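/- Let k be an algebraically closed field (of arbitrary characteristic), let n ≥ 3, let ℓ be a prime, and let X be a k-variety admitting a dominant morphism f : X → Sym^ℓ Y such that (i) Y is a retract rational k-variety and (ii) the generic fibre of f is birational over K := k(Sym^ℓ Y) to the norm hypersurface {N = a} ⊂ R_{L/K} G_{m,L}, where L := k(Y × Sym^{ℓ-1} Y), N is the norm map of the degree-ℓ extension L/K, and a ∈ k^*. Then X is retract rational over k. -/

import Mathlib

open AlgebraicGeometry CategoryTheory CategoryTheory.Limits TopologicalSpace

universe u

attribute [local instance] MvPolynomial.gradedAlgebra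

noncomputable def ProjSpace (k : Type u) [Field k] (N : ℕ) : Scheme.{u} :=
  Proj (MvPolynomial.homogeneousSubmodule (Fin (N + 1)) k)

noncomputable def ProjSpace.structMap (k : Type u) [Field k] (N : ℕ) :
    ProjSpace k N ⟶ Spec (CommRingCat.of k) :=
  Proj.toSpecZero _ ≫ Spec.map (CommRingCat.ofHom
    ((GradedRing.projZeroRingHom' (MvPolynomial.homogeneousSubmodule (Fin (N + 1)) k)).comp
      (MvPolynomial.C : k →+* MvPolynomial (Fin (N + 1)) k)))

def AlgebraicGeometry.Scheme.PartialMap.CompEqId {X Y : Scheme.{u}}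
    (f : X.PartialMap Y) (g : Y.PartialMap X) : Prop :=
  ∃ (U : X.Opens) (_ : Dense (U : Set X)) (hle : U ≤ f.domain)
    (lift : (U : Scheme.{u}) ⟶ (g.domain : Scheme.{u})),
      lift ≫ g.domain.ι = X.homOfLE hle ≫ f.hom ∧ lift ≫ g.hom = U.ι

def AlgebraicGeometry.Scheme.PartialMap.IsOverStruct {X Y B : Scheme.{u}}
    (sX : X ⟶ B) (sY : Y ⟶ B) (f : X.PartialMap Y) : Prop :=
  f.hom ≫ sY = f.domain.ι ≫ sX

/-- A scheme `X` with structure morphism `sX` over a field `K` is retract rational if the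
identity on `X` factors rationally through some projective space `ℙ^N_K`:  there are
rational (partial) maps `f : X ⤏ ℙ^N` and `g : ℙ^N ⤏ X` over `K` such that `g ∘ f` is
defined and agrees with the identity as a rational map. -/
def IsRetractRational (K : Type u) [Field K] (X : Scheme.{u})
    (sX : X ⟶ Spec (CommRingCat.of K)) : Prop :=
  ∃ (N : ℕ), 1 ≤ N ∧
    ∃ (f : X.PartialMap (ProjSpace K N)) (g : (ProjSpace K N).PartialMap X),
      f.IsOverStruct sX (ProjSpace.structMap K N) ∧
      g.IsOverStruct (ProjSpace.structMap K N) sX ∧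
      f.CompEqId g

/-- Base change of a `k`-scheme along a field extension `k → K`. -/
noncomputable def baseChange {k : Type u} [Field k] (K : Type u) [Field K] [Algebra k K]
    {X : Scheme.{u}} (sX : X ⟶ Spec (CommRingCat.of k)) : Scheme.{u} :=
  Limits.pullback sX (Spec.map (CommRingCat.ofHom (algebraMap k K)))

/-- The structure morphism of the base change. -/
noncomputable def baseChangeStruct {k : Type u} [Field k] (K : Type u) [Field K] [Algebra k K]
    {X : Scheme.{u}} (sX : X ⟶ Spec (CommRingCat.of k)) :
    baseChange K sX ⟶ Spec (CommRingCat.of K) :=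
  Limits.pullback.snd sX (Spec.map (CommRingCat.ofHom (algebraMap k K)))

/-- A `k`-scheme is geometrically retract rational if its base change to an algebraic
closure of `k` is retract rational. -/
def IsGeometricallyRetractRational (k : Type u) [Field k] (X : Scheme.{u})
    (sX : X ⟶ Spec (CommRingCat.of k)) : Prop :=
  IsRetractRational (AlgebraicClosure k) (baseChange (AlgebraicClosure k) sX)
    (baseChangeStruct (AlgebraicClosure k) sX)

/-- A partial (rational) map `f : X ⤏ Y` is generically injective if on suitable dense open
subsets `U ⊆ X` and `V ⊆ Y` it restricts to a closed embedding `U ↪ V`. -/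
def AlgebraicGeometry.Scheme.PartialMap.GenericallyInjective {X Y : Scheme.{u}}
    (f : X.PartialMap Y) : Prop :=
  ∃ (U : X.Opens) (_ : Dense (U : Set X)) (hle : U ≤ f.domain)
    (V : Y.Opens) (_ : Dense (V : Set Y)) (h : (U : Scheme.{u}) ⟶ (V : Scheme.{u})),
      h ≫ V.ι = X.homOfLE hle ≫ f.hom ∧ IsClosedImmersion h

/-- A `K`-scheme is unirational if it admits a dominant rational map from some
projective space over `K`. -/
def IsUnirational (K : Type u) [Field K] (X : Scheme.{u})
    (sX : X ⟶ Spec (CommRingCat.of K)) : Prop :=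
  ∃ (N : ℕ) (g : (ProjSpace K N).PartialMap X),
    g.IsOverStruct (ProjSpace.structMap K N) sX ∧ IsDominant g.hom

/-- Two schemes over a base are birational (over the base) if there are rational maps
between them, over the base, which are mutually inverse as rational maps. -/
def AreBirationalOver {X Y B : Scheme.{u}} (sX : X ⟶ B) (sY : Y ⟶ B) : Prop :=
  ∃ (f : X.PartialMap Y) (g : Y.PartialMap X),
    f.IsOverStruct sX sY ∧ g.IsOverStruct sY sX ∧ f.CompEqId g ∧ g.CompEqId f

noncomputable section NormTorus

open scoped TensorProduct

variable (K L : Type u) [Field K] [Field L] [Algebra K L] [FiniteDimensional K L]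

/-- The generic element `∑ xᵢ ⊗ bᵢ` of the Weil restriction `R_{L/K} 𝔾_m`, written in the
coordinates given by a fixed basis of `L` over `K`. -/
def genericElement :
    TensorProduct K (MvPolynomial (Fin (Module.finrank K L)) K) L :=
  ∑ i, (MvPolynomial.X i) ⊗ₜ[K] (Module.finBasis K L i)

/-- The norm form of `L/K`: the norm of the generic element of the Weil restriction
`R_{L/K} 𝔾_{m,L}`, a polynomial of degree `[L : K]` in `[L : K]` variables.  The induced
map on points is the norm map `N : R_{L/K} 𝔾_{m,L} → 𝔾_{m,K}`. -/
def normForm : MvPolynomial (Fin (Module.finrank K L)) K :=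
  Algebra.norm (MvPolynomial (Fin (Module.finrank K L)) K) (genericElement K L)

/-- The coordinate ring of the norm hypersurface `{N = a}` inside `R_{L/K} 𝔾_{m,L}`. -/
def NormHypersurfaceRing (a : K) : Type u :=
  MvPolynomial (Fin (Module.finrank K L)) K ⧸
    Ideal.span {normForm K L - MvPolynomial.C a}

instance (a : K) : CommRing (NormHypersurfaceRing K L a) :=
  Ideal.Quotient.commRing _

instance (a : K) : Algebra K (NormHypersurfaceRing K L a) :=
  Ideal.Quotient.algebra _

/-- The norm hypersurface `{N = a} ⊆ R_{L/K} 𝔾_{m,L}`, as an affine `K`-scheme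
(for `a = 1` this is the norm-one torus of `L/K`). -/
def NormHypersurface (a : K) : Scheme.{u} :=
  Spec (CommRingCat.of (NormHypersurfaceRing K L a))

/-- The structure morphism of the norm hypersurface over `K`. -/
def NormHypersurface.structMap (a : K) :
    NormHypersurface K L a ⟶ Spec (CommRingCat.of K) :=
  Spec.map (CommRingCat.ofHom (algebraMap K (NormHypersurfaceRing K L a)))

end NormTorus

noncomputable section SymmetricPower

/-- The `m`-fold fibre power `Y ×ₖ ⋯ ×ₖ Y` of a `k`-scheme `Y`, as an object of the
category of schemes over `Spec k`. -/
def fibrePower (k : Type u) [Field k] {Y : Scheme.{u}}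
    (sY : Y ⟶ Spec (CommRingCat.of k)) (m : ℕ) : Over (Spec (CommRingCat.of k)) :=
  ∏ᶜ (fun _ : Fin m => Over.mk sY)

/-- The action of a permutation `σ ∈ S_m` on the `m`-fold fibre power, permuting the
factors. -/
def permAction (k : Type u) [Field k] {Y : Scheme.{u}}
    (sY : Y ⟶ Spec (CommRingCat.of k)) (m : ℕ) (σ : Equiv.Perm (Fin m)) :
    fibrePower k sY m ⟶ fibrePower k sY m :=
  Limits.Pi.lift (fun i => Limits.Pi.π _ (σ i))

/-- `q : Y^m → S` exhibits `S` as the `m`-th symmetric power `Sym^m Y = Y^m / S_m` of the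
`k`-scheme `Y`:  `q` is invariant under the permutation action of the symmetric group
`S_m` and is a categorical quotient by this action in the category of `k`-schemes. -/
def IsSymmetricPower (k : Type u) [Field k] {Y S : Scheme.{u}}
    (sY : Y ⟶ Spec (CommRingCat.of k)) (sS : S ⟶ Spec (CommRingCat.of k)) (m : ℕ)
    (q : fibrePower k sY m ⟶ Over.mk sS) : Prop :=
  (∀ σ : Equiv.Perm (Fin m), permAction k sY m σ ≫ q = q) ∧
  ∀ (T : Over (Spec (CommRingCat.of k))) (h : fibrePower k sY m ⟶ T),
    (∀ σ : Equiv.Perm (Fin m), permAction k sY m σ ≫ h = h) →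
      ∃! t : Over.mk sS ⟶ T, q ≫ t = h

end SymmetricPower

/-- The canonical map `k → k(S)` from the base field to the function field of an
irreducible `k`-scheme `S`, induced by the structure morphism. -/
noncomputable def functionFieldAlgebraMap {k : Type u} [Field k] {S : Scheme.{u}}
    [IrreducibleSpace S] (sS : S ⟶ Spec (CommRingCat.of k)) :
    CommRingCat.of k ⟶ S.functionField :=
  (Scheme.ΓSpecIso (CommRingCat.of k)).inv ≫ sS.appTop ≫
    S.presheaf.germ ⊤ (genericPoint S) trivial

/-- The generic fibre of a morphism `f : X' ⟶ S` with `S` irreducible:  the fibre of `f`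
over the generic point of `S`, a scheme over the function field `K = k(S)`. -/
noncomputable def GenericFibre {X' S : Scheme.{u}} [IrreducibleSpace S] (f : X' ⟶ S) :
    Scheme.{u} :=
  Limits.pullback f (S.fromSpecStalk (genericPoint S))

/-- The structure morphism of the generic fibre over `Spec k(S)`. -/
noncomputable def GenericFibre.structMap {X' S : Scheme.{u}} [IrreducibleSpace S]
    (f : X' ⟶ S) : GenericFibre f ⟶ Spec (CommRingCat.of (S.functionField)) :=
  Limits.pullback.snd f (S.fromSpecStalk (genericPoint S))

/-- The generic fibre of `f : X' ⟶ S` is birational, over `K := k(S)`, to the norm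
hypersurface `{N = aₙ} ⊆ R_{L/K} 𝔾_{m,L}`, where `L/K` is a degree-`ℓ` field extension
isomorphic (as a ring) to the function field of `P` (in the application, `P` is the
product `Y × Sym^{ℓ-1} Y`), `N` is the norm map of `L/K`, and `aₙ ∈ k` is viewed in `K`
via the structure morphism. -/
def NormHypFibreData (k : Type u) [Field k] (ℓ : ℕ) (aN : k)
    {X' S P : Scheme.{u}} (f : X' ⟶ S) (sS : S ⟶ Spec (CommRingCat.of k))
    [IsIntegral S] [IrreducibleSpace P] : Prop :=
  ∃ (L : Type u) (iL : Field L), by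
    letI := iL
    exact ∃ iA : Algebra (S.functionField) L, by
      letI := iA
      exact Module.finrank (S.functionField) L = ℓ ∧
        Nonempty (L ≃+* P.functionField) ∧
        ∃ ifd : FiniteDimensional (S.functionField) L, by
          letI := ifd
          exact AreBirationalOver (GenericFibre.structMap f)
            (NormHypersurface.structMap (S.functionField) L (functionFieldAlgebraMap sS aN))

section

/-- A field extension `φ : k → E` has local sections if every surjection from a local
`k`-algebra onto `E` splits over `k`.  For the function field of a variety this is a
reformulation of retract rationality. -/
def HasLocalSections {k E : Type u} [Field k] [Field E] (φ : k →+* E) : Prop :=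
  ∀ (R : Type u) [CommRing R] (κ : k →+* R) (π : R →+* E) [IsLocalHom π],
    Function.Surjective π → π.comp κ = φ →
      ∃ s : E →+* R, π.comp s = RingHom.id E ∧ s.comp φ = κ

namespace HasLocalSections

variable {k E : Type u} [Field k] [Field E] {φ : k →+* E}

theorem lift (h : HasLocalSections φ) {Q Ω : Type u} [CommRing Q] [Field Ω] (κ : k →+* Q)
    (π : Q →+* Ω) [IsLocalHom π] (j : E →+* Ω) (hκ : π.comp κ = j.comp φ)
    (hj : j.range ≤ π.range) : ∃ s : E →+* Q, π.comp s = j ∧ s.comp φ = κ := by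
  let R : Subring Q := j.range.comap π
  have hR : ∀ x : R, ∃ e, j e = π x := fun x => x.2
  choose p hp using hR
  let πR : R →+* E :=
    { toFun := p
      map_one' := j.injective (by simp [hp])
      map_mul' := fun x y => j.injective (by simp [hp])
      map_zero' := j.injective (by simp [hp])
      map_add' := fun x y => j.injective (by simp [hp]) }
  have hπR : ∀ x, j (πR x) = π x := hp
  have hloc : IsLocalHom πR := by
    constructor
    intro x hx
    have hx' : IsUnit (π x) := by rw [← hπR]; exact hx.map j
    obtain ⟨y, hy⟩ := (isUnit_of_map_unit π _ hx').exists_right_inv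
    obtain ⟨z, hz⟩ := hx.exists_right_inv
    have hyR : y ∈ R := by
      refine ⟨z, ?_⟩
      have h1 : π x * j z = 1 := by rw [← hπR, ← map_mul, hz, map_one]
      have h2 : π x * π y = 1 := by rw [← map_mul, hy, map_one]
      exact hx'.mul_left_cancel (h1.trans h2.symm)
    exact IsUnit.of_mul_eq_one ⟨y, hyR⟩ (Subtype.ext hy)
  have hsurj : Function.Surjective πR := by
    intro e
    obtain ⟨x, hx⟩ := hj ⟨e, rfl⟩
    exact ⟨⟨x, ⟨e, hx.symm⟩⟩, j.injective ((hπR _).trans hx)⟩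
  let κR : k →+* R := κ.codRestrict R fun x => ⟨φ x, (RingHom.congr_fun hκ x).symm⟩
  obtain ⟨s, hs1, hs2⟩ := h R κR πR hsurj (by
    ext x
    exact j.injective ((hπR _).trans (RingHom.congr_fun hκ x)))
  refine ⟨R.subtype.comp s, ?_, ?_⟩
  · ext e
    have := RingHom.congr_fun hs1 e
    change π (s e) = j e
    rw [← hπR]
    exact congrArg j this
  · ext x
    exact congrArg Subtype.val (RingHom.congr_fun hs2 x)

theorem of_range_eq (h : HasLocalSections φ) {φ' : k →+* E} (he : φ'.range = φ.range) :
    HasLocalSections φ' := by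
  intro R _ κ π _ hπ hκ
  have h1 : ∀ x, ∃ y, φ' y = φ x := fun x => by
    have : φ x ∈ φ'.range := he ▸ ⟨x, rfl⟩
    exact this
  choose p hp using h1
  let e : k →+* k :=
    { toFun := p
      map_one' := φ'.injective (by simp [hp])
      map_mul' := fun x y => φ'.injective (by simp [hp])
      map_zero' := φ'.injective (by simp [hp])
      map_add' := fun x y => φ'.injective (by simp [hp]) }
  obtain ⟨s, hs1, hs2⟩ := h R (κ.comp e) π hπ (by
    ext x
    exact (RingHom.congr_fun hκ (p x)).trans (hp x))
  refine ⟨s, hs1, ?_⟩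
  ext y
  obtain ⟨x, hx⟩ : φ' y ∈ φ.range := he ▸ ⟨y, rfl⟩
  have : p x = y := φ'.injective ((hp x).trans hx)
  rw [RingHom.comp_apply, ← hx]
  exact (RingHom.congr_fun hs2 x).trans (congrArg κ this)

theorem of_ringEquiv (h : HasLocalSections φ) {E' : Type u} [Field E'] (e : E ≃+* E') :
    HasLocalSections ((e : E →+* E').comp φ) := by
  intro R _ κ π _ hπ hκ
  obtain ⟨s, hs1, hs2⟩ := h.lift κ π (e : E →+* E') hκ (by
    rintro _ ⟨x, rfl⟩
    exact hπ _)
  refine ⟨s.comp (e.symm : E' →+* E), ?_, ?_⟩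
  · ext x
    simpa using RingHom.congr_fun hs1 (e.symm x)
  · ext x
    simpa using RingHom.congr_fun hs2 x

end HasLocalSections

/-- If the algebra homomorphisms `τ i : C → Q` from a free `R`-algebra of rank `m` separate a
basis, the norm is the product of the `τ i`. -/
theorem Algebra.algebraMap_norm_eq_prod_of_isUnit_det {R Q C ι : Type*} [CommRing R] [CommRing Q]
    [CommRing C] [Algebra R C] [Algebra R Q] [Fintype ι] [DecidableEq ι] (b : Module.Basis ι R C)
    (τ : ι → C →ₐ[R] Q) (h : IsUnit (Matrix.of fun i j => τ i (b j)).det) (c : C) :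
    algebraMap R Q (Algebra.norm R c) = ∏ i, τ i c := by
  set A : Matrix ι ι Q := Matrix.of fun i j => τ i (b j)
  have key : A * (Algebra.leftMulMatrix b c).map (algebraMap R Q) =
      Matrix.diagonal (fun i => τ i c) * A := by
    ext i j
    rw [Matrix.mul_apply, Matrix.diagonal_mul]
    simp only [A, Matrix.of_apply, Matrix.map_apply]
    rw [← map_mul, ← b.sum_repr (c * b j), map_sum]
    refine Finset.sum_congr rfl fun l _ => ?_
    rw [map_smul, Algebra.leftMulMatrix_eq_repr_mul, Algebra.smul_def, mul_comm]
  have hdet := congrArg Matrix.det key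
  rw [Matrix.det_mul, Matrix.det_mul, Matrix.det_diagonal, mul_comm] at hdet
  rw [Algebra.norm_eq_matrix_det b, RingHom.map_det]
  exact h.mul_right_cancel hdet

end

section

theorem RingHom.ker_le_jacobson_of_isLocalHom {R S : Type*} [CommRing R] [CommRing S]
    (π : R →+* S) [IsLocalHom π] : RingHom.ker π ≤ (⊥ : Ideal R).jacobson := by
  intro x hx
  rw [Ideal.mem_jacobson_bot]
  intro y
  apply isUnit_of_map_unit π
  rw [RingHom.mem_ker] at hx
  simp [hx]

theorem Ideal.map_le_jacobson_bot_of_isIntegral {R C : Type*} [CommRing R] [CommRing C]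
    [Algebra R C] [Algebra.IsIntegral R C] {I : Ideal R} (hI : I ≤ (⊥ : Ideal R).jacobson) :
    I.map (algebraMap R C) ≤ (⊥ : Ideal C).jacobson := by
  rw [Ideal.map_le_iff_le_comap]
  intro x hx
  rw [Ideal.mem_comap, Ideal.jacobson, Ideal.mem_sInf]
  rintro J ⟨-, hJ⟩
  have := Ideal.isMaximal_comap_of_isIntegral_of_isMaximal (R := R) J
  have hx' := hI hx
  rw [Ideal.jacobson, Ideal.mem_sInf] at hx'
  exact hx' ⟨bot_le, this⟩

theorem RingHom.isLocalHom_of_ker_le_jacobson {C D : Type*} [CommRing C] [CommRing D]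
    (f : C →+* D) (hf : Function.Surjective f) (hk : RingHom.ker f ≤ (⊥ : Ideal C).jacobson) :
    IsLocalHom f := by
  constructor
  intro x hx
  obtain ⟨z, hz⟩ := hx.exists_right_inv
  obtain ⟨y, rfl⟩ := hf z
  have h1 : x * y - 1 ∈ RingHom.ker f := by
    rw [RingHom.mem_ker, map_sub, map_mul, hz, map_one, sub_self]
  have h2 := (Ideal.mem_jacobson_bot.mp (hk h1)) 1
  rw [mul_one, sub_add_cancel] at h2
  exact isUnit_of_mul_isUnit_left h2

theorem AdjoinRoot.map_mk {R K : Type*} [CommRing R] [CommRing K] (π : R →+* K)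
    (p : Polynomial R) (q : Polynomial K) (h : q ∣ p.map π) (g : Polynomial R) :
    AdjoinRoot.map π p q h (AdjoinRoot.mk p g) = AdjoinRoot.mk q (g.map π) := by
  rw [AdjoinRoot.map, AdjoinRoot.lift_mk, ← Polynomial.eval₂_map, ← AdjoinRoot.algebraMap_eq,
    ← Polynomial.aeval_def, AdjoinRoot.aeval_eq]

theorem AdjoinRoot.isLocalHom_map {R K : Type*} [CommRing R] [CommRing K] (π : R →+* K)
    [IsLocalHom π] (hπ : Function.Surjective π) (p : Polynomial R) (hp : p.Monic)
    (q : Polynomial K) (hq : p.map π = q) (h : q ∣ p.map π) :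
    IsLocalHom (AdjoinRoot.map π p q h) := by
  have : Module.Finite R (AdjoinRoot p) := hp.finite_adjoinRoot
  apply RingHom.isLocalHom_of_ker_le_jacobson
  · intro x
    obtain ⟨g, rfl⟩ := AdjoinRoot.mk_surjective x
    obtain ⟨g', rfl⟩ := Polynomial.map_surjective π hπ g
    exact ⟨AdjoinRoot.mk p g', AdjoinRoot.map_mk π p q h g'⟩
  · refine le_trans ?_ (Ideal.map_le_jacobson_bot_of_isIntegral
      (RingHom.ker_le_jacobson_of_isLocalHom π))
    intro x hx
    obtain ⟨g, rfl⟩ := AdjoinRoot.mk_surjective x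
    rw [RingHom.mem_ker, AdjoinRoot.map_mk, AdjoinRoot.mk_eq_zero, ← hq] at hx
    obtain ⟨d, hd⟩ := hx
    obtain ⟨d', rfl⟩ := Polynomial.map_surjective π hπ d
    have h1 : g - p * d' ∈ RingHom.ker (Polynomial.mapRingHom π) := by
      rw [RingHom.mem_ker, map_sub, map_mul, sub_eq_zero]
      exact hd
    have h2 : AdjoinRoot.mk p g = AdjoinRoot.mk p (g - p * d') := by
      rw [map_sub, map_mul, AdjoinRoot.mk_self, zero_mul, sub_zero]
    rw [Polynomial.ker_mapRingHom] at h1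
    rw [h2]
    have h3 := Ideal.mem_map_of_mem (AdjoinRoot.mk p) h1
    rwa [Ideal.map_map] at h3

/-- A polynomial over `M` taking values in a subfield on infinitely many of its elements is
defined over that subfield. -/
theorem Polynomial.mem_lifts_of_eval_mem {K M : Type*} [Field K] [Field M] (c : K →+* M)
    (S : Set K) (hS : S.Infinite) (P : Polynomial M) (h : ∀ x ∈ S, P.eval (c x) ∈ c.range) :
    P ∈ Polynomial.lifts c := by
  classical
  obtain ⟨t, htS, htc⟩ := hS.exists_subset_card_eq (P.natDegree + 1)
  choose! r hr using h
  have hinj : Set.InjOn c (t : Set K) := c.injective.injOn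
  have : P = Lagrange.interpolate t c (fun x => c (r x)) := by
    apply Lagrange.eq_interpolate_of_eval_eq _ hinj
    · rw [htc]
      exact lt_of_le_of_lt Polynomial.degree_le_natDegree (by exact_mod_cast Nat.lt_succ_self _)
    · intro i hi
      exact (hr i (htS hi)).symm
  refine (Polynomial.mem_lifts P).mpr ⟨Lagrange.interpolate t id r, ?_⟩
  rw [this]
  apply Lagrange.eq_interpolate_of_eval_eq _ hinj
  · rw [Polynomial.degree_map]
    exact Lagrange.degree_interpolate_lt _ Function.injective_id.injOn
  · intro i hi
    rw [Polynomial.eval_map, Polynomial.eval₂_at_apply]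
    congr 1
    exact Lagrange.eval_interpolate_at_node r (v := id) Function.injective_id.injOn hi

end

section

/-- The structure carried by the function field `M` of the `m`-th fibre power of a variety with
function field `E` over `k`: the embeddings of `E` given by the projections, the action of the
symmetric group, and the lifting property coming from the universal property of the product. -/
structure FieldPower {k E : Type u} [Field k] [Field E] (φ : k →+* E) (m : ℕ) (M : Type u)
    [Field M] where
  /-- the embeddings induced by the projections -/
  emb : Fin m → E →+* M
  /-- the action of the symmetric group -/
  act : Equiv.Perm (Fin m) → M →+* M
  act_emb : ∀ σ i e, act σ (emb i e) = emb (σ i) e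
  emb_base : ∀ i j x, emb i (φ x) = emb j (φ x)
  exists_lift : ∀ (Q Ω : Type u) [CommRing Q] [Field Ω] (π : Q →+* Ω) [IsLocalHom π]
    (j : M →+* Ω) (s : Fin m → E →+* Q), (∀ i e, π (s i e) = j (emb i e)) →
    (∀ i i' x, s i (φ x) = s i' (φ x)) → ∃ ρ : M →+* Q, π.comp ρ = j ∧ ∀ i e, ρ (emb i e) = s i e

namespace FieldPower

variable {k E : Type u} [Field k] [Field E] {φ : k →+* E} {m : ℕ} {M : Type u} [Field M]
  (P : FieldPower φ m M)

include P in
theorem subfield_eq_top (M₀ : Subfield M) (h : ∀ i e, P.emb i e ∈ M₀) : M₀ = ⊤ := by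
  have : IsLocalHom M₀.subtype := inferInstance
  obtain ⟨ρ, hρ, -⟩ := P.exists_lift M₀ M M₀.subtype (RingHom.id M)
    (fun i => (P.emb i).codRestrict M₀ (h i)) (fun i e => rfl)
    (fun i i' x => Subtype.ext (P.emb_base i i' x))
  rw [eq_top_iff]
  intro x _
  rw [← RingHom.id_apply x, ← hρ]
  exact (ρ x).2

theorem hom_ext {N : Type*} [Field N] {f g : M →+* N} (h : ∀ i e, f (P.emb i e) = g (P.emb i e)) :
    f = g := by
  have := P.subfield_eq_top (f.eqLocusField g) h
  ext x
  exact (this ▸ Subfield.mem_top x : x ∈ f.eqLocusField g)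

theorem emb_eq_of_not_injective (h : ¬ Function.Injective P.emb) (i j : Fin m) :
    P.emb i = P.emb j := by
  by_cases hij : i = j
  · rw [hij]
  simp only [Function.Injective, not_forall] at h
  obtain ⟨a, b, hab, hne⟩ := h
  obtain ⟨σ, hσ⟩ : ∃ σ : Equiv.Perm (Fin m), σ a = i ∧ σ b = j := by
    refine ⟨Equiv.swap j (Equiv.swap a i b) * Equiv.swap a i, ?_, ?_⟩
    · rw [Equiv.Perm.mul_apply, Equiv.swap_apply_left]
      refine Equiv.swap_apply_of_ne_of_ne hij ?_
      intro h
      exact hne ((Equiv.swap a i).injective ((Equiv.swap_apply_left a i).trans h))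
    · rw [Equiv.Perm.mul_apply, Equiv.swap_apply_right]
  ext e
  rw [← hσ.1, ← hσ.2, ← P.act_emb, ← P.act_emb, hab]

theorem exists_separating [Infinite k] (h : Function.Injective P.emb) :
    ∃ θ : E, Function.Injective fun i => P.emb i θ := by
  classical
  rcases isEmpty_or_nonempty (Fin m) with hm | ⟨⟨i₀⟩⟩
  · exact ⟨0, Function.injective_of_subsingleton _⟩
  let iA : Algebra k E := φ.toAlgebra
  let iM : Algebra k M := ((P.emb i₀).comp φ).toAlgebra
  let f : Fin m → E →ₐ[k] M := fun i =>
    { P.emb i with commutes' := fun x => P.emb_base i i₀ x }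
  let s : Finset (Submodule k E) :=
    (Finset.univ.filter fun p : Fin m × Fin m => p.1 ≠ p.2).image
      fun p => LinearMap.eqLocus (f p.1).toLinearMap (f p.2).toLinearMap
  have hs : ⊤ ∉ s := by
    intro hs
    obtain ⟨p, hp, he⟩ := Finset.mem_image.mp hs
    refine (Finset.mem_filter.mp hp).2 (h ?_)
    ext e
    exact (he ▸ Submodule.mem_top :
      e ∈ LinearMap.eqLocus (f p.1).toLinearMap (f p.2).toLinearMap)
  have h1 := Subspace.biUnion_ne_univ_of_top_notMem hs
  obtain ⟨θ, hθ⟩ := (Set.ne_univ_iff_exists_notMem _).mp h1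
  refine ⟨θ, fun i j hij => ?_⟩
  by_contra hne
  refine hθ (Set.mem_biUnion (Finset.mem_coe.mpr (Finset.mem_image.mpr
    ⟨(i, j), Finset.mem_filter.mpr ⟨Finset.mem_univ _, hne⟩, rfl⟩)) ?_)
  exact hij

end FieldPower

end

section

namespace FieldPower

variable {k E : Type u} [Field k] [Field E] {φ : k →+* E} {m : ℕ} {M : Type u} [Field M]
  (P : FieldPower φ m M)

open Polynomial in
theorem mem_of_prod_mem_of_act_eq [Infinite k] (hm : 0 < m) {θ : E}
    (hθ : Function.Injective fun i => P.emb i θ) (K₀ : Subfield M)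
    (hk : ∀ i x, P.emb i (φ x) ∈ K₀) (hN : ∀ e, ∏ i, P.emb i e ∈ K₀) {x : M}
    (hx : ∀ σ, P.act σ x = x) : x ∈ K₀ := by
  let i₀ : Fin m := ⟨0, hm⟩
  let ψ : k →+* K₀ := ((P.emb i₀).comp φ).codRestrict K₀ (hk i₀)
  have hψ : ∀ i x, ((ψ x : K₀) : M) = P.emb i (φ x) := fun i x => P.emb_base i₀ i x
  have hS : (Set.range ψ).Infinite := Set.infinite_range_of_injective ψ.injective
  have hlift : ∀ Q : M[X], (∀ y : k, Q.eval (ψ y : M) ∈ K₀) → Q ∈ Polynomial.lifts K₀.subtype := by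
    intro Q hQ
    refine Polynomial.mem_lifts_of_eval_mem K₀.subtype _ hS Q ?_
    rintro _ ⟨y, rfl⟩
    exact ⟨⟨_, hQ y⟩, rfl⟩
  have hchar : ∏ i, (X - C (P.emb i θ)) ∈ Polynomial.lifts K₀.subtype := by
    refine hlift _ fun y => ?_
    rw [eval_prod]
    convert hN (φ y - θ) using 2 with i
    rw [eval_sub, eval_X, eval_C, map_sub, hψ i]
  let D : E → M[X] := fun e => ∑ i, C (P.emb i e) * ∏ j ∈ Finset.univ.erase i, (X - C (P.emb j θ))
  have hD : ∀ e, D e ∈ Polynomial.lifts K₀.subtype := by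
    intro e
    refine hlift _ fun y => ?_
    have h1 : ∏ i, (C ((ψ y : M) - P.emb i θ) + C (P.emb i e) * X) ∈
        Polynomial.lifts K₀.subtype := by
      refine hlift _ fun z => ?_
      rw [eval_prod]
      convert hN (φ y - θ + e * φ z) using 2 with i
      rw [eval_add, eval_mul, eval_X, eval_C, eval_C, map_add, map_mul, map_sub, hψ i, hψ i]
    obtain ⟨q, hq⟩ := (Polynomial.mem_lifts _).mp h1
    have h2 : (D e).eval (ψ y : M) = (q.derivative.eval 0 : K₀) := by
      have h3 := congrArg (fun p => eval 0 (derivative p)) hq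
      simp only [derivative_map] at h3
      rw [← map_zero K₀.subtype, Polynomial.eval_map, eval₂_at_apply] at h3
      refine Eq.trans ?_ h3.symm
      rw [map_zero, derivative_prod_finset, eval_finsetSum, eval_finsetSum]
      refine Finset.sum_congr rfl fun i _ => ?_
      rw [eval_mul, eval_mul, eval_prod, eval_prod, mul_comm]
      simp
    rw [h2]
    exact SetLike.coe_mem _
  have hDeval : ∀ e i, (D e).eval (P.emb i θ) =
      P.emb i e * ∏ j ∈ Finset.univ.erase i, (P.emb i θ - P.emb j θ) := by
    intro e i
    rw [eval_finsetSum, Finset.sum_eq_single i]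
    · rw [eval_mul, eval_C, eval_prod]
      simp
    · intro j _ hj
      rw [eval_mul, eval_prod, Finset.prod_eq_zero (Finset.mem_erase.mpr ⟨hj.symm, Finset.mem_univ i⟩),
        mul_zero]
      simp
    · simp
  have hne : ∀ i, ∏ j ∈ Finset.univ.erase i, (P.emb i θ - P.emb j θ) ≠ 0 := by
    intro i
    refine Finset.prod_ne_zero_iff.mpr fun j hj => sub_ne_zero.mpr fun h => ?_
    exact (Finset.mem_erase.mp hj).1 (hθ h).symm
  obtain ⟨p, hp⟩ := (Polynomial.mem_lifts _).mp hchar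
  have hp' : p.map (algebraMap K₀ M) = ∏ i, (X - C (P.emb i θ)) := hp
  have hroots : ∀ y, y ∈ p.rootSet M ↔ ∃ i, y = P.emb i θ := by
    intro y
    have hp0 : p.map (algebraMap K₀ M) ≠ 0 := by
      rw [hp']
      exact Finset.prod_ne_zero_iff.mpr fun i _ => X_sub_C_ne_zero _
    rw [mem_rootSet', and_iff_right hp0, aeval_def, ← Polynomial.eval_map, hp', eval_prod,
      Finset.prod_eq_zero_iff]
    simp [sub_eq_zero]
  choose d hd using fun e => (Polynomial.mem_lifts _).mp (hD e)
  have hadj : IntermediateField.adjoin K₀ (p.rootSet M) = ⊤ := by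
    set F := IntermediateField.adjoin K₀ (p.rootSet M)
    have hF : ∀ i, P.emb i θ ∈ F := fun i =>
      IntermediateField.subset_adjoin _ _ ((hroots _).mpr ⟨i, rfl⟩)
    have h1 : ∀ i e, P.emb i e ∈ F.toSubfield := by
      intro i e
      have h2 : (D e).eval (P.emb i θ) ∈ F := by
        rw [← hd e]
        change eval _ ((d e).map (algebraMap K₀ M)) ∈ F
        rw [Polynomial.eval_map, ← aeval_def, aeval_eq_sum_range]
        exact sum_mem fun n _ => F.smul_mem (pow_mem (hF i) n)
      rw [hDeval] at h2
      have h3 : ∏ j ∈ Finset.univ.erase i, (P.emb i θ - P.emb j θ) ∈ F :=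
        prod_mem fun j _ => sub_mem (hF i) (hF j)
      have h4 := div_mem h2 h3
      rwa [mul_div_cancel_right₀ _ (hne i)] at h4
    have h2 := P.subfield_eq_top F.toSubfield h1
    rw [eq_top_iff]
    intro y _
    exact (h2 ▸ Subfield.mem_top y : y ∈ F.toSubfield)
  have hsplit : p.IsSplittingField K₀ M := by
    rw [isSplittingField_iff_intermediateField]
    refine ⟨?_, hadj⟩
    rw [hp']
    exact Splits.prod fun i _ => Splits.X_sub_C _
  have hsep : p.Separable := by
    rw [← separable_map (algebraMap K₀ M), hp']
    exact separable_prod_X_sub_C_iff.mpr hθ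
  have : IsGalois K₀ M := IsGalois.of_separable_splitting_field hsep
  have : FiniteDimensional K₀ M := IsSplittingField.finiteDimensional M p
  have hfix : ∀ g : Gal(M/K₀), g x = x := by
    intro g
    have h1 : ∀ i, ∃ i', g (P.emb i θ) = P.emb i' θ := fun i => by
      rw [← hroots]
      have h2 := (hroots (P.emb i θ)).mpr ⟨i, rfl⟩
      rw [mem_rootSet'] at h2 ⊢
      refine ⟨h2.1, ?_⟩
      change aeval (g.toAlgHom (P.emb i θ)) p = 0
      rw [aeval_algHom_apply, h2.2, map_zero]
    choose τ hτ using h1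
    have hτi : Function.Injective τ := by
      intro a b hab
      apply hθ
      apply g.injective
      change g (P.emb a θ) = g (P.emb b θ)
      rw [hτ, hτ, hab]
    let σ : Equiv.Perm (Fin m) := Equiv.ofBijective τ (Finite.injective_iff_bijective.mp hτi)
    have hgσ : (g.toAlgHom.toRingHom : M →+* M) = P.act σ := by
      refine P.hom_ext fun i e => ?_
      rw [P.act_emb]
      change g (P.emb i e) = P.emb (τ i) e
      have h2 := congrArg g (hDeval e i)
      rw [map_mul, map_prod] at h2
      have h3 : g ((D e).eval (P.emb i θ)) = (D e).eval (P.emb (τ i) θ) := by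
        rw [← hd e]
        change g (eval _ ((d e).map (algebraMap K₀ M))) = eval _ ((d e).map (algebraMap K₀ M))
        rw [Polynomial.eval_map, Polynomial.eval_map, ← aeval_def, ← aeval_def, ← hτ]
        exact (aeval_algHom_apply g.toAlgHom (P.emb i θ) (d e)).symm
      have h4 : ∏ j ∈ Finset.univ.erase i, g (P.emb i θ - P.emb j θ) =
          ∏ j ∈ Finset.univ.erase (τ i), (P.emb (τ i) θ - P.emb j θ) := by
        refine Finset.prod_bij (fun j _ => τ j) ?_ ?_ ?_ ?_
        · intro j hj
          exact Finset.mem_erase.mpr ⟨fun h => (Finset.mem_erase.mp hj).1 (hτi h), Finset.mem_univ _⟩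
        · intro a _ b _ hab
          exact hτi hab
        · intro b hb
          obtain ⟨a, rfl⟩ := σ.surjective b
          refine ⟨a, Finset.mem_erase.mpr ⟨?_, Finset.mem_univ _⟩, rfl⟩
          rintro rfl
          exact (Finset.mem_erase.mp hb).1 rfl
        · intro j _
          rw [map_sub, hτ, hτ]
      rw [h3, hDeval, h4] at h2
      exact (mul_right_cancel₀ (hne _) h2).symm
    exact (RingHom.congr_fun hgσ x).trans (hx σ)
  obtain ⟨y, hy⟩ := IntermediateField.mem_bot.mp ((IsGalois.mem_bot_iff_fixed x).mpr hfix)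
  rw [← hy]
  exact y.2

end FieldPower

end

section

theorem Polynomial.Monic.exists_local_splits_map {R : Type u} [CommRing R] [IsLocalRing R]
    {p : Polynomial R} (hp : p.Monic) :
    ∃ (Q : Type u) (_ : CommRing Q) (_ : Algebra R Q), IsLocalRing Q ∧
      IsLocalHom (algebraMap R Q) ∧ Function.Injective (algebraMap R Q) ∧
      (p.map (algebraMap R Q)).Splits := by
  obtain ⟨S, _, _, _, _, _, hS⟩ := hp.exists_splits_map
  obtain ⟨n, hn⟩ := Ideal.exists_maximal S
  have hloc : IsLocalHom (algebraMap R (Localization.AtPrime n)) := by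
    constructor
    intro x hx
    by_contra h
    have h1 := Ideal.isMaximal_comap_of_isIntegral_of_isMaximal (R := R) n
    have h2 : x ∈ n.comap (algebraMap R S) := by
      rw [IsLocalRing.eq_maximalIdeal h1]
      exact h
    rw [IsScalarTower.algebraMap_apply R S] at hx
    exact (IsLocalization.AtPrime.isUnit_to_map_iff (Localization.AtPrime n) n _).mp hx h2
  have : Module.Flat R (Localization.AtPrime n) := Module.Flat.trans R S _
  have : Module.FaithfullyFlat R (Localization.AtPrime n) :=
    Module.FaithfullyFlat.of_flat_of_isLocalHom
  refine ⟨Localization.AtPrime n, inferInstance, inferInstance, inferInstance, hloc,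
    FaithfulSMul.algebraMap_injective _ _, ?_⟩
  rw [IsScalarTower.algebraMap_eq R S, ← Polynomial.map_map]
  exact hS.map _

theorem exists_field_amalgamation {K M N : Type u} [Field K] [Field M] [Field N] (c : K →+* M)
    (f : K →+* N) : ∃ (Ω : Type u) (_ : Field Ω) (j : M →+* Ω) (g : N →+* Ω),
      j.comp c = g.comp f := by
  let _ := c.toAlgebra
  let _ := f.toAlgebra
  obtain ⟨n, hn⟩ := Ideal.exists_maximal (TensorProduct K M N)
  refine ⟨TensorProduct K M N ⧸ n, Ideal.Quotient.field n,
    (Ideal.Quotient.mk n).comp Algebra.TensorProduct.includeLeftRingHom,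
    (Ideal.Quotient.mk n).comp (Algebra.TensorProduct.includeRight.toRingHom : N →+* _), ?_⟩
  rw [RingHom.comp_assoc, RingHom.comp_assoc]
  congr 1
  ext x
  exact (Algebra.TensorProduct.includeLeft (R := K) (S := K) (A := M) (B := N)).commutes x |>.trans
    ((Algebra.TensorProduct.includeRight (R := K) (A := M) (B := N)).commutes x).symm

theorem Polynomial.Splits.exists_root_eq {Q Ω : Type*} [CommRing Q] [Field Ω] {p : Polynomial Q}
    (hp : p.Monic) (hs : p.Splits) (f : Q →+* Ω) {y : Ω} (hy : (p.map f).eval y = 0) :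
    ∃ t, p.eval t = 0 ∧ f t = y := by
  obtain ⟨s, hs⟩ := Polynomial.splits_iff_exists_multiset.mp hs
  rw [hp.leadingCoeff, map_one, one_mul] at hs
  rw [hs, Polynomial.map_multiset_prod, Multiset.map_map, Polynomial.eval_multiset_prod,
    Multiset.map_map, Multiset.prod_eq_zero_iff] at hy
  obtain ⟨t, hts, ht⟩ := Multiset.mem_map.mp hy
  refine ⟨t, ?_, ?_⟩
  · rw [hs, Polynomial.eval_multiset_prod, Multiset.map_map, Multiset.prod_eq_zero]
    exact Multiset.mem_map.mpr ⟨t, hts, by simp⟩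
  · simp only [Function.comp_apply, Polynomial.map_sub, Polynomial.map_X, Polynomial.map_C,
      Polynomial.eval_sub, Polynomial.eval_X, Polynomial.eval_C] at ht
    exact (sub_eq_zero.mp ht).symm

namespace FieldPower

variable {k E : Type u} [Field k] [Field E] {φ : k →+* E} {m : ℕ} {M : Type u} [Field M]
  (P : FieldPower φ m M)

theorem mem_lifts_of_map_act_eq {K : Type u} [Field K] {c : K →+* M}
    (hrange : ∀ x, (∀ σ, P.act σ x = x) → x ∈ c.range) {q : Polynomial M}
    (hq : ∀ σ, q.map (P.act σ) = q) : q ∈ Polynomial.lifts c := by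
  rw [Polynomial.lifts_iff_coeff_lifts]
  intro n
  refine hrange _ fun σ => ?_
  conv_rhs => rw [← hq σ]
  rw [Polynomial.coeff_map]

end FieldPower

end

section

namespace FieldPower

variable {k E : Type u} [Field k] [Field E] {φ : k →+* E} {m : ℕ} {M : Type u} [Field M]
  (P : FieldPower φ m M)

theorem exists_irreducible_map_eq_prod {θ : E} (hm : 0 < m)
    (hθ : Function.Injective fun i => P.emb i θ) {K : Type u} [Field K] {c : K →+* M}
    (hfix : ∀ σ y, P.act σ (c y) = c y) (hrange : ∀ x, (∀ σ, P.act σ x = x) → x ∈ c.range) :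
    ∃ q : Polynomial K, q.Monic ∧ Irreducible q ∧ q.natDegree = m ∧
      q.map c = ∏ i, (Polynomial.X - Polynomial.C (P.emb i θ)) := by
  set r : Polynomial M := ∏ i, (Polynomial.X - Polynomial.C (P.emb i θ)) with hr
  have hrm : r.Monic := Polynomial.monic_prod_of_monic _ _ fun i _ => Polynomial.monic_X_sub_C _
  have hrdeg : r.natDegree = m := by
    rw [hr, Polynomial.natDegree_prod_of_monic _ _ fun i _ => Polynomial.monic_X_sub_C _]
    simp
  have hl : r ∈ Polynomial.lifts c := by
    refine P.mem_lifts_of_map_act_eq hrange fun σ => ?_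
    simp only [hr, Polynomial.map_prod, Polynomial.map_sub, Polynomial.map_X, Polynomial.map_C,
      P.act_emb]
    exact Equiv.prod_comp σ fun i => (Polynomial.X - Polynomial.C (P.emb i θ))
  obtain ⟨q, hqr, hqd, hqm⟩ := Polynomial.lifts_and_natDegree_eq_and_monic hl hrm
  refine ⟨q, hqm, ?_, hqd.trans hrdeg, hqr⟩
  let _ : Algebra K M := c.toAlgebra
  set p := minpoly K (P.emb ⟨0, hm⟩ θ) with hp
  have hq0 : Polynomial.aeval (P.emb ⟨0, hm⟩ θ) q = 0 := by
    change Polynomial.eval₂ c _ _ = 0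
    rw [← Polynomial.eval_map, hqr, hr, Polynomial.eval_prod]
    exact Finset.prod_eq_zero (Finset.mem_univ ⟨0, hm⟩) (by simp)
  have hint : IsIntegral K (P.emb ⟨0, hm⟩ θ) := ⟨q, hqm, hq0⟩
  have hroot : ∀ i, (p.map c).eval (P.emb i θ) = 0 := by
    intro i
    have h0 : (p.map c).eval (P.emb ⟨0, hm⟩ θ) = 0 := by
      rw [Polynomial.eval_map]
      exact minpoly.aeval K _
    have h1 := congrArg (P.act (Equiv.swap ⟨0, hm⟩ i)) h0
    rw [Polynomial.eval_map, Polynomial.hom_eval₂, P.act_emb, Equiv.swap_apply_left, map_zero,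
      ← Polynomial.eval_map] at h1
    rw [← h1]
    congr 2
    ext y
    exact (hfix _ y).symm
  have hdvd : r ∣ p.map c := by
    refine Finset.prod_dvd_of_coprime ?_ fun i _ => Polynomial.dvd_iff_isRoot.mpr (hroot i)
    exact fun i _ j _ hij => Polynomial.isCoprime_X_sub_C_of_isUnit_sub
      (sub_ne_zero.mpr fun h => hij (hθ h)).isUnit
  have hpq : p = q := by
    refine Polynomial.eq_of_monic_of_dvd_of_natDegree_le (minpoly.monic hint) hqm
      (minpoly.dvd K _ hq0) ?_ |>.symm
    rw [hqd, ← Polynomial.natDegree_map c (p := p)]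
    exact Polynomial.natDegree_le_of_dvd hdvd ((minpoly.monic hint).map c).ne_zero
  rw [← hpq]
  exact minpoly.irreducible hint

open Polynomial in
theorem exists_map_eval_eq {θ : E} (i₀ : Fin m)
    (hθ : Function.Injective fun i => P.emb i θ) {K : Type u} [Field K] {c : K →+* M}
    (hrange : ∀ x, (∀ σ, P.act σ x = x) → x ∈ c.range) (e : E) :
    ∃ h : K[X], (h.map c).eval (P.emb i₀ θ) = P.emb i₀ e := by
  have hinj : Set.InjOn (fun i => P.emb i θ) (Finset.univ : Finset (Fin m)) := hθ.injOn
  set r : M[X] := Lagrange.interpolate Finset.univ (fun i => P.emb i θ) fun i => P.emb i e with hr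
  have heval : ∀ i, r.eval (P.emb i θ) = P.emb i e := fun i =>
    Lagrange.eval_interpolate_at_node _ hinj (Finset.mem_univ i)
  have hl : r ∈ Polynomial.lifts c := by
    refine P.mem_lifts_of_map_act_eq hrange fun σ => ?_
    refine Lagrange.eq_interpolate_of_eval_eq _ hinj ?_ fun i _ => ?_
    · exact Polynomial.degree_map_le.trans_lt (Lagrange.degree_interpolate_lt _ hinj)
    · have := P.act_emb σ (σ.symm i) θ
      rw [Equiv.apply_symm_apply] at this
      rw [← this, Polynomial.eval_map_apply, heval, P.act_emb, Equiv.apply_symm_apply]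
  obtain ⟨h, hh⟩ := (Polynomial.mem_lifts _).mp hl
  exact ⟨h, by rw [hh, heval]⟩

end FieldPower

end

section

theorem RingHom.exists_comp_eq_of_range_le {R K Q : Type*} [CommRing R] [CommRing K] [CommRing Q]
    (f : K →+* Q) (g : R →+* Q) (hg : Function.Injective g) (h : f.range ≤ g.range) :
    ∃ s : K →+* R, g.comp s = f := by
  let e := RingEquiv.ofBijective g.rangeRestrict
    ⟨fun x y hxy => hg (congrArg Subtype.val hxy), g.rangeRestrict_surjective⟩
  refine ⟨(e.symm : g.range →+* R).comp (f.codRestrict g.range fun x => h ⟨x, rfl⟩), ?_⟩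
  ext x
  exact congrArg Subtype.val (e.apply_symm_apply (f.codRestrict g.range (fun x => h ⟨x, rfl⟩) x))

theorem AdjoinRoot.algebraMap_norm_eq_prod {R Q : Type u} [CommRing R] [Nontrivial R] [CommRing Q]
    [Algebra R Q] {p : Polynomial R} (hp : p.Monic) {m : ℕ} (hm : p.natDegree = m) (t : Fin m → Q)
    (ht : ∀ i, p.eval₂ (algebraMap R Q) (t i) = 0)
    (hu : ∀ i j, i ≠ j → IsUnit (t i - t j)) (c : AdjoinRoot p) :
    algebraMap R Q (Algebra.norm R c) =
      ∏ i, AdjoinRoot.lift (algebraMap R Q) (t i) (ht i) c := by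
  obtain rfl : (AdjoinRoot.powerBasis' hp).dim = m := (AdjoinRoot.powerBasis'_dim hp).trans hm
  let b := (AdjoinRoot.powerBasis' hp).basis
  let τ : Fin (AdjoinRoot.powerBasis' hp).dim → AdjoinRoot p →ₐ[R] Q := fun i =>
    { AdjoinRoot.lift (algebraMap R Q) (t i) (ht i) with
      commutes' := fun r => AdjoinRoot.lift_of (ht i) }
  refine Algebra.algebraMap_norm_eq_prod_of_isUnit_det b τ ?_ c
  have : (Matrix.of fun i j => τ i (b j)) = Matrix.vandermonde t := by
    ext i j
    rw [Matrix.of_apply, Matrix.vandermonde_apply, PowerBasis.basis_eq_pow, map_pow,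
      AdjoinRoot.powerBasis'_gen]
    congr 1
    exact AdjoinRoot.lift_root (ht i)
  rw [this, Matrix.det_vandermonde, IsUnit.prod_univ_iff]
  intro i
  rw [IsUnit.prod_iff]
  intro j hj
  exact hu _ _ (Finset.mem_Ioi.mp hj).ne'

namespace FieldPower

variable {k E : Type u} [Field k] [Field E] {φ : k →+* E} {m : ℕ} {M : Type u} [Field M]
  (P : FieldPower φ m M)

include P in
theorem hasLocalSections_of_not_injective (hP : ¬ Function.Injective P.emb) (hm : 0 < m)
    (h : HasLocalSections φ) {K : Type u} [Field K] (c : K →+* M) (φK : k →+* K)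
    (hc : ∀ x, c (φK x) = P.emb ⟨0, hm⟩ (φ x))
    (hrange : ∀ x, (∀ σ, P.act σ x = x) → x ∈ c.range) : HasLocalSections φK := by
  intro R _ κ π _ hπ hκ
  have hact : ∀ σ, P.act σ = RingHom.id M := fun σ => P.hom_ext fun i e => by
    rw [P.act_emb, P.emb_eq_of_not_injective hP (σ i) i, RingHom.id_apply]
  have hcs : Function.Surjective c := fun x => hrange x fun σ => by rw [hact, RingHom.id_apply]
  have : IsLocalHom (c.comp π) := RingHom.isLocalHom_comp _ _
  obtain ⟨s, hs, hsκ⟩ := h.lift κ (c.comp π) (P.emb ⟨0, hm⟩)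
    (by rw [RingHom.comp_assoc, hκ]; exact RingHom.ext hc)
    (fun x _ => (hcs.comp hπ) x)
  obtain ⟨ρ, hρ, hρs⟩ := P.exists_lift R M (c.comp π) (RingHom.id M) (fun _ => s)
    (fun i e => by
      rw [P.emb_eq_of_not_injective hP i ⟨0, hm⟩, RingHom.id_apply, ← hs]
      rfl)
    (fun _ _ _ => rfl)
  refine ⟨ρ.comp c, ?_, ?_⟩
  · ext y
    exact c.injective (RingHom.congr_fun hρ (c y))
  · ext x
    rw [RingHom.comp_apply, RingHom.comp_apply, hc, hρs, ← hsκ, RingHom.comp_apply]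

theorem hasLocalSections_of_injective [Infinite k] (hP : Function.Injective P.emb) (hm : 0 < m)
    (h : HasLocalSections φ) {K : Type u} [Field K] (c : K →+* M) (φK : k →+* K)
    (hc : ∀ x, c (φK x) = P.emb ⟨0, hm⟩ (φ x)) (hfix : ∀ σ y, P.act σ (c y) = c y)
    (hrange : ∀ x, (∀ σ, P.act σ x = x) → x ∈ c.range) : HasLocalSections φK := by
  intro R _ κ π _ hπ hκ
  have : IsLocalRing R := RingHom.domain_isLocalRing π
  obtain ⟨θ, hθ⟩ := P.exists_separating hP
  obtain ⟨q, hqm, hqi, hqd, hq⟩ := P.exists_irreducible_map_eq_prod hm hθ hfix hrange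
  obtain ⟨p, hpq, hpd, hpm⟩ := Polynomial.lifts_and_natDegree_eq_and_monic
    (f := π) ((Polynomial.mem_lifts _).mpr (Polynomial.map_surjective π hπ q)) hqm
  have := Fact.mk hqi
  let π₁ : AdjoinRoot p →+* AdjoinRoot q := AdjoinRoot.map π p q hpq.symm.dvd
  have hπ₁ : IsLocalHom π₁ := AdjoinRoot.isLocalHom_map π hπ p hpm q hpq hpq.symm.dvd
  have hqθ : ∀ i, q.eval₂ c (P.emb i θ) = 0 := fun i => by
    rw [← Polynomial.eval_map, hq, Polynomial.eval_prod]
    exact Finset.prod_eq_zero (Finset.mem_univ i) (by simp)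
  let ψ : Fin m → AdjoinRoot q →+* M := fun i => AdjoinRoot.lift c (P.emb i θ) (hqθ i)
  have hπ₁s : Function.Surjective π₁ := by
    intro y
    obtain ⟨g, rfl⟩ := AdjoinRoot.mk_surjective y
    obtain ⟨g', rfl⟩ := Polynomial.map_surjective π hπ g
    exact ⟨AdjoinRoot.mk p g', AdjoinRoot.map_mk π p q _ g'⟩
  have : IsLocalHom ((ψ ⟨0, hm⟩).comp π₁) := RingHom.isLocalHom_comp _ _
  obtain ⟨s, hs, hsκ⟩ := h.lift ((AdjoinRoot.of p).comp κ) ((ψ ⟨0, hm⟩).comp π₁) (P.emb ⟨0, hm⟩)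
    (by
      ext x
      simp only [RingHom.comp_apply, ψ, π₁, AdjoinRoot.map_of, AdjoinRoot.lift_of]
      rw [← hc, ← hκ, RingHom.comp_apply])
    (by
      rintro _ ⟨e, rfl⟩
      obtain ⟨g, hg⟩ := P.exists_map_eval_eq ⟨0, hm⟩ hθ hrange e
      obtain ⟨y, hy⟩ := hπ₁s (AdjoinRoot.mk q g)
      refine ⟨y, ?_⟩
      rw [RingHom.comp_apply, hy, ← hg, Polynomial.eval_map]
      exact AdjoinRoot.lift_mk (hqθ _) g)
  have hψs : ∀ i e, ψ i (π₁ (s e)) = P.emb i e := by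
    intro i e
    have h1 : ψ i = (P.act (Equiv.swap ⟨0, hm⟩ i)).comp (ψ ⟨0, hm⟩) := by
      refine AdjoinRoot.ringHom_ext ?_ ?_
      · ext y
        simp only [RingHom.comp_apply, ψ, AdjoinRoot.lift_of, hfix]
      · simp only [RingHom.comp_apply, ψ, AdjoinRoot.lift_root, P.act_emb, Equiv.swap_apply_left]
    have h2 : ψ ⟨0, hm⟩ (π₁ (s e)) = P.emb ⟨0, hm⟩ e := RingHom.congr_fun hs e
    rw [h1, RingHom.comp_apply, h2, P.act_emb, Equiv.swap_apply_left]
  obtain ⟨Q, _, _, _, hQ, hQi, hQs⟩ := hpm.exists_local_splits_map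
  obtain ⟨f, hf⟩ : ∃ f : K →+* IsLocalRing.ResidueField Q,
      f.comp π = (IsLocalRing.residue Q).comp (algebraMap R Q) := by
    refine ⟨RingHom.liftOfSurjective π hπ ⟨(IsLocalRing.residue Q).comp (algebraMap R Q), ?_⟩,
      RingHom.liftOfRightInverse_comp _ _ _ _⟩
    intro x hx
    rw [RingHom.mem_ker] at hx ⊢
    by_contra hne
    have h1 := (isUnit_iff_ne_zero.mpr hne)
    rw [RingHom.comp_apply, isUnit_map_iff, isUnit_map_iff (algebraMap R Q)] at h1
    exact (h1.map π).ne_zero hx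
  obtain ⟨Ω, _, j, g, hjg⟩ := exists_field_amalgamation c f
  let πQ : Q →+* Ω := g.comp (IsLocalRing.residue Q)
  have : IsLocalHom πQ := RingHom.isLocalHom_comp _ _
  have hπQ : ∀ r, πQ (algebraMap R Q r) = j (c (π r)) := fun r => by
    have := RingHom.congr_fun hf r
    simp only [RingHom.comp_apply, πQ] at this ⊢
    rw [← this]
    exact (RingHom.congr_fun hjg (π r)).symm
  have hπQ' : πQ.comp (algebraMap R Q) = (j.comp c).comp π := RingHom.ext hπQ
  have hroots : ∀ i, ∃ t, (p.map (algebraMap R Q)).eval t = 0 ∧ πQ t = j (P.emb i θ) := by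
    intro i
    refine Polynomial.Splits.exists_root_eq (hpm.map _) hQs πQ ?_
    rw [Polynomial.map_map, hπQ', ← Polynomial.map_map, hpq, Polynomial.eval_map,
      ← Polynomial.hom_eval₂, hqθ, map_zero]
  choose t ht htj using hroots
  have ht' : ∀ i, p.eval₂ (algebraMap R Q) (t i) = 0 := fun i => by rw [← Polynomial.eval_map, ht]
  let τ : Fin m → AdjoinRoot p →+* Q := fun i => AdjoinRoot.lift (algebraMap R Q) (t i) (ht' i)
  have hτ : ∀ i, πQ.comp (τ i) = j.comp ((ψ i).comp π₁) := by
    intro i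
    refine AdjoinRoot.ringHom_ext ?_ ?_
    · ext r
      simp only [RingHom.comp_apply, τ, ψ, π₁, AdjoinRoot.lift_of, AdjoinRoot.map_of, hπQ]
    · simp only [RingHom.comp_apply, τ, ψ, π₁, AdjoinRoot.lift_root, AdjoinRoot.map_root, htj]
  have hτs : ∀ i x, τ i (s (φ x)) = algebraMap R Q (κ x) := fun i x => by
    rw [← RingHom.comp_apply s, hsκ]
    exact AdjoinRoot.lift_of (ht' i)
  obtain ⟨ρ, hρ, hρs⟩ := P.exists_lift Q Ω πQ j (fun i => (τ i).comp s)
    (fun i e => by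
      rw [← hψs]
      exact RingHom.congr_fun (hτ i) (s e))
    (fun i i' x => by simp only [RingHom.comp_apply, hτs])
  let K₀ : Subfield M :=
    { c.range ⊓ (algebraMap R Q).range.comap ρ with
      inv_mem' := by
        rintro x ⟨hx, r, hr⟩
        refine ⟨?_, ?_⟩
        · obtain ⟨y, rfl⟩ := hx
          exact ⟨y⁻¹, map_inv₀ c y⟩
        · rcases eq_or_ne x 0 with rfl | hx0
          · rw [inv_zero]
            exact Subring.zero_mem _
          · have hu : IsUnit (ρ x) := (isUnit_iff_ne_zero.mpr hx0).map ρ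
            have hr' : IsUnit r := by
              rw [← hr] at hu
              exact (isUnit_map_iff (algebraMap R Q) r).mp hu
            obtain ⟨r', hr'⟩ := hr'.exists_right_inv
            refine ⟨r', ?_⟩
            refine hu.mul_left_cancel ?_
            rw [← map_mul, mul_inv_cancel₀ hx0, map_one, ← hr, ← map_mul, hr', map_one] }
  have hK₀ : ∀ y, c y ∈ K₀ := by
    intro y
    refine P.mem_of_prod_mem_of_act_eq hm hθ K₀ ?_ ?_ (fun σ => hfix σ y)
    · intro i x
      refine ⟨⟨φK x, (hc x).trans (P.emb_base _ _ _)⟩, κ x, ?_⟩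
      rw [hρs, RingHom.comp_apply, hτs]
    · intro e
      refine ⟨?_, Algebra.norm R (s e), ?_⟩
      · refine hrange _ fun σ => ?_
        rw [map_prod]
        simp only [P.act_emb]
        exact Equiv.prod_comp σ fun i => P.emb i e
      · rw [map_prod]
        simp only [hρs, RingHom.comp_apply]
        refine AdjoinRoot.algebraMap_norm_eq_prod hpm (hpd.trans hqd) t ht' ?_ (s e)
        intro i i' hii
        rw [← isUnit_map_iff πQ, map_sub, htj, htj, isUnit_iff_ne_zero, ← map_sub, map_ne_zero,
          sub_ne_zero]
        exact fun h => hii (hθ h)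
  obtain ⟨σ, hσ⟩ := RingHom.exists_comp_eq_of_range_le (ρ.comp c) (algebraMap R Q) hQi (by
    rintro _ ⟨y, rfl⟩
    exact (hK₀ y).2)
  have hσ' : ∀ y, algebraMap R Q (σ y) = ρ (c y) := RingHom.congr_fun hσ
  refine ⟨σ, ?_, ?_⟩
  · ext y
    refine (j.comp c).injective ?_
    rw [RingHom.comp_apply, RingHom.comp_apply, ← hπQ, hσ']
    exact RingHom.congr_fun hρ (c y)
  · ext x
    refine hQi ?_
    rw [RingHom.comp_apply, hσ', hc, hρs, RingHom.comp_apply, hτs]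

theorem hasLocalSections [Infinite k] (hm : 0 < m) (h : HasLocalSections φ) {K : Type u} [Field K]
    (c : K →+* M) (φK : k →+* K) (hc : ∀ x, c (φK x) = P.emb ⟨0, hm⟩ (φ x))
    (hfix : ∀ σ y, P.act σ (c y) = c y) (hrange : ∀ x, (∀ σ, P.act σ x = x) → x ∈ c.range) :
    HasLocalSections φK := by
  by_cases hP : Function.Injective P.emb
  · exact P.hasLocalSections_of_injective hP hm h c φK hc hfix hrange
  · exact P.hasLocalSections_of_not_injective hP hm h c φK hc hrange

end FieldPower

end

section

theorem MulAction.exists_orderOf_eq_natCard {G X : Type*} [Group G] [Finite G] [MulAction G X]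
    [Finite X] [FaithfulSMul G X] [MulAction.IsPretransitive G X] (hX : (Nat.card X).Prime) :
    ∃ (σ : G) (x : X), orderOf σ = Nat.card X ∧
      Function.Bijective (fun i : Fin (Nat.card X) => σ ^ (i : ℕ) • x) ∧
      Function.Bijective (fun p : Fin (Nat.card X) × MulAction.stabilizer G x =>
        σ ^ (p.1 : ℕ) * (p.2 : G)) ∧
      (Nat.card X).Coprime (Nat.card (MulAction.stabilizer G x)) := by
  have := Fact.mk hX
  obtain ⟨x₁⟩ : Nonempty X := (Nat.card_pos_iff.mp hX.pos).1
  have hcard : ∀ x : X, Nat.card (MulAction.stabilizer G x) * Nat.card X = Nat.card G := fun x => by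
    rw [← MulAction.index_stabilizer_of_transitive G x, Subgroup.card_mul_index]
  obtain ⟨σ, hσ⟩ := exists_prime_orderOf_dvd_card' (G := G) (Nat.card X)
    (Dvd.intro_left _ (hcard x₁))
  obtain ⟨x, hx⟩ : ∃ x : X, σ • x ≠ x := by
    by_contra! h
    have : σ = 1 := FaithfulSMul.eq_of_smul_eq_smul (α := X) fun x => by rw [h, one_smul]
    rw [this, orderOf_one] at hσ
    exact hX.one_lt.ne hσ
  have hper : MulAction.period σ x = Nat.card X := by
    have h1 : MulAction.period σ x ∣ Nat.card X := hσ ▸ MulAction.period_dvd_orderOf σ x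
    refine ((Nat.dvd_prime hX).mp h1).resolve_left fun h => hx ?_
    have := MulAction.pow_period_smul σ x
    rwa [h, pow_one] at this
  have hinj : Function.Injective (fun i : Fin (Nat.card X) => σ ^ (i : ℕ) • x) := by
    intro i j hij
    wlog hle : i ≤ j generalizing i j
    · exact (this hij.symm (le_of_not_ge hle)).symm
    have h1 : σ ^ (j - i : ℕ) • x = x := by
      have : σ ^ (j : ℕ) = σ ^ (i : ℕ) * σ ^ (j - i : ℕ) := by
        rw [← pow_add, Nat.add_sub_cancel' hle]
      simp only [this, mul_smul] at hij
      exact (smul_left_cancel _ hij).symm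
    rw [MulAction.pow_smul_eq_iff_period_dvd, hper] at h1
    have h2 := Nat.eq_zero_of_dvd_of_lt h1 (lt_of_le_of_lt (Nat.sub_le _ _) j.2)
    exact Fin.ext (le_antisymm hle (Nat.sub_eq_zero_iff_le.mp h2))
  have hbij : Function.Bijective (fun i : Fin (Nat.card X) => σ ^ (i : ℕ) • x) :=
    (Nat.bijective_iff_injective_and_card _).mpr ⟨hinj, by simp⟩
  refine ⟨σ, x, hσ, hbij, ⟨?_, ?_⟩, ?_⟩
  · rintro ⟨i, g⟩ ⟨j, h⟩ hgh
    have h1 : i = j := hinj (by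
      have := congrArg (· • x) hgh
      simp only [mul_smul] at this
      rwa [MulAction.mem_stabilizer_iff.mp g.2, MulAction.mem_stabilizer_iff.mp h.2] at this)
    subst h1
    exact Prod.ext rfl (Subtype.ext (mul_left_cancel hgh))
  · intro g
    obtain ⟨i, hi⟩ := hbij.2 (g • x)
    refine ⟨⟨i, (σ ^ (i : ℕ))⁻¹ * g, ?_⟩, mul_inv_cancel_left _ _⟩
    rw [MulAction.mem_stabilizer_iff, mul_smul, ← hi, inv_smul_smul]
  · rw [Nat.Prime.coprime_iff_not_dvd hX]
    rintro ⟨d, hd⟩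
    have h1 : Nat.card G ∣ (Nat.card X).factorial := by
      classical
      have := Fintype.ofFinite X
      rw [Nat.card_eq_fintype_card (α := X), ← Fintype.card_perm, ← Nat.card_eq_fintype_card]
      exact Subgroup.card_dvd_of_injective (MulAction.toPermHom G X) MulAction.toPerm_injective
    rw [← hcard x, hd, mul_comm, ← mul_assoc] at h1
    have h2 := (Dvd.intro d rfl).trans h1
    rw [← Nat.mul_factorial_pred hX.ne_zero] at h2
    have h3 := Nat.dvd_of_mul_dvd_mul_left hX.pos h2
    rw [Nat.Prime.dvd_factorial hX] at h3
    have := hX.pos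
    omega

/-- A finite separable extension of prime degree embeds into a Galois extension which is the
disjoint union of the translates of a stabilizer under powers of one automorphism. -/
theorem exists_galois_of_prime_degree (K L : Type u) [Field K] [Field L] [Algebra K L]
    [FiniteDimensional K L] [Algebra.IsSeparable K L] {ℓ : ℕ} (hd : Module.finrank K L = ℓ)
    (hℓ : ℓ.Prime) :
    ∃ (M : Type u) (_ : Field M) (_ : Algebra K M) (_ : FiniteDimensional K M) (_ : IsGalois K M)
      (τ : L →ₐ[K] M) (σ : M ≃ₐ[K] M) (H : Subgroup (M ≃ₐ[K] M)), orderOf σ = ℓ ∧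
      (∀ g, g ∈ H ↔ g.toAlgHom.comp τ = τ) ∧
      Function.Injective (fun i : Fin ℓ => (σ ^ (i : ℕ)).toAlgHom.comp τ) ∧
      Function.Bijective (fun p : Fin ℓ × H => σ ^ (p.1 : ℕ) * (p.2 : M ≃ₐ[K] M)) ∧
      ℓ.Coprime (Nat.card H) := by
  let pb := Field.powerBasisOfFiniteOfSeparable K L
  let p := minpoly K pb.gen
  have hpi : Irreducible p := minpoly.irreducible (Algebra.IsIntegral.isIntegral _)
  have hps : p.Separable := Algebra.IsSeparable.isSeparable K pb.gen
  let M := p.SplittingField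
  have hG : IsGalois K M := IsGalois.of_separable_splitting_field hps
  have hsp : Fact ((p.map (algebraMap K M)).Splits) := ⟨Polynomial.SplittingField.splits p⟩
  have hcard : Nat.card (p.rootSet M) = ℓ := by
    rw [Nat.card_eq_fintype_card, Polynomial.card_rootSet_eq_natDegree hps hsp.1,
      pb.natDegree_minpoly, ← pb.finrank, hd]
  let _ : MulAction (M ≃ₐ[K] M) (p.rootSet M) := Polynomial.Gal.galActionAux p
  have hsmul : ∀ (g : M ≃ₐ[K] M) (x : p.rootSet M), ((g • x : p.rootSet M) : M) = g x :=
    fun _ _ => rfl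
  have htr : MulAction.IsPretransitive (M ≃ₐ[K] M) (p.rootSet M) := by
    refine ⟨fun x y => ?_⟩
    have hx := minpoly.eq_of_irreducible hpi (Polynomial.mem_rootSet.mp x.2).2
    have hy := minpoly.eq_of_irreducible hpi (Polynomial.mem_rootSet.mp y.2).2
    obtain ⟨g, hg⟩ := (Normal.minpoly_eq_iff_mem_orbit M).mp (hy.symm.trans hx)
    exact ⟨g, Subtype.ext hg⟩
  have hfaith : FaithfulSMul (M ≃ₐ[K] M) (p.rootSet M) := by
    refine ⟨fun {g h} hgh => ?_⟩
    refine Polynomial.Gal.ext (p := p) fun x hx => ?_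
    exact congrArg Subtype.val (hgh ⟨x, hx⟩)
  obtain ⟨σ, x, hσ, hinj, hbij, hcop⟩ :=
    MulAction.exists_orderOf_eq_natCard (G := M ≃ₐ[K] M) (X := p.rootSet M) (hcard ▸ hℓ)
  rw [hcard] at hσ hinj hbij hcop
  let τ : L →ₐ[K] M := pb.lift x (Polynomial.mem_rootSet.mp x.2).2
  have hτ : τ pb.gen = x := pb.lift_gen _ _
  refine ⟨M, inferInstance, inferInstance, inferInstance, hG, τ, σ,
    MulAction.stabilizer (M ≃ₐ[K] M) x, hσ, ?_, ?_, hbij, hcop⟩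
  · intro g
    rw [MulAction.mem_stabilizer_iff]
    constructor
    · intro hg
      refine pb.algHom_ext ?_
      change g (τ pb.gen) = τ pb.gen
      rw [hτ, ← hsmul, hg]
    · intro hg
      refine Subtype.ext ?_
      rw [hsmul, ← hτ]
      exact AlgHom.congr_fun hg pb.gen
  · intro i j hij
    refine hinj.1 (Subtype.ext ?_)
    change ((σ ^ (i : ℕ) • x : p.rootSet M) : M) = ((σ ^ (j : ℕ) • x : p.rootSet M) : M)
    rw [hsmul, hsmul, ← hτ]
    exact AlgHom.congr_fun hij pb.gen

end

section

section NormLifting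

open scoped TensorProduct

theorem Algebra.norm_tensorProduct_map {K L R S ι : Type*} [CommRing K] [CommRing L] [Algebra K L]
    [CommRing R] [Algebra K R] [CommRing S] [Algebra K S] [Finite ι] (b : Module.Basis ι K L)
    (f : R →ₐ[K] S) (x : R ⊗[K] L) :
    Algebra.norm S (Algebra.TensorProduct.map f (AlgHom.id K L) x) = f (Algebra.norm R x) := by
  classical
  have := Fintype.ofFinite ι
  have hf : ∀ (y : R ⊗[K] L) i, (Algebra.TensorProduct.basis S b).repr
      (Algebra.TensorProduct.map f (AlgHom.id K L) y) i =
        f ((Algebra.TensorProduct.basis R b).repr y i) := by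
    intro y i
    induction y with
    | zero => simp
    | add x y hx hy => simp only [map_add, Finsupp.add_apply, hx, hy]
    | tmul r l =>
      rw [Algebra.TensorProduct.map_tmul, Algebra.TensorProduct.basis_repr_tmul,
        Algebra.TensorProduct.basis_repr_tmul]
      simp
  rw [Algebra.norm_eq_matrix_det (Algebra.TensorProduct.basis S b),
    Algebra.norm_eq_matrix_det (Algebra.TensorProduct.basis R b), AlgHom.map_det]
  congr 1
  ext i j
  rw [AlgHom.mapMatrix_apply, Matrix.map_apply, Algebra.leftMulMatrix_eq_repr_mul,
    Algebra.leftMulMatrix_eq_repr_mul, ← hf,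
    map_mul (Algebra.TensorProduct.map f (AlgHom.id K L))]
  simp

theorem Algebra.algebraMap_norm_tensorProduct_eq_prod {K L M R : Type*} [Field K] [Field L]
    [Algebra K L] [FiniteDimensional K L] [Algebra.IsSeparable K L] [Field M] [Algebra K M]
    [CommRing R] [Algebra K R] {ℓ : ℕ} (hd : Module.finrank K L = ℓ) (τ : Fin ℓ → L →ₐ[K] M)
    (hτ : Function.Injective τ) (x : R ⊗[K] L) :
    (Algebra.TensorProduct.includeLeft : R →ₐ[K] R ⊗[K] M) (Algebra.norm R x) =
      ∏ i, Algebra.TensorProduct.map (AlgHom.id K R) (τ i) x := by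
  let pb := Field.powerBasisOfFiniteOfSeparable K L
  obtain rfl : pb.dim = ℓ := by rw [← pb.finrank, hd]
  refine Algebra.algebraMap_norm_eq_prod_of_isUnit_det (R := R) (Q := R ⊗[K] M)
    (Algebra.TensorProduct.basis R pb.basis)
    (fun i => Algebra.TensorProduct.map (AlgHom.id R R) (τ i)) ?_ x
  have : (Matrix.of fun i j => Algebra.TensorProduct.map (AlgHom.id R R) (τ i)
      (Algebra.TensorProduct.basis R pb.basis j)) =
      (Matrix.vandermonde fun i => τ i pb.gen).map
        (Algebra.TensorProduct.includeRight : M →ₐ[K] R ⊗[K] M) := by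
    ext i j
    rw [Matrix.of_apply, Matrix.map_apply, Matrix.vandermonde_apply,
      Algebra.TensorProduct.basis_apply, Algebra.TensorProduct.map_tmul, PowerBasis.basis_eq_pow]
    simp
  rw [this, ← AlgHom.mapMatrix_apply, ← AlgHom.map_det, Matrix.det_vandermonde]
  refine IsUnit.map _ (isUnit_iff_ne_zero.mpr ?_)
  refine Finset.prod_ne_zero_iff.mpr fun i _ => Finset.prod_ne_zero_iff.mpr fun j hj => ?_
  rw [sub_ne_zero]
  exact fun h => (Finset.mem_Ioi.mp hj).ne' (hτ (pb.algHom_ext h))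

theorem exists_tensorProduct_map_eq_of_invariant {K L M R : Type*} [Field K] [Field L] [Algebra K L]
    [Field M] [Algebra K M] [FiniteDimensional K M] [IsGalois K M] [CommRing R] [Algebra K R]
    (τ : L →ₐ[K] M) (H : Subgroup (M ≃ₐ[K] M)) (hH : ∀ g, g ∈ H ↔ g.toAlgHom.comp τ = τ)
    (x : R ⊗[K] M)
    (hx : ∀ g ∈ H, Algebra.TensorProduct.map (AlgHom.id K R) g.toAlgHom x = x) :
    ∃ y : R ⊗[K] L, Algebra.TensorProduct.map (AlgHom.id K R) τ y = x := by
  classical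
  let b := Module.Basis.ofVectorSpace K R
  let eM := TensorProduct.equivFinsuppOfBasisLeft (N := M) b
  let eL := TensorProduct.equivFinsuppOfBasisLeft (N := L) b
  have heM : ∀ (g : M ≃ₐ[K] M) (y : R ⊗[K] M) i,
      eM (Algebra.TensorProduct.map (AlgHom.id K R) g.toAlgHom y) i = g (eM y i) := by
    intro g y i
    induction y with
    | zero => simp
    | add x y hx hy => simp only [map_add, Finsupp.add_apply, hx, hy]
    | tmul r l => simp [eM]
  have heL : ∀ (y : R ⊗[K] L) i,
      eM (Algebra.TensorProduct.map (AlgHom.id K R) τ y) i = τ (eL y i) := by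
    intro y i
    induction y with
    | zero => simp
    | add x y hx hy => simp only [map_add, Finsupp.add_apply, hx, hy]
    | tmul r l => simp [eM, eL]
  have hmem : ∀ i, ∃ l, τ l = eM x i := by
    intro i
    have h1 : H = τ.fieldRange.fixingSubgroup := by
      ext g
      rw [hH, IntermediateField.mem_fixingSubgroup_iff]
      constructor
      · rintro h _ ⟨l, rfl⟩
        exact AlgHom.congr_fun h l
      · intro h
        ext l
        exact h _ ⟨l, rfl⟩
    have h2 : eM x i ∈ IntermediateField.fixedField H := by
      rw [IntermediateField.mem_fixedField_iff]
      intro g hg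
      rw [← heM, hx g hg]
    rw [h1, IsGalois.fixedField_fixingSubgroup] at h2
    exact h2
  choose l hl using hmem
  refine ⟨eL.symm (Finsupp.onFinset (eM x).support l fun i hi => ?_), ?_⟩
  · rw [Finsupp.mem_support_iff, ← hl]
    simpa using hi
  · apply eM.injective
    ext i
    rw [heL, LinearEquiv.apply_symm_apply, Finsupp.onFinset_apply, hl]

theorem Algebra.TensorProduct.isLocalHom_map_of_finite {K M R κ : Type*} [Field K] [Field M]
    [Algebra K M] [FiniteDimensional K M] [CommRing R] [Algebra K R] [CommRing κ]
    [Algebra K κ] (π : R →ₐ[K] κ) [IsLocalHom π] (hπ : Function.Surjective π) :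
    IsLocalHom (Algebra.TensorProduct.map π (AlgHom.id K M)).toRingHom := by
  have h1 : IsLocalHom π.toRingHom := ⟨fun a h => IsLocalHom.map_nonunit (f := π) a h⟩
  apply RingHom.isLocalHom_of_ker_le_jacobson
  · exact _root_.TensorProduct.map_surjective (g := π.toLinearMap)
      (g' := (LinearMap.id : M →ₗ[K] M)) hπ
      Function.surjective_id
  · have h2 := Algebra.TensorProduct.rTensor_ker (R := K) (S := K) (C := M) π hπ
    have h3 := Ideal.map_le_jacobson_bot_of_isIntegral (C := R ⊗[K] M)
      (RingHom.ker_le_jacobson_of_isLocalHom π.toRingHom)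
    exact h2.le.trans h3

end NormLifting

end

section

section NormLifting

open scoped TensorProduct

theorem exists_isUnit_sum_mul_tmul {K M A ι : Type*} [Field K] [Infinite K] [Field M]
    [Algebra K M] [CommRing A] [Algebra K A] [IsArtinianRing A] [Fintype ι] (j : M →ₐ[K] A)
    (σ : ι → M →ₐ[K] M) (hσ : Function.Injective σ) (c : ι → A) (i₀ : ι) (hc : c i₀ = 1) :
    ∃ θ, IsUnit (∑ i, c i * j (σ i θ)) := by
  classical
  let z : M →ₗ[K] A := ∑ i, LinearMap.mulLeft K (c i) ∘ₗ (j.comp (σ i)).toLinearMap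
  have hz : ∀ θ, z θ = ∑ i, c i * j (σ i θ) := fun θ => by simp [z]
  have := Fintype.ofFinite (MaximalSpectrum A)
  let s : Finset (Subspace K M) := Finset.univ.image fun n : MaximalSpectrum A =>
    (n.asIdeal.restrictScalars K).comap z
  have hs : ⊤ ∉ s := by
    intro hs
    obtain ⟨n, -, hn⟩ := Finset.mem_image.mp hs
    have hmax := n.isMaximal
    let _ : Field (A ⧸ n.asIdeal) := Ideal.Quotient.field _
    let χ : M →+* A ⧸ n.asIdeal := (Ideal.Quotient.mk n.asIdeal).comp j.toRingHom
    have hlin : LinearIndependent (A ⧸ n.asIdeal) fun i => ⇑((χ.comp (σ i).toRingHom :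
        M →+* A ⧸ n.asIdeal) : M →* A ⧸ n.asIdeal) := by
      refine (linearIndependent_monoidHom M (A ⧸ n.asIdeal)).comp
        (fun i => ((χ.comp (σ i).toRingHom : M →+* A ⧸ n.asIdeal) : M →* A ⧸ n.asIdeal)) ?_
      intro i i' h
      refine hσ (AlgHom.ext fun x => χ.injective ?_)
      exact DFunLike.congr_fun h x
    have h0 := Fintype.linearIndependent_iff.mp hlin (fun i => Ideal.Quotient.mk _ (c i)) (by
      ext θ
      have h1 : θ ∈ (n.asIdeal.restrictScalars K).comap z := hn ▸ Submodule.mem_top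
      rw [Submodule.mem_comap, Submodule.restrictScalars_mem, hz] at h1
      rw [← Ideal.Quotient.eq_zero_iff_mem, map_sum] at h1
      simp only [map_mul] at h1
      simpa [χ] using h1) i₀
    rw [hc, map_one] at h0
    exact one_ne_zero h0
  obtain ⟨θ, hθ⟩ := (Set.ne_univ_iff_exists_notMem _).mp
    (Subspace.biUnion_ne_univ_of_top_notMem hs)
  refine ⟨θ, ?_⟩
  rw [← hz]
  by_contra hu
  obtain ⟨n, hn, hzn⟩ := exists_max_ideal_of_mem_nonunits hu
  exact hθ (Set.mem_biUnion (Finset.mem_coe.mpr (Finset.mem_image.mpr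
    ⟨⟨n, hn⟩, Finset.mem_univ _, rfl⟩)) hzn)

/-- Hilbert 90 for the action of an automorphism `σ` of order `ℓ` on an Artinian algebra. -/
theorem exists_isUnit_mul_eq_of_prod_eq_one {K M A : Type*} [Field K] [Infinite K] [Field M]
    [Algebra K M] [CommRing A] [Algebra K A] [IsArtinianRing A] (j : M →ₐ[K] A)
    (σ : M ≃ₐ[K] M) {ℓ : ℕ} (hℓ : 0 < ℓ) (hσ : orderOf σ = ℓ) (s : A →+* A)
    (hs : ∀ x, s (j x) = j (σ x)) (u : A) (hu : ∏ i ∈ Finset.range ℓ, (s ^ i) u = 1) :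
    ∃ z, IsUnit z ∧ u * s z = z := by
  let c : ℕ → A := fun n => ∏ i ∈ Finset.range n, (s ^ i) u
  have hcs : ∀ n, u * s (c n) = c (n + 1) := by
    intro n
    simp only [c]
    rw [Finset.prod_range_succ', map_prod, mul_comm]
    congr 1
    refine Finset.prod_congr rfl fun i _ => ?_
    rw [pow_succ']
    rfl
  obtain ⟨θ, hθ⟩ := exists_isUnit_sum_mul_tmul j (fun i : Fin ℓ => ((σ ^ (i : ℕ)).toAlgHom))
    (by
      intro i i' h
      have h1 : σ ^ (i : ℕ) = σ ^ (i' : ℕ) := AlgEquiv.ext fun x => AlgHom.congr_fun h x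
      exact Fin.ext (pow_injOn_Iio_orderOf (hσ ▸ i.2) (hσ ▸ i'.2) h1))
    (fun i => c i) ⟨0, hℓ⟩ (by simp [c])
  refine ⟨_, hθ, ?_⟩
  rw [Fin.sum_univ_eq_sum_range (fun n => c n * j ((σ ^ n).toAlgHom θ)), map_sum, Finset.mul_sum]
  have h1 : ∀ n, u * s (c n * j ((σ ^ n).toAlgHom θ)) = c (n + 1) * j ((σ ^ (n + 1)).toAlgHom θ) := by
    intro n
    rw [map_mul, ← mul_assoc, hcs, hs, pow_succ']
    rfl
  simp only [h1]
  obtain ⟨r, rfl⟩ := Nat.exists_eq_add_of_lt hℓ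
  rw [Nat.zero_add] at *
  rw [Finset.sum_range_succ, Finset.sum_range_succ']
  have h2 : σ ^ (r + 1) = 1 := hσ ▸ pow_orderOf_eq_one σ
  have h3 : c (r + 1) = c 0 := hu.trans (Finset.prod_range_zero _).symm
  rw [h2, h3, pow_zero]

end NormLifting

end

section

section GroupAction

variable {A B G : Type*} [CommRing A] [CommRing B] [Group G]

theorem exists_prod_eq_one_lift [Fintype G] (a : G →* (A →+* A)) (b : G →* (B →+* B))
    (p : A →+* B) [IsLocalHom p] (hp : Function.Surjective p)
    (hpa : ∀ g x, p (a g x) = b g (p x)) (σ : G) (u z : B) (hz : IsUnit z)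
    (huz : u * b σ z = z) : ∃ w, p w = u ∧ ∏ g, a g w = 1 := by
  obtain ⟨y, rfl⟩ := hp z
  obtain ⟨y', hy'⟩ := ((isUnit_map_iff p y).mp hz).exists_right_inv
  refine ⟨y * a σ y', ?_, ?_⟩
  · have h1 : b σ (p y) * b σ (p y') = 1 := by
      rw [← map_mul, ← map_mul, hy', map_one, map_one]
    calc p (y * a σ y') = p y * b σ (p y') := by rw [map_mul, hpa]
      _ = u * (b σ (p y) * b σ (p y')) := by rw [← mul_assoc, huz]
      _ = u := by rw [h1, mul_one]
  · simp only [map_mul, Finset.prod_mul_distrib]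
    have h2 : ∀ g, a g (a σ y') = a (g * σ) y' := fun g => by rw [map_mul]; rfl
    simp only [h2]
    rw [Fintype.prod_equiv (Equiv.mulRight σ) (fun g => a (g * σ) y') (fun g => a g y')
      fun _ => rfl, ← Finset.prod_mul_distrib]
    simp only [← map_mul, hy', map_one, Finset.prod_const_one]

theorem map_prod_subgroup_eq (a : G →* (A →+* A)) (H : Subgroup G) [Fintype H] (w : A) (g : G)
    (hg : g ∈ H) : a g (∏ h : H, a h w) = ∏ h : H, a h w := by
  rw [map_prod]
  refine Fintype.prod_equiv (Equiv.mulLeft ⟨g, hg⟩) _ _ fun h => ?_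
  change _ = a (g * h) w
  rw [map_mul]
  rfl

theorem prod_prod_subgroup_eq [Fintype G] (a : G →* (A →+* A)) (H : Subgroup G) [Fintype H]
    {ι : Type*} [Fintype ι] (s : ι → G)
    (hs : Function.Bijective fun p : ι × H => s p.1 * p.2) (w : A) :
    ∏ i, a (s i) (∏ h : H, a h w) = ∏ g, a g w := by
  simp only [map_prod]
  rw [← Fintype.prod_prod_type']
  refine Fintype.prod_equiv (Equiv.ofBijective _ hs) _ _ fun p => ?_
  change _ = a (s p.1 * p.2) w
  rw [map_mul]
  rfl

end GroupAction

section NormLifting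

open scoped TensorProduct

variable {K L R κ : Type u} [Field K] [Field L] [Algebra K L] [FiniteDimensional K L]
  [CommRing R] [Algebra K R] [Field κ] [Algebra K κ] (π : R →ₐ[K] κ) [IsLocalHom π]

/-- The action of field automorphisms on the second factor of a tensor product. -/
noncomputable def tensorAut (K A M : Type*) [Field K] [CommRing A] [Algebra K A] [Field M]
    [Algebra K M] : (M ≃ₐ[K] M) →* (A ⊗[K] M →+* A ⊗[K] M) where
  toFun g := (Algebra.TensorProduct.map (AlgHom.id K A) g.toAlgHom).toRingHom
  map_one' := by
    have : Algebra.TensorProduct.map (AlgHom.id K A) (1 : M ≃ₐ[K] M).toAlgHom = AlgHom.id K _ := by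
      ext <;> simp
    rw [this]
    rfl
  map_mul' g h := by
    have : Algebra.TensorProduct.map (AlgHom.id K A) (g * h).toAlgHom =
        (Algebra.TensorProduct.map (AlgHom.id K A) g.toAlgHom).comp
          (Algebra.TensorProduct.map (AlgHom.id K A) h.toAlgHom) := by
      ext <;> simp
    rw [this]
    rfl

theorem tensorAut_apply (K A M : Type*) [Field K] [CommRing A] [Algebra K A] [Field M]
    [Algebra K M] (g : M ≃ₐ[K] M) (x : A ⊗[K] M) :
    tensorAut K A M g x = Algebra.TensorProduct.map (AlgHom.id K A) g.toAlgHom x := rfl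

theorem tensorAut_map {K A L M : Type*} [Field K] [CommRing A] [Algebra K A] [Field M]
    [Algebra K M] [Field L] [Algebra K L] (g : M ≃ₐ[K] M) (τ : L →ₐ[K] M) (x : A ⊗[K] L) :
    tensorAut K A M g (Algebra.TensorProduct.map (AlgHom.id K A) τ x) =
      Algebra.TensorProduct.map (AlgHom.id K A) (g.toAlgHom.comp τ) x := by
  rw [tensorAut_apply, ← AlgHom.comp_apply]
  congr 1
  ext <;> simp

theorem map_tensorAut {K A B M : Type*} [Field K] [CommRing A] [Algebra K A] [CommRing B]
    [Algebra K B] [Field M] [Algebra K M] (π : A →ₐ[K] B) (g : M ≃ₐ[K] M) (x : A ⊗[K] M) :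
    Algebra.TensorProduct.map π (AlgHom.id K M) (tensorAut K A M g x) =
      tensorAut K B M g (Algebra.TensorProduct.map π (AlgHom.id K M) x) := by
  rw [tensorAut_apply, tensorAut_apply, ← AlgHom.comp_apply, ← AlgHom.comp_apply]
  congr 1
  ext <;> simp

theorem map_tensorMap {K A B L M : Type*} [Field K] [CommRing A] [Algebra K A] [CommRing B]
    [Algebra K B] [Field M] [Algebra K M] [Field L] [Algebra K L] (π : A →ₐ[K] B)
    (τ : L →ₐ[K] M) (x : A ⊗[K] L) :
    Algebra.TensorProduct.map π (AlgHom.id K M)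
        (Algebra.TensorProduct.map (AlgHom.id K A) τ x) =
      Algebra.TensorProduct.map (AlgHom.id K B) τ
        (Algebra.TensorProduct.map π (AlgHom.id K L) x) := by
  rw [← AlgHom.comp_apply, ← AlgHom.comp_apply]
  congr 1
  ext <;> simp

theorem exists_norm_eq_one_lift_pow [Infinite K] [Algebra.IsSeparable K L]
    (hℓ : (Module.finrank K L).Prime) (hπ : Function.Surjective π) :
    ∃ n : ℕ, (Module.finrank K L).Coprime n ∧ ∀ u : κ ⊗[K] L, Algebra.norm κ u = 1 →
      ∃ v : R ⊗[K] L, Algebra.norm R v = 1 ∧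
        Algebra.TensorProduct.map π (AlgHom.id K L) v = u ^ n := by
  classical
  obtain ⟨M, _, _, _, _, τ, σ, H, hσ, hH, hinj, hbij, hcop⟩ :=
    exists_galois_of_prime_degree K L rfl hℓ
  refine ⟨_, hcop, fun u hu => ?_⟩
  obtain ⟨e, he⟩ : ∃ e, e = Algebra.TensorProduct.map (AlgHom.id K κ) τ u := ⟨_, rfl⟩
  have hs : ∀ n : ℕ, (tensorAut K κ M σ) ^ n = tensorAut K κ M (σ ^ n) := fun n =>
    (map_pow _ _ _).symm
  have hu1 : ∏ i ∈ Finset.range (Module.finrank K L), (tensorAut K κ M σ ^ i) e = 1 := by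
    rw [← Fin.prod_univ_eq_prod_range (fun i => (tensorAut K κ M σ ^ i) e)]
    simp only [hs, he, tensorAut_map]
    rw [← Algebra.algebraMap_norm_tensorProduct_eq_prod rfl _ hinj, hu, map_one]
  have : IsArtinianRing (κ ⊗[K] M) := IsArtinianRing.of_finite κ _
  obtain ⟨z, hz, huz⟩ := exists_isUnit_mul_eq_of_prod_eq_one
    (Algebra.TensorProduct.includeRight : M →ₐ[K] κ ⊗[K] M) σ hℓ.pos hσ (tensorAut K κ M σ)
    (fun x => by simp [tensorAut_apply]) e hu1
  have hloc := Algebra.TensorProduct.isLocalHom_map_of_finite (M := M) π hπ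
  obtain ⟨w, hw, hw1⟩ := exists_prod_eq_one_lift (tensorAut K R M) (tensorAut K κ M)
    (Algebra.TensorProduct.map π (AlgHom.id K M)).toRingHom
    (TensorProduct.map_surjective (g := π.toLinearMap) (g' := (LinearMap.id : M →ₗ[K] M)) hπ
      Function.surjective_id) (map_tensorAut π) σ e z hz huz
  obtain ⟨v, hv⟩ := exists_tensorProduct_map_eq_of_invariant τ H hH
    (∏ h : H, tensorAut K R M h w) (map_prod_subgroup_eq (tensorAut K R M) H w)
  refine ⟨v, ?_, ?_⟩
  · refine Algebra.TensorProduct.includeLeft_injective (R := K) (S := K) (A := R) (B := M)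
      (FaithfulSMul.algebraMap_injective K M) ?_
    rw [map_one, Algebra.algebraMap_norm_tensorProduct_eq_prod rfl _ hinj]
    simp only [← tensorAut_map, hv]
    rw [prod_prod_subgroup_eq (tensorAut K R M) H _ hbij, hw1]
  · have hinj' : Function.Injective (Algebra.TensorProduct.map (AlgHom.id K κ) τ) :=
      Module.Flat.lTensor_preserves_injective_linearMap (M := κ) τ.toLinearMap τ.injective
    apply hinj'
    rw [← map_tensorMap, map_pow, hv, map_prod, ← he]
    have : ∀ h : H, Algebra.TensorProduct.map π (AlgHom.id K M) (tensorAut K R M h w) = e := by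
      intro h
      rw [map_tensorAut]
      refine (congrArg _ hw).trans ?_
      rw [he, tensorAut_map, (hH _).mp h.2]
    simp only [this, Finset.prod_const, Finset.card_univ, Nat.card_eq_fintype_card]

theorem isUnit_of_isUnit_norm {A B : Type*} [CommRing A] [CommRing B] [Algebra A B]
    [Module.Free A B] [Module.Finite A B] {x : B} (h : IsUnit (Algebra.norm A x)) : IsUnit x := by
  rw [Algebra.norm_apply, ← LinearMap.isUnit_iff_isUnit_det] at h
  obtain ⟨y, hy⟩ := ((Module.End.isUnit_iff _).mp h).2 1
  exact IsUnit.of_mul_eq_one y hy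

theorem exists_norm_eq_one_lift [Infinite K] [Algebra.IsSeparable K L]
    (hℓ : (Module.finrank K L).Prime) (hπ : Function.Surjective π) (u : κ ⊗[K] L)
    (hu : Algebra.norm κ u = 1) :
    ∃ v : R ⊗[K] L, Algebra.norm R v = 1 ∧
      Algebra.TensorProduct.map π (AlgHom.id K L) v = u := by
  obtain ⟨n, hn, hlift⟩ := exists_norm_eq_one_lift_pow (L := L) π hℓ hπ
  obtain ⟨p, hp⟩ : ∃ p, p = (Algebra.TensorProduct.map π (AlgHom.id K L)).toRingHom := ⟨_, rfl⟩
  have hp' : ∀ x, p x = Algebra.TensorProduct.map π (AlgHom.id K L) x := fun x => by rw [hp]; rfl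
  have hsurj : Function.Surjective p := by
    rw [hp]
    exact TensorProduct.map_surjective (g := π.toLinearMap) (g' := (LinearMap.id : L →ₗ[K] L)) hπ
      Function.surjective_id
  have hloc : IsLocalHom p := by
    rw [hp]
    exact Algebra.TensorProduct.isLocalHom_map_of_finite π hπ
  have hnorm : ∀ x, Algebra.norm κ (p x) = π (Algebra.norm R x) := fun x => by
    rw [hp', Algebra.norm_tensorProduct_map (Module.finBasis K L)]
  have hfin : Module.finrank R (R ⊗[K] L) = Module.finrank K L := by
    have : Nontrivial R := π.toRingHom.domain_nontrivial
    exact Module.finrank_baseChange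
  set N : (R ⊗[K] L)ˣ →* Rˣ := Units.map (Algebra.norm R)
  set P : (R ⊗[K] L)ˣ →* (κ ⊗[K] L)ˣ := Units.map (p : R ⊗[K] L →* κ ⊗[K] L) with hP
  obtain ⟨U, rfl⟩ : IsUnit u := isUnit_of_isUnit_norm (A := κ) (by rw [hu]; exact isUnit_one)
  suffices hU : U ∈ N.ker.map P by
    obtain ⟨V, hV, rfl⟩ := hU
    exact ⟨V, congrArg Units.val (MonoidHom.mem_ker.mp hV), (hp' _).symm⟩
  have hUn : U ^ n ∈ N.ker.map P := by
    obtain ⟨v, hv, hvu⟩ := hlift U hu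
    obtain ⟨V, rfl⟩ : IsUnit v := isUnit_of_isUnit_norm (A := R) (by rw [hv]; exact isUnit_one)
    refine ⟨V, MonoidHom.mem_ker.mpr (Units.ext hv), Units.ext ?_⟩
    exact (hp' _).trans (hvu.trans (Units.val_pow_eq_pow_val _ _).symm)
  have hUl : U ^ Module.finrank K L ∈ N.ker.map P := by
    obtain ⟨x, hx⟩ := hsurj U
    obtain ⟨V, rfl⟩ : IsUnit x := (isUnit_map_iff p x).mp (hx ▸ U.isUnit)
    have hVU : P V = U := Units.ext hx
    set D : Rˣ →* (R ⊗[K] L)ˣ := Units.map (algebraMap R (R ⊗[K] L) : R →* R ⊗[K] L)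
    have hND : ∀ c, N (D c) = c ^ Module.finrank K L := fun c => Units.ext (by
      change Algebra.norm R (algebraMap R (R ⊗[K] L) c) = _
      rw [Algebra.norm_algebraMap_of_basis
        (Algebra.TensorProduct.basis R (Module.finBasis K L)), Fintype.card_fin,
        Units.val_pow_eq_pow_val])
    have hPD : P (D (N V)) = 1 := Units.ext (by
      change p (algebraMap R (R ⊗[K] L) (Algebra.norm R (V : R ⊗[K] L))) = 1
      rw [hp', Algebra.TensorProduct.algebraMap_apply, Algebra.TensorProduct.map_tmul]
      change π (Algebra.norm R (V : R ⊗[K] L)) ⊗ₜ _ = _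
      rw [← hnorm, hx, hu, map_one]
      rfl)
    refine ⟨V ^ Module.finrank K L * (D (N V))⁻¹, ?_, ?_⟩
    · rw [SetLike.mem_coe, MonoidHom.mem_ker, map_mul, map_inv, map_pow, hND, mul_inv_cancel]
    · rw [map_mul, map_inv, map_pow, hPD, hVU, inv_one, mul_one]
  have h1 := Nat.gcd_eq_gcd_ab (Module.finrank K L) n
  rw [Nat.Coprime.gcd_eq_one hn] at h1
  have h2 : U = (U ^ Module.finrank K L) ^ (Nat.gcdA (Module.finrank K L) n) *
      (U ^ n) ^ (Nat.gcdB (Module.finrank K L) n) := by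
    rw [← zpow_natCast, ← zpow_natCast, ← zpow_mul, ← zpow_mul, ← zpow_add, ← h1]
    simp
  rw [h2]
  exact mul_mem (zpow_mem hUl _) (zpow_mem hUn _)

end NormLifting

end

section

section NormHypersurfacePoints

open scoped TensorProduct

theorem isSeparable_or_pow_mem_range {K L : Type*} [Field K] [Field L] [Algebra K L]
    [FiniteDimensional K L] (h : (Module.finrank K L).Prime) :
    Algebra.IsSeparable K L ∨ CharP K (Module.finrank K L) ∧
      ∀ x : L, x ^ Module.finrank K L ∈ (algebraMap K L).range := by
  rcases (Nat.dvd_prime h).mp (Field.finSepDegree_dvd_finrank K L) with h1 | h1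
  · right
    have hpi : IsPurelyInseparable K L := (isPurelyInseparable_iff_finSepDegree_eq_one K L).mpr h1
    obtain ⟨q, hq⟩ := ExpChar.exists K
    have key : ∀ x : L, x ∈ (algebraMap K L).range ∨
        (q = Module.finrank K L ∧ x ^ Module.finrank K L ∈ (algebraMap K L).range) := by
      intro x
      obtain ⟨n, y, hy⟩ := IsPurelyInseparable.minpoly_eq_X_pow_sub_C K q x
      have hd := minpoly.degree_dvd (Algebra.IsIntegral.isIntegral (R := K) x)
      have hq0 : q ^ n ≠ 0 := pow_ne_zero _ (expChar_pos K q).ne'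
      rw [hy, Polynomial.natDegree_X_pow_sub_C] at hd
      have hx := minpoly.aeval K x
      rw [hy] at hx
      simp only [map_sub, map_pow, Polynomial.aeval_X, Polynomial.aeval_C, sub_eq_zero] at hx
      rcases (Nat.dvd_prime h).mp hd with h2 | h2
      · left
        rw [h2, pow_one] at hx
        exact ⟨y, hx.symm⟩
      · right
        rw [h2] at hx
        refine ⟨?_, y, hx.symm⟩
        have hn : n ≠ 0 := by
          rintro rfl
          exact h.one_lt.ne (by simpa using h2)
        have hdq : q ∣ Module.finrank K L := h2 ▸ dvd_pow_self q hn
        rcases (Nat.dvd_prime h).mp hdq with h3 | h3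
        · rw [h3, one_pow] at h2
          exact absurd h2.symm h.one_lt.ne'
        · exact h3
    have hex : ∃ x : L, x ∉ (algebraMap K L).range := by
      by_contra! hall
      have : Function.Surjective (algebraMap K L) := hall
      have h2 : Module.finrank K L = 1 := by
        have e := (LinearEquiv.ofBijective (Algebra.linearMap K L)
          ⟨(algebraMap K L).injective, this⟩).finrank_eq
        rw [← e, Module.finrank_self]
      exact h.one_lt.ne' h2
    obtain ⟨x, hx⟩ := hex
    obtain ⟨hq', -⟩ := (key x).resolve_left hx
    refine ⟨?_, fun y => ?_⟩
    · cases hq with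
      | zero => exact absurd hq' h.one_lt.ne
      | prime _ => rwa [hq'] at *
    · rcases key y with hy | hy
      · exact pow_mem hy _
      · exact hy.2
  · left
    exact (Field.finSepDegree_eq_finrank_iff K L).mp h1

theorem Algebra.TensorProduct.productMap_injective_of_pow_mem_range {K L κ Ω : Type*} [Field K]
    [Field L] [Algebra K L] [FiniteDimensional K L] [Field κ] [Algebra K κ] [Field Ω] [Algebra K Ω]
    {p : ℕ} (hp : p.Prime) (hd : Module.finrank K L = p) [CharP Ω p]
    (hL : ∀ x : L, x ^ p ∈ (algebraMap K L).range) (i : κ →ₐ[K] Ω) (j : L →ₐ[K] Ω)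
    (hij : ¬ j.range ≤ i.range) :
    Function.Injective (Algebra.TensorProduct.productMap i j) := by
  obtain ⟨_, ⟨b, rfl⟩, hb⟩ := Set.not_subset.mp hij
  obtain ⟨c, hc⟩ := hL b
  have : Fact p.Prime := ⟨hp⟩
  have hirr : Irreducible (Polynomial.X ^ p - Polynomial.C (algebraMap K κ c)) := by
    refine X_pow_sub_C_irreducible_of_prime hp fun d hd => hb ⟨d, ?_⟩
    apply frobenius_inj Ω p
    change i d ^ p = j b ^ p
    rw [← map_pow, hd, ← map_pow, ← hc, i.commutes, j.commutes]
  let _ : Algebra κ Ω := i.toRingHom.toAlgebra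
  have hmin : minpoly κ (j b) = Polynomial.X ^ p - Polynomial.C (algebraMap K κ c) := by
    refine (minpoly.eq_of_irreducible_of_monic hirr ?_
      (Polynomial.monic_X_pow_sub_C _ hp.ne_zero)).symm
    simp only [map_sub, map_pow, Polynomial.aeval_X, Polynomial.aeval_C]
    rw [← map_pow, ← hc, j.commutes]
    change _ - i _ = 0
    rw [i.commutes, sub_self]
  have hind := linearIndependent_pow (K := κ) (j b)
  rw [hmin, Polynomial.natDegree_X_pow_sub_C] at hind
  let μ : κ ⊗[K] L →ₗ[κ] Ω :=
    { toFun := Algebra.TensorProduct.productMap i j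
      map_add' := map_add _
      map_smul' := fun r x => by
        rw [Algebra.smul_def, map_mul, Algebra.TensorProduct.algebraMap_apply,
          Algebra.TensorProduct.productMap_apply_tmul, map_one, mul_one]
        rfl }
  have hμ : (μ ∘ fun n : Fin p => (1 : κ) ⊗ₜ[K] (b ^ (n : ℕ))) = fun n : Fin p => j b ^ (n : ℕ) := by
    funext n
    refine (Algebra.TensorProduct.productMap_apply_tmul i j _ _).trans ?_
    rw [map_one, one_mul, map_pow]
  rw [← hμ] at hind
  have : Nonempty (Fin p) := ⟨⟨0, hp.pos⟩⟩
  let B := basisOfLinearIndependentOfCardEqFinrank (LinearIndependent.of_comp μ hind)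
    (by rw [Fintype.card_fin, Module.finrank_baseChange, hd])
  have hB : (μ ∘ fun n : Fin p => (1 : κ) ⊗ₜ[K] (b ^ (n : ℕ))) = fun n => μ (B n) := by
    funext n
    simp [B]
  rw [hB, Fintype.linearIndependent_iff] at hind
  refine (injective_iff_map_eq_zero μ).mpr fun x hx => ?_
  rw [← B.sum_repr x] at hx ⊢
  simp only [map_sum, map_smul] at hx
  simp [hind _ hx]

variable {K L : Type u} [Field K] [Field L] [Algebra K L] [FiniteDimensional K L]

theorem Algebra.algebraMap_norm_tensorProduct_eq_pow {A : Type*} [CommRing A] [Algebra K A]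
    (hp : (Module.finrank K L).Prime) [CharP K (Module.finrank K L)]
    (hL : ∀ x : L, x ^ Module.finrank K L ∈ (algebraMap K L).range) (x : A ⊗[K] L) :
    algebraMap A (A ⊗[K] L) (Algebra.norm A x) = x ^ Module.finrank K L := by
  set p := Module.finrank K L with hpdef
  have : Fact p.Prime := ⟨hp⟩
  set B := MvPolynomial (Fin p) K
  choose c hc using hL
  have : CharP (B ⊗[K] L) p := charP_of_injective_algebraMap
    (FaithfulSMul.algebraMap_injective K (B ⊗[K] L)) p
  have h1 : genericElement K L ^ p =
      algebraMap B _ (∑ i, MvPolynomial.C (c (Module.finBasis K L i)) * MvPolynomial.X i ^ p) := by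
    rw [genericElement, sum_pow_char, map_sum]
    refine Finset.sum_congr rfl fun i _ => ?_
    rw [Algebra.TensorProduct.tmul_pow, ← hc, Algebra.TensorProduct.algebraMap_apply,
      Algebra.algebraMap_eq_smul_one, ← TensorProduct.smul_tmul, Algebra.smul_def]
    rfl
  have h2 : Algebra.norm B (genericElement K L) =
      ∑ i, MvPolynomial.C (c (Module.finBasis K L i)) * MvPolynomial.X i ^ p := by
    apply frobenius_inj B p
    rw [frobenius_def, frobenius_def, ← map_pow, h1, Algebra.norm_algebraMap_of_basis
      (Algebra.TensorProduct.basis B (Module.finBasis K L)), Fintype.card_fin]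
  let b := Algebra.TensorProduct.basis A (Module.finBasis K L)
  have h3 : Algebra.TensorProduct.map (MvPolynomial.aeval fun i => b.repr x i : B →ₐ[K] A)
      (AlgHom.id K L) (genericElement K L) = x := by
    conv_rhs => rw [← b.sum_repr x]
    rw [genericElement, map_sum]
    refine Finset.sum_congr rfl fun i _ => ?_
    rw [Algebra.TensorProduct.map_tmul, MvPolynomial.aeval_X, Algebra.TensorProduct.basis_apply,
      TensorProduct.smul_tmul', smul_eq_mul, mul_one]
    rfl
  rw [← h2] at h1
  rw [← h3, Algebra.norm_tensorProduct_map (Module.finBasis K L), ← map_pow, h1,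
    Algebra.TensorProduct.algebraMap_apply, Algebra.TensorProduct.algebraMap_apply,
    Algebra.TensorProduct.map_tmul, map_one]
  rfl

namespace NormHypersurfaceRing

variable {A : Type*} [CommRing A] [Algebra K A] {a : K}

/-- The quotient map from the polynomial ring to the coordinate ring of `{N = a}`. -/
noncomputable def mkHom (a : K) :
    MvPolynomial (Fin (Module.finrank K L)) K →ₐ[K] NormHypersurfaceRing K L a :=
  Ideal.Quotient.mkₐ K _

theorem mkHom_surjective : Function.Surjective (mkHom a (L := L)) :=
  Ideal.Quotient.mkₐ_surjective K _

theorem mkHom_normForm : mkHom a (normForm K L) = algebraMap K _ a :=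
  Ideal.Quotient.eq.mpr (Ideal.subset_span rfl)

theorem exists_comp_mkHom_eq (h : MvPolynomial (Fin (Module.finrank K L)) K →ₐ[K] A)
    (hh : h (normForm K L) = algebraMap K A a) :
    ∃ g : NormHypersurfaceRing K L a →ₐ[K] A, g.comp (mkHom a) = h := by
  have hle : Ideal.span {normForm K L - MvPolynomial.C a} ≤ RingHom.ker h := by
    rw [Ideal.span_singleton_le_iff_mem, RingHom.mem_ker, map_sub, sub_eq_zero, hh]
    exact (h.commutes a).symm
  exact ⟨Ideal.Quotient.liftₐ _ h fun y hy => hle hy, rfl⟩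

/-- The element of `A ⊗ L` of norm `a` defined by an `A`-valued point of `{N = a}`. -/
noncomputable def point (g : NormHypersurfaceRing K L a →ₐ[K] A) : A ⊗[K] L :=
  Algebra.TensorProduct.map (g.comp (mkHom a)) (AlgHom.id K L) (genericElement K L)

theorem norm_point (g : NormHypersurfaceRing K L a →ₐ[K] A) :
    Algebra.norm A (point g) = algebraMap K A a := by
  rw [point, Algebra.norm_tensorProduct_map (Module.finBasis K L), AlgHom.comp_apply]
  exact (congrArg g mkHom_normForm).trans (g.commutes a)

theorem exists_point_eq (x : A ⊗[K] L) (hx : Algebra.norm A x = algebraMap K A a) :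
    ∃ g : NormHypersurfaceRing K L a →ₐ[K] A, point g = x := by
  let b := Algebra.TensorProduct.basis A (Module.finBasis K L)
  let h : MvPolynomial (Fin (Module.finrank K L)) K →ₐ[K] A :=
    MvPolynomial.aeval fun i => b.repr x i
  have h3 : Algebra.TensorProduct.map h (AlgHom.id K L) (genericElement K L) = x := by
    conv_rhs => rw [← b.sum_repr x]
    rw [genericElement, map_sum]
    refine Finset.sum_congr rfl fun i _ => ?_
    rw [Algebra.TensorProduct.map_tmul, MvPolynomial.aeval_X, Algebra.TensorProduct.basis_apply,
      TensorProduct.smul_tmul', smul_eq_mul, mul_one]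
    rfl
  obtain ⟨g, hg⟩ := exists_comp_mkHom_eq h (a := a) (by
    rw [normForm, ← Algebra.norm_tensorProduct_map (Module.finBasis K L), h3, hx])
  exact ⟨g, by rw [point, hg, h3]⟩

theorem point_comp {B : Type*} [CommRing B] [Algebra K B] (g : NormHypersurfaceRing K L a →ₐ[K] A)
    (f : A →ₐ[K] B) :
    point (f.comp g) = Algebra.TensorProduct.map f (AlgHom.id K L) (point g) := by
  rw [point, point, ← AlgHom.comp_apply]
  congr 1
  apply Algebra.TensorProduct.ext
  · exact AlgHom.ext fun x => by simp
  · exact AlgHom.ext fun x => by simp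

theorem point_injective :
    Function.Injective (point : (NormHypersurfaceRing K L a →ₐ[K] A) → A ⊗[K] L) := by
  intro g g' h
  have key : ∀ (g : NormHypersurfaceRing K L a →ₐ[K] A) i,
      (Algebra.TensorProduct.basis A (Module.finBasis K L)).repr (point g) i =
        g (mkHom a (MvPolynomial.X i)) := by
    intro g i
    rw [point, genericElement, map_sum, map_sum, Finsupp.finsetSum_apply, Finset.sum_eq_single i]
    · rw [Algebra.TensorProduct.map_tmul, Algebra.TensorProduct.basis_repr_tmul]
      simp
    · intro j _ hj
      rw [Algebra.TensorProduct.map_tmul, Algebra.TensorProduct.basis_repr_tmul]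
      simp [hj]
    · simp
  have hc : g.comp (mkHom a) = g'.comp (mkHom a) := by
    apply MvPolynomial.algHom_ext
    intro i
    rw [AlgHom.comp_apply, AlgHom.comp_apply, ← key, ← key, h]
  exact (AlgHom.cancel_right mkHom_surjective).mp hc

end NormHypersurfaceRing

end NormHypersurfacePoints

end

section

section NormHypersurfaceLifting

open scoped TensorProduct

namespace NormHypersurfaceRing

variable {K L R κ : Type u} [Field K] [Field L] [Algebra K L] [FiniteDimensional K L]
  [CommRing R] [Algebra K R] [Field κ] [Algebra K κ] {a : K}

theorem exists_comp_eq_of_norm_eq (π : R →ₐ[K] κ) (g : NormHypersurfaceRing K L a →ₐ[K] κ)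
    (v : R ⊗[K] L) (hv : Algebra.norm R v = algebraMap K R a)
    (hvg : Algebra.TensorProduct.map π (AlgHom.id K L) v = point g) :
    ∃ g' : NormHypersurfaceRing K L a →ₐ[K] R, π.comp g' = g := by
  obtain ⟨g', hg'⟩ := exists_point_eq v hv
  exact ⟨g', point_injective (by rw [point_comp, hg', hvg])⟩

theorem norm_smul' {A : Type u} [CommRing A] [Algebra K A] (b : K) (x : A ⊗[K] L) :
    Algebra.norm A (algebraMap K _ b * x) =
      algebraMap K A b ^ Module.finrank K L * Algebra.norm A x := by
  rw [map_mul, IsScalarTower.algebraMap_apply K A (A ⊗[K] L), Algebra.norm_algebraMap_of_basis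
    (Algebra.TensorProduct.basis A (Module.finBasis K L)), Fintype.card_fin]

theorem exists_lift_of_isSeparable [Infinite K] [Algebra.IsSeparable K L]
    (hℓ : (Module.finrank K L).Prime) (π : R →ₐ[K] κ) [IsLocalHom π]
    (hπ : Function.Surjective π) {b : K} (hb : b ^ Module.finrank K L = a) (hb0 : b ≠ 0)
    (g : NormHypersurfaceRing K L a →ₐ[K] κ) :
    ∃ g' : NormHypersurfaceRing K L a →ₐ[K] R, π.comp g' = g := by
  obtain ⟨v, hv, hvu⟩ := exists_norm_eq_one_lift π hℓ hπ (algebraMap K _ b⁻¹ * point g) (by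
    rw [norm_smul', norm_point, ← hb, map_pow, ← mul_pow, ← map_mul, inv_mul_cancel₀ hb0, map_one,
      one_pow])
  refine exists_comp_eq_of_norm_eq π g (algebraMap K _ b * v) ?_ ?_
  · rw [norm_smul', hv, mul_one, ← hb, map_pow]
  · rw [map_mul, hvu, AlgHom.commutes, ← mul_assoc, ← map_mul, mul_inv_cancel₀ hb0, map_one,
      one_mul]

theorem exists_lift_of_point_eq (π : R →ₐ[K] κ) {b : K} (hb : b ^ Module.finrank K L = a)
    (g : NormHypersurfaceRing K L a →ₐ[K] κ) (hg : point g = algebraMap K _ b) :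
    ∃ g' : NormHypersurfaceRing K L a →ₐ[K] R, π.comp g' = g := by
  refine exists_comp_eq_of_norm_eq π g (algebraMap K _ b) ?_ ?_
  · rw [← mul_one (algebraMap K _ b), norm_smul', map_one, mul_one, ← hb, map_pow]
  · rw [AlgHom.commutes, hg]

theorem exists_lift_of_algHom (hp : (Module.finrank K L).Prime) [CharP K (Module.finrank K L)]
    (hL : ∀ x : L, x ^ Module.finrank K L ∈ (algebraMap K L).range) (π : R →ₐ[K] κ)
    (hπ : Function.Surjective π) {b : K} (hb : b ^ Module.finrank K L = a) (s : L →ₐ[K] R)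
    (g : NormHypersurfaceRing K L a →ₐ[K] κ)
    (hg : Algebra.TensorProduct.productMap (AlgHom.id K κ) (π.comp s) (point g) =
      algebraMap K κ b) :
    ∃ g' : NormHypersurfaceRing K L a →ₐ[K] R, π.comp g' = g := by
  obtain ⟨y, hy⟩ : ∃ y, Algebra.TensorProduct.map π (AlgHom.id K L) y = point g :=
    TensorProduct.map_surjective (g := π.toLinearMap) (g' := (LinearMap.id : L →ₗ[K] L)) hπ
      Function.surjective_id _
  have h1 : ∀ z, π (Algebra.TensorProduct.productMap (AlgHom.id K R) s z) =
      Algebra.TensorProduct.productMap (AlgHom.id K κ) (π.comp s)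
        (Algebra.TensorProduct.map π (AlgHom.id K L) z) := by
    intro z
    rw [← AlgHom.comp_apply, ← AlgHom.comp_apply]
    congr 1
    ext <;> simp
  obtain ⟨d, hd⟩ : ∃ d, d = algebraMap K R b -
    Algebra.TensorProduct.productMap (AlgHom.id K R) s y := ⟨_, rfl⟩
  have hd0 : π d = 0 := by
    rw [hd, map_sub, h1, hy, hg, AlgHom.commutes, sub_self]
  obtain ⟨v, hv⟩ : ∃ v, v = y + d ⊗ₜ 1 := ⟨_, rfl⟩
  have hmv : Algebra.TensorProduct.productMap (AlgHom.id K R) s v = algebraMap K R b := by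
    rw [hv, map_add, Algebra.TensorProduct.productMap_apply_tmul, map_one, mul_one, hd]
    simp
  refine exists_comp_eq_of_norm_eq π g v ?_ ?_
  · have h2 := congrArg (Algebra.TensorProduct.productMap (AlgHom.id K R) s)
      (Algebra.algebraMap_norm_tensorProduct_eq_pow hp hL v)
    rwa [map_pow, hmv, ← map_pow, hb, Algebra.TensorProduct.algebraMap_apply,
      Algebra.TensorProduct.productMap_apply_tmul, map_one, mul_one] at h2
  · rw [hv, map_add, hy, Algebra.TensorProduct.map_tmul, hd0, TensorProduct.zero_tmul, add_zero]

end NormHypersurfaceRing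

open NormHypersurfaceRing in
/-- Points of the norm hypersurface `{N = a}` lift along surjective local homomorphisms,
compatibly with the ground field. -/
theorem NormHypersurfaceRing.exists_lift {k K L R κ : Type u} [Field k] [IsAlgClosed k] [Field K]
    [Field L] [Algebra K L] [FiniteDimensional K L] [CommRing R] [Field κ] (φ : k →+* K)
    (hK : HasLocalSections φ) (hL : HasLocalSections ((algebraMap K L).comp φ))
    (hℓ : (Module.finrank K L).Prime) {a : k} (ha : a ≠ 0) (π : R →+* κ) [IsLocalHom π]
    (hπ : Function.Surjective π) (κ₀ : k →+* R) (g : NormHypersurfaceRing K L (φ a) →+* κ)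
    (hg : π.comp κ₀ = (g.comp (algebraMap K _)).comp φ) :
    ∃ g' : NormHypersurfaceRing K L (φ a) →+* R, π.comp g' = g ∧
      (g'.comp (algebraMap K _)).comp φ = κ₀ := by
  have : Infinite k := IsAlgClosed.instInfinite
  have : Infinite K := Infinite.of_injective φ φ.injective
  obtain ⟨b, hb⟩ := IsAlgClosed.exists_pow_nat_eq a hℓ.pos
  have hb0 : b ≠ 0 := by
    rintro rfl
    exact ha (by rw [← hb, zero_pow hℓ.ne_zero])
  have hφb : φ b ^ Module.finrank K L = φ a := by rw [← map_pow, hb]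
  have hrange : ∀ {E : Type u} [Field E] (j : E →+* κ), j.range ≤ π.range := fun j => by
    rw [RingHom.range_eq_top.mpr hπ]
    exact le_top
  let _ : Algebra K κ := (g.comp (algebraMap K _)).toAlgebra
  let gA : NormHypersurfaceRing K L (φ a) →ₐ[K] κ := { g with commutes' := fun _ => rfl }
  by_cases hcase : ∃ (s : K →+* R) (hs : π.comp s = g.comp (algebraMap K _)),
    s.comp φ = κ₀ ∧ (let _ : Algebra K R := s.toAlgebra
      let πA : R →ₐ[K] κ := { π with commutes' := fun x => RingHom.congr_fun hs x }
      ∃ g' : NormHypersurfaceRing K L (φ a) →ₐ[K] R, πA.comp g' = gA)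
  · obtain ⟨s, hs, hsφ, g', hg'⟩ := hcase
    let _ : Algebra K R := s.toAlgebra
    refine ⟨g', RingHom.ext fun x => AlgHom.congr_fun hg' x, ?_⟩
    rw [← hsφ]
    exact congrArg (fun h : K →+* R => h.comp φ) g'.comp_algebraMap
  exfalso
  obtain ⟨s, hs, hsφ⟩ := hK.lift κ₀ π _ hg (hrange _)
  rcases isSeparable_or_pow_mem_range hℓ (K := K) (L := L) with hsep | ⟨hchar, hpow⟩
  · refine hcase ⟨s, hs, hsφ, ?_⟩
    intro _ πA
    have : IsLocalHom πA := ⟨fun x hx => (isUnit_map_iff π x).mp hx⟩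
    exact exists_lift_of_isSeparable hℓ πA hπ hφb ((map_ne_zero φ).mpr hb0) gA
  obtain ⟨Ω, _, i, j, hij⟩ := exists_field_amalgamation (algebraMap K κ) (algebraMap K L)
  let _ : Algebra K Ω := (i.comp (algebraMap K κ)).toAlgebra
  let iA : κ →ₐ[K] Ω := { i with commutes' := fun _ => rfl }
  let jA : L →ₐ[K] Ω := { j with commutes' := fun x => (RingHom.congr_fun hij x).symm }
  have hcharΩ : CharP Ω (Module.finrank K L) :=
    charP_of_injective_algebraMap (algebraMap K Ω).injective _
  have : Fact (Module.finrank K L).Prime := ⟨hℓ⟩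
  have hpt : Algebra.TensorProduct.productMap iA jA (point gA) = algebraMap K Ω (φ b) := by
    apply frobenius_inj Ω (Module.finrank K L)
    rw [frobenius_def, frobenius_def, ← map_pow,
      ← Algebra.algebraMap_norm_tensorProduct_eq_pow hℓ hpow, norm_point,
      Algebra.TensorProduct.algebraMap_apply, Algebra.TensorProduct.productMap_apply_tmul, map_one,
      mul_one, ← map_pow, hφb]
    exact iA.commutes _
  by_cases hsub : jA.range ≤ iA.range
  · obtain ⟨h, hh⟩ := RingHom.exists_comp_eq_of_range_le j i i.injective hsub
    have hhK : h.comp (algebraMap K L) = algebraMap K κ := by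
      refine RingHom.ext fun x => i.injective ?_
      have h1 := RingHom.congr_fun hh (algebraMap K L x)
      have h2 := RingHom.congr_fun hij x
      exact h1.trans h2.symm
    obtain ⟨t, ht, htφ⟩ := hL.lift κ₀ π h (by
      rw [← RingHom.comp_assoc, hhK]
      exact hg) (hrange _)
    refine hcase ⟨t.comp (algebraMap K L), ?_, ?_, ?_⟩
    · rw [← RingHom.comp_assoc, ht, hhK]
      rfl
    · rw [RingHom.comp_assoc, htφ]
    · intro _ πA
      let tA : L →ₐ[K] R := { t with commutes' := fun x => rfl }
      refine exists_lift_of_algHom hℓ hpow πA hπ hφb tA gA ?_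
      apply i.injective
      refine Eq.trans ?_ (hpt.trans rfl)
      change iA _ = _
      rw [← AlgHom.comp_apply]
      congr 1
      apply Algebra.TensorProduct.ext
      · exact AlgHom.ext fun x => by simp
      · refine AlgHom.ext fun x => ?_
        have h1 := RingHom.congr_fun ht x
        have h2 := RingHom.congr_fun hh x
        simp only [AlgHom.comp_apply, AlgHom.restrictScalars_apply,
          Algebra.TensorProduct.includeRight_apply, Algebra.TensorProduct.productMap_apply_tmul,
          map_one, one_mul]
        exact (congrArg i h1).trans h2
  · refine hcase ⟨s, hs, hsφ, ?_⟩
    intro _ πA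
    refine exists_lift_of_point_eq πA hφb gA ?_
    refine Algebra.TensorProduct.productMap_injective_of_pow_mem_range hℓ rfl hpow iA jA hsub ?_
    rw [hpt, AlgHom.commutes]

end NormHypersurfaceLifting

end

section

section FunctionFieldLifting

namespace AlgebraicGeometry.Scheme

/-- The closed point of the spectrum of a local ring. -/
noncomputable def specClosedPoint (Q : Type u) [CommRing Q] [IsLocalRing Q] : Spec (.of Q) :=
  IsLocalRing.closedPoint Q

theorem specMap_specClosedPoint {A B : Type u} [CommRing A] [IsLocalRing A] [CommRing B]
    [IsLocalRing B] (f : A →+* B) [IsLocalHom f] :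
    Spec.map (CommRingCat.ofHom f) (specClosedPoint B) = specClosedPoint A :=
  IsLocalRing.comap_closedPoint f

theorem specMap_comp_specClosedPoint {X : Scheme.{u}} {A B : Type u} [CommRing A] [IsLocalRing A]
    [CommRing B] [IsLocalRing B] (f : A →+* B) [IsLocalHom f] (h : Spec (.of A) ⟶ X) :
    (Spec.map (CommRingCat.ofHom f) ≫ h) (specClosedPoint B) = h (specClosedPoint A) := by
  rw [Scheme.Hom.comp_apply, specMap_specClosedPoint]

/-- The canonical morphism from the spectrum of a stalk. -/
noncomputable def stalkSpec (X : Scheme.{u}) (x : X) : Spec (.of (X.presheaf.stalk x)) ⟶ X :=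
  X.fromSpecStalk x

theorem stalkSpec_specClosedPoint (X : Scheme.{u}) (x : X) :
    X.stalkSpec x (specClosedPoint (X.presheaf.stalk x)) = x :=
  fromSpecStalk_closedPoint

theorem exists_ringHom_stalk {X : Scheme.{u}} {Q : Type u} [CommRing Q] [IsLocalRing Q]
    (h : Spec (.of Q) ⟶ X) (x : X) (hx : h (specClosedPoint Q) = x) :
    ∃ ρ : X.presheaf.stalk x →+* Q, IsLocalHom ρ ∧
      Spec.map (CommRingCat.ofHom ρ) ≫ X.stalkSpec x = h := by
  subst hx
  exact ⟨(stalkClosedPointTo h).hom, isLocalHom_stalkClosedPointTo (R := .of Q) h,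
    Spec_stalkClosedPointTo_fromSpecStalk h⟩

theorem specMap_fromSpecStalk_injective {X : Scheme.{u}} (x : X) {A : Type u} [CommRing A]
    {f g : X.presheaf.stalk x →+* A}
    (h : Spec.map (CommRingCat.ofHom f) ≫ X.fromSpecStalk x =
      Spec.map (CommRingCat.ofHom g) ≫ X.fromSpecStalk x) : f = g := by
  rw [cancel_mono, Spec.map_inj] at h
  exact congrArg CommRingCat.Hom.hom h

/-- The inclusion of the generic point, as a morphism from the spectrum of the function field. -/
noncomputable def genericSpec (X : Scheme.{u}) [IrreducibleSpace X] :
    Spec (.of X.functionField) ⟶ X :=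
  X.fromSpecStalk (genericPoint X)

instance (X : Scheme.{u}) [IrreducibleSpace X] : Mono X.genericSpec :=
  inferInstanceAs (Mono (X.fromSpecStalk (genericPoint X)))

theorem genericSpec_specClosedPoint (X : Scheme.{u}) [IsIntegral X] :
    X.genericSpec (specClosedPoint X.functionField) = genericPoint X :=
  fromSpecStalk_closedPoint

theorem genericSpec_comp_eq_specMap {k : Type u} [Field k] {X : Scheme.{u}} [IrreducibleSpace X]
    (sX : X ⟶ Spec (CommRingCat.of k)) :
    X.genericSpec ≫ sX = Spec.map (CommRingCat.ofHom (functionFieldAlgebraMap sX).hom) := by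
  have h := Scheme.fromSpecStalk_toSpecΓ X (genericPoint X)
  change X.fromSpecStalk (genericPoint X) ≫ sX = Spec.map (functionFieldAlgebraMap sX)
  rw [functionFieldAlgebraMap, Spec.map_comp, Spec.map_comp, ← h, Category.assoc, Category.assoc,
    ← Scheme.toSpecΓ_naturality_assoc]
  simp

theorem specMap_genericSpec_injective {X : Scheme.{u}} [IrreducibleSpace X] {A : Type u}
    [CommRing A] {f g : X.functionField →+* A}
    (h : Spec.map (CommRingCat.ofHom f) ≫ X.genericSpec =
      Spec.map (CommRingCat.ofHom g) ≫ X.genericSpec) : f = g :=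
  specMap_fromSpecStalk_injective (genericPoint X) h

/-- A morphism from the spectrum of a local ring to an integral scheme whose closed point lands
at the generic point factors through the function field. -/
theorem exists_ringHom_functionField {X : Scheme.{u}} [IsIntegral X] {Q Ω : Type u} [CommRing Q]
    [Field Ω] (h : Spec (.of Q) ⟶ X) (π : Q →+* Ω) [IsLocalHom π] (j : X.functionField →+* Ω)
    (hj : Spec.map (CommRingCat.ofHom π) ≫ h = Spec.map (CommRingCat.ofHom j) ≫ X.genericSpec) :
    ∃ ρ : X.functionField →+* Q,
      Spec.map (CommRingCat.ofHom ρ) ≫ X.genericSpec = h ∧ π.comp ρ = j := by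
  have : IsLocalRing Q := RingHom.domain_isLocalRing π
  have hx : h (specClosedPoint Q) = genericPoint X := by
    rw [← specMap_comp_specClosedPoint π h, hj, specMap_comp_specClosedPoint,
      genericSpec_specClosedPoint]
  obtain ⟨ρ, -, hρ⟩ := exists_ringHom_stalk h _ hx
  have hρ' : Spec.map (CommRingCat.ofHom ρ) ≫ X.genericSpec = h := hρ
  refine ⟨ρ, hρ', specMap_genericSpec_injective ?_⟩
  rw [← hj, ← hρ', CommRingCat.ofHom_comp, Spec.map_comp, Category.assoc]

/-- A morphism from the spectrum of a local ring factors through an open subset containing the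
image of the closed point. -/
theorem exists_lift_opens {X : Scheme.{u}} {Q : Type u} [CommRing Q] [IsLocalRing Q]
    (h : Spec (.of Q) ⟶ X) (U : X.Opens) (hU : h (specClosedPoint Q) ∈ U) :
    ∃ h' : Spec (.of Q) ⟶ U, h' ≫ U.ι = h := by
  have : h ⁻¹ᵁ U = ⊤ := preimage_eq_top_of_closedPoint_mem h hU
  refine ⟨IsOpenImmersion.lift U.ι h ?_, IsOpenImmersion.lift_fac _ _ _⟩
  rintro _ ⟨x, rfl⟩
  rw [Scheme.Opens.range_ι]
  have : x ∈ h ⁻¹ᵁ U := this ▸ trivial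
  exact this

end AlgebraicGeometry.Scheme

end FunctionFieldLifting

end

section

section ProjectiveSpaceCharts

theorem MvPolynomial.IsHomogeneous.eval₂_mul_right {σ R S : Type*} [Fintype σ] [CommSemiring R]
    [CommSemiring S] {f : MvPolynomial σ R} {n : ℕ} (hf : f.IsHomogeneous n) (g : R →+* S)
    (x : σ → S) (w : S) : f.eval₂ g (fun j => x j * w) = f.eval₂ g x * w ^ n := by
  rw [MvPolynomial.eval₂_eq', MvPolynomial.eval₂_eq', Finset.sum_mul]
  refine Finset.sum_congr rfl fun d hd => ?_
  simp only [mul_pow, Finset.prod_mul_distrib, Finset.prod_pow_eq_pow_sum, mul_assoc]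
  rw [← hf (MvPolynomial.mem_support_iff.mp hd), Finsupp.weight_apply, Finsupp.sum_fintype]
  · simp
  · simp

namespace ProjSpace

variable (k : Type u) [Field k] (N : ℕ)

/-- The coordinate ring of a standard affine chart of projective space. -/
abbrev ChartRing (i : Fin (N + 1)) : Type u :=
  HomogeneousLocalization.Away (MvPolynomial.homogeneousSubmodule (Fin (N + 1)) k)
    (MvPolynomial.X i)

theorem X_mem (i : Fin (N + 1)) :
    (MvPolynomial.X i : MvPolynomial (Fin (N + 1)) k) ∈
      MvPolynomial.homogeneousSubmodule (Fin (N + 1)) k 1 :=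
  MvPolynomial.isHomogeneous_X k i

/-- A standard affine chart of projective space. -/
noncomputable def chart (i : Fin (N + 1)) : Spec (.of (ChartRing k N i)) ⟶ ProjSpace k N :=
  Proj.awayι _ (MvPolynomial.X i) (X_mem k N i) one_pos

instance (i : Fin (N + 1)) : IsOpenImmersion (chart k N i) :=
  inferInstanceAs (IsOpenImmersion (Proj.awayι _ _ _ _))

/-- The inclusion of the ground field in the coordinate ring of a standard chart. -/
noncomputable def chartConst (i : Fin (N + 1)) : k →+* ChartRing k N i :=
  (HomogeneousLocalization.fromZeroRingHom _ _).comp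
    ((GradedRing.projZeroRingHom' (MvPolynomial.homogeneousSubmodule (Fin (N + 1)) k)).comp
      MvPolynomial.C)

theorem chart_structMap (i : Fin (N + 1)) :
    chart k N i ≫ structMap k N = Spec.map (CommRingCat.ofHom (chartConst k N i)) := by
  refine (congrArg (· ≫ Spec.map _) (Proj.awayι_toSpecZero
    (MvPolynomial.homogeneousSubmodule (Fin (N + 1)) k) _ (X_mem k N i) one_pos)).trans ?_
  exact (Spec.map_comp _ _).symm

/-- The coordinates on a standard chart. -/
noncomputable def chartCoord (i j : Fin (N + 1)) : ChartRing k N i :=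
  HomogeneousLocalization.Away.mk _ (X_mem k N i) 1 (MvPolynomial.X j)
    (by rw [one_smul]; exact X_mem k N j)

theorem val_chartConst (i : Fin (N + 1)) (x : k) :
    (chartConst k N i x).val =
      algebraMap _ _ (MvPolynomial.C x : MvPolynomial (Fin (N + 1)) k) := by
  have h0 : (MvPolynomial.C x : MvPolynomial (Fin (N + 1)) k) ∈
      MvPolynomial.homogeneousSubmodule (Fin (N + 1)) k 0 := MvPolynomial.isHomogeneous_C _ x
  change HomogeneousLocalization.val (HomogeneousLocalization.mk _) = _
  rw [HomogeneousLocalization.val_mk, ← Localization.mk_one_eq_algebraMap]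
  congr 1
  exact DirectSum.decompose_of_mem_same _ h0

/-- The polynomial ring mapping to the coordinate ring of a standard chart. -/
noncomputable def chartPoly (i : Fin (N + 1)) :
    MvPolynomial (Fin (N + 1)) k →+* ChartRing k N i :=
  MvPolynomial.eval₂Hom (chartConst k N i) (chartCoord k N i)

theorem val_chartPoly (i : Fin (N + 1)) {f : MvPolynomial (Fin (N + 1)) k} {n : ℕ}
    (hf : f.IsHomogeneous n) :
    (chartPoly k N i f).val = Localization.mk f ((⟨MvPolynomial.X i, 1, pow_one _⟩ :
      Submonoid.powers (MvPolynomial.X i : MvPolynomial (Fin (N + 1)) k)) ^ n) := by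
  have h1 : (algebraMap (ChartRing k N i)
      (Localization.Away (MvPolynomial.X i : MvPolynomial (Fin (N + 1)) k))).comp
        (chartPoly k N i) = MvPolynomial.eval₂Hom
        ((algebraMap (MvPolynomial (Fin (N + 1)) k)
          (Localization.Away (MvPolynomial.X i))).comp MvPolynomial.C)
        (fun j => algebraMap (MvPolynomial (Fin (N + 1)) k) _ (MvPolynomial.X j) *
          Localization.mk 1 (⟨MvPolynomial.X i, 1, pow_one _⟩ :
            Submonoid.powers (MvPolynomial.X i : MvPolynomial (Fin (N + 1)) k))) := by
    apply MvPolynomial.ringHom_ext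
    · intro x
      simp only [RingHom.comp_apply, chartPoly, MvPolynomial.eval₂Hom_C]
      exact val_chartConst k N i x
    · intro j
      simp only [RingHom.comp_apply, chartPoly, MvPolynomial.eval₂Hom_X']
      refine (HomogeneousLocalization.Away.val_mk _ _ (X_mem k N i) _ _).trans ?_
      rw [← Localization.mk_one_eq_algebraMap, Localization.mk_mul]
      simp
  have h2 := RingHom.congr_fun h1 f
  refine h2.trans ?_
  rw [MvPolynomial.coe_eval₂Hom, hf.eval₂_mul_right, Localization.mk_pow, one_pow]
  have h3 : MvPolynomial.eval₂Hom ((algebraMap (MvPolynomial (Fin (N + 1)) k)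
      (Localization.Away (MvPolynomial.X i : MvPolynomial (Fin (N + 1)) k))).comp MvPolynomial.C)
        (fun j => algebraMap (MvPolynomial (Fin (N + 1)) k)
          (Localization.Away (MvPolynomial.X i : MvPolynomial (Fin (N + 1)) k)) (MvPolynomial.X j)) =
      algebraMap (MvPolynomial (Fin (N + 1)) k) (Localization.Away (MvPolynomial.X i)) := by
    apply MvPolynomial.ringHom_ext <;> simp
  rw [← MvPolynomial.coe_eval₂Hom, h3, ← Localization.mk_one_eq_algebraMap, Localization.mk_mul, mul_one, one_mul]

theorem chartPoly_surjective (i : Fin (N + 1)) : Function.Surjective (chartPoly k N i) := by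
  intro x
  obtain ⟨n, f, hf, rfl⟩ := HomogeneousLocalization.Away.mk_surjective _ (X_mem k N i) x
  refine ⟨f, ?_⟩
  apply HomogeneousLocalization.val_injective
  rw [HomogeneousLocalization.Away.val_mk, val_chartPoly k N i (n := n) (by simpa using hf)]
  congr 1

theorem exists_chartRing_hom {R : Type u} [CommRing R] (c : k →+* R) (i : Fin (N + 1))
    (v : Fin (N + 1) → R) (hv : v i = 1) :
    ∃ h : ChartRing k N i →+* R, h.comp (chartConst k N i) = c ∧
      ∀ j, h (chartCoord k N i j) = v j := by
  let e : MvPolynomial (Fin (N + 1)) k →+* R := MvPolynomial.eval₂Hom c v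
  have he : IsUnit (e (MvPolynomial.X i)) := by
    simp [e, hv]
  let l : Localization.Away (MvPolynomial.X i : MvPolynomial (Fin (N + 1)) k) →+* R :=
    IsLocalization.Away.lift (MvPolynomial.X i) he
  have hl : ∀ x, l (algebraMap _ _ x) = e x := fun x => IsLocalization.Away.lift_eq _ _ _
  refine ⟨l.comp (algebraMap (ChartRing k N i) _), RingHom.ext fun x => ?_, fun j => ?_⟩
  · change l (chartConst k N i x).val = _
    rw [val_chartConst, hl]
    simp [e]
  · change l (chartCoord k N i j).val = _
    have h1 : (chartCoord k N i j).val *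
        algebraMap (MvPolynomial (Fin (N + 1)) k) _ (MvPolynomial.X i) =
        algebraMap (MvPolynomial (Fin (N + 1)) k) _ (MvPolynomial.X j) := by
      rw [chartCoord, HomogeneousLocalization.Away.val_mk, ← Localization.mk_one_eq_algebraMap,
        ← Localization.mk_one_eq_algebraMap, Localization.mk_mul, Localization.mk_eq_mk_iff,
        Localization.r_iff_exists]
      exact ⟨1, by simp [mul_comm]⟩
    have h2 := congrArg l h1
    rw [map_mul, hl, hl] at h2
    simpa [e, hv] using h2

theorem chartRing_hom_ext {R : Type u} [CommRing R] {i : Fin (N + 1)}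
    {f g : ChartRing k N i →+* R} (h : f.comp (chartConst k N i) = g.comp (chartConst k N i))
    (h' : ∀ j, f (chartCoord k N i j) = g (chartCoord k N i j)) : f = g := by
  rw [← RingHom.cancel_right (chartPoly_surjective k N i)]
  apply MvPolynomial.ringHom_ext
  · intro x
    simpa [chartPoly] using RingHom.congr_fun h x
  · intro j
    simpa [chartPoly] using h' j

theorem chartCoord_self (i : Fin (N + 1)) : chartCoord k N i i = 1 := by
  apply HomogeneousLocalization.val_injective
  rw [chartCoord, HomogeneousLocalization.Away.val_mk, HomogeneousLocalization.val_one,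
    ← Localization.mk_one, Localization.mk_eq_mk_iff, Localization.r_iff_exists]
  exact ⟨1, by simp⟩

theorem iSup_opensRange_chart : ⨆ i, (chart k N i).opensRange = ⊤ := by
  refine (iSup_congr fun i => Proj.opensRange_awayι
    (MvPolynomial.homogeneousSubmodule (Fin (N + 1)) k) _ (X_mem k N i) one_pos).trans ?_
  refine Proj.iSup_basicOpen_eq_top' _ _ (fun i => ⟨1, X_mem k N i⟩) ?_
  refine top_le_iff.mp fun x _ => ?_
  have hx : x ∈ Algebra.adjoin k (Set.range (MvPolynomial.X : Fin (N + 1) → _)) := by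
    rw [MvPolynomial.adjoin_range_X]
    trivial
  induction hx using Algebra.adjoin_induction with
  | mem x hx => exact Algebra.subset_adjoin hx
  | algebraMap r =>
    exact Subalgebra.algebraMap_mem _
      (⟨MvPolynomial.C r, MvPolynomial.isHomogeneous_C _ r⟩ :
        MvPolynomial.homogeneousSubmodule (Fin (N + 1)) k 0)
  | add x y _ _ hx hy => exact add_mem (hx trivial) (hy trivial)
  | mul x y _ _ hx hy => exact mul_mem (hx trivial) (hy trivial)

theorem exists_mem_opensRange_chart (x : ProjSpace k N) : ∃ i, x ∈ (chart k N i).opensRange := by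
  have : x ∈ ⨆ i, (chart k N i).opensRange := by
    rw [iSup_opensRange_chart]
    trivial
  exact Opens.mem_iSup.mp this

instance (i : Fin (N + 1)) : IsDomain (ChartRing k N i) := by
  have : IsDomain (Localization.Away (MvPolynomial.X i : MvPolynomial (Fin (N + 1)) k)) :=
    IsLocalization.isDomain_localization
      (powers_le_nonZeroDivisors_of_noZeroDivisors (MvPolynomial.X_ne_zero i))
  exact (HomogeneousLocalization.val_injective _).isDomain (algebraMap (ChartRing k N i)
    (Localization.Away (MvPolynomial.X i : MvPolynomial (Fin (N + 1)) k)))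

/-- The generic point of projective space. -/
noncomputable def zeroPoint : ProjSpace k N :=
  (⟨⊥, Ideal.isPrime_bot, fun h => by
    have h1 : (MvPolynomial.X 0 : MvPolynomial (Fin (N + 1)) k) ∈
        HomogeneousIdeal.irrelevant (MvPolynomial.homogeneousSubmodule (Fin (N + 1)) k) := by
      rw [HomogeneousIdeal.mem_irrelevant_iff, GradedRing.proj_apply,
        DirectSum.decompose_of_mem_ne _ (X_mem k N 0) one_ne_zero]
    exact MvPolynomial.X_ne_zero 0 ((Submodule.mem_bot _).mp (h h1))⟩ :
    ProjectiveSpectrum (MvPolynomial.homogeneousSubmodule (Fin (N + 1)) k))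

instance : IsIntegral (ProjSpace k N) := by
  have : IsReduced (ProjSpace k N) := by
    have (x : ProjSpace k N) : _root_.IsReduced ((ProjSpace k N).presheaf.stalk x) := by
      obtain ⟨i, y, rfl⟩ := exists_mem_opensRange_chart k N x
      exact isReduced_of_injective _
        (asIso ((chart k N i).stalkMap y)).commRingCatIsoToRingEquiv.injective
    exact isReduced_of_isReduced_stalk _
  have hirr : IrreducibleSpace (ProjSpace k N) := by
    have h : closure {zeroPoint k N} = Set.univ := by
      refine Set.eq_univ_of_forall fun x => mem_closure_iff.mpr fun U hU hx => ?_
      obtain ⟨_, ⟨_, ⟨f, rfl⟩, rfl⟩, hxf, hfU⟩ := (Proj.isBasis_basicOpen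
        (MvPolynomial.homogeneousSubmodule (Fin (N + 1)) k)).exists_subset_of_mem_open hx hU
      refine ⟨zeroPoint k N, hfU fun h0 => hxf ?_, rfl⟩
      have : f = 0 := (Submodule.mem_bot _).mp h0
      rw [this]
      exact zero_mem _
    rw [irreducibleSpace_def, Set.top_eq_univ, ← h]
    exact isIrreducible_singleton.closure
  exact isIntegral_of_irreducibleSpace_of_isReduced _

end ProjSpace

end ProjectiveSpaceCharts

end

section

section RetractRationalLocalSections

namespace AlgebraicGeometry.Scheme

theorem specMap_injective {A B : Type u} [CommRing A] [CommRing B] {f g : A →+* B}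
    (h : Spec.map (CommRingCat.ofHom f) = Spec.map (CommRingCat.ofHom g)) : f = g :=
  congrArg CommRingCat.Hom.hom (Spec.map_injective h)

theorem exists_specMap_eq {A B : Type u} [CommRing A] [CommRing B]
    (c : Spec (.of B) ⟶ Spec (.of A)) :
    ∃ φ : A →+* B, Spec.map (CommRingCat.ofHom φ) = c :=
  ⟨(Spec.preimage c).hom, by simp⟩

theorem exists_lift_of_isOpenImmersion {U X : Scheme.{u}} {Q : Type u} [CommRing Q]
    [IsLocalRing Q] (h : Spec (.of Q) ⟶ X) (i : U ⟶ X) [IsOpenImmersion i]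
    (hi : h (specClosedPoint Q) ∈ i.opensRange) : ∃ h' : Spec (.of Q) ⟶ U, h' ≫ i = h := by
  obtain ⟨h', rfl⟩ := exists_lift_opens h _ hi
  exact ⟨h' ≫ i.isoOpensRange.inv, by simp⟩

theorem genericPoint_mem_of_dense {X : Scheme.{u}} [IrreducibleSpace X] {U : X.Opens}
    (hU : Dense (U : Set X)) : genericPoint X ∈ U :=
  ((genericPoint_spec X).mem_open_set_iff U.2).mpr (by simpa using hU.nonempty)

end AlgebraicGeometry.Scheme

open AlgebraicGeometry.Scheme

theorem IsRetractRational.hasLocalSections {k : Type u} [Field k] {X : Scheme.{u}} [IsIntegral X]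
    {sX : X ⟶ Spec (CommRingCat.of k)} (h : IsRetractRational k X sX) :
    HasLocalSections (functionFieldAlgebraMap sX).hom := by
  intro R _ κ π _ hπ hκ
  obtain ⟨N, -, f, g, hf, hg, U, hU, hle, lift, h1, h2⟩ := h
  have : IsLocalRing R := RingHom.domain_isLocalRing π
  obtain ⟨a, ha⟩ := exists_lift_opens X.genericSpec U
    (by rw [genericSpec_specClosedPoint]; exact genericPoint_mem_of_dense hU)
  let b : Spec (.of X.functionField) ⟶ ProjSpace k N := a ≫ lift ≫ g.domain.ι
  have hb : b ≫ ProjSpace.structMap k N = 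
      Spec.map (CommRingCat.ofHom (functionFieldAlgebraMap sX).hom) := by
    rw [← genericSpec_comp_eq_specMap, ← ha]
    simp only [b, Category.assoc]
    rw [reassoc_of% h1, hf]
    simp
  obtain ⟨i, hi⟩ := ProjSpace.exists_mem_opensRange_chart k N (b (specClosedPoint _))
  obtain ⟨c, hc⟩ := exists_lift_of_isOpenImmersion b (ProjSpace.chart k N i) hi
  obtain ⟨φ, rfl⟩ := exists_specMap_eq c
  have hφ : φ.comp (ProjSpace.chartConst k N i) = (functionFieldAlgebraMap sX).hom := by
    rw [← hc, Category.assoc, ProjSpace.chart_structMap, ← Spec.map_comp] at hb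
    exact specMap_injective hb
  obtain ⟨v, hv⟩ : ∃ v : Fin (N + 1) → R, v i = 1 ∧
      ∀ j, π (v j) = φ (ProjSpace.chartCoord k N i j) := by
    choose w hw using fun j => hπ (φ (ProjSpace.chartCoord k N i j))
    refine ⟨Function.update w i 1, by simp, fun j => ?_⟩
    by_cases hj : j = i
    · subst hj
      simp [ProjSpace.chartCoord_self]
    · simp [hj, hw]
  obtain ⟨ρ, hρ, hρ'⟩ := ProjSpace.exists_chartRing_hom k N κ i v hv.1
  have hπρ : π.comp ρ = φ := by
    apply ProjSpace.chartRing_hom_ext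
    · rw [RingHom.comp_assoc, hρ, hκ, hφ]
    · intro j
      rw [RingHom.comp_apply, hρ', hv.2]
  let d : Spec (.of R) ⟶ ProjSpace k N :=
    Spec.map (CommRingCat.ofHom ρ) ≫ ProjSpace.chart k N i
  have hd : Spec.map (CommRingCat.ofHom π) ≫ d = b := by
    rw [← hc, ← hπρ, CommRingCat.ofHom_comp, Spec.map_comp, Category.assoc]
  obtain ⟨d', hd'⟩ := exists_lift_opens d g.domain (by
    rw [← specMap_comp_specClosedPoint π d, hd]
    exact (a ≫ lift) _ |>.2)
  have hd'' : Spec.map (CommRingCat.ofHom π) ≫ d' = a ≫ lift := by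
    rw [← cancel_mono g.domain.ι, Category.assoc, hd', hd, Category.assoc]
  obtain ⟨s, hs, hs'⟩ := exists_ringHom_functionField (d' ≫ g.hom) π (RingHom.id _) (by
    rw [reassoc_of% hd'', h2, ha]
    simp)
  refine ⟨s, hs', ?_⟩
  refine specMap_injective ?_
  rw [CommRingCat.ofHom_comp, Spec.map_comp, ← genericSpec_comp_eq_specMap, reassoc_of% hs, hg,
    reassoc_of% hd']
  simp only [d, Category.assoc]
  rw [ProjSpace.chart_structMap, ← Spec.map_comp, ← hρ, CommRingCat.ofHom_comp]

end RetractRationalLocalSections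

end

section

section LocalSectionsRetractRational

namespace AlgebraicGeometry.Scheme

theorem exists_isAffineOpen_mem (X : Scheme.{u}) (x : X) :
    ∃ U : X.Opens, IsAffineOpen U ∧ x ∈ U := by
  obtain ⟨_, ⟨U, hU, rfl⟩, hxU, -⟩ := X.isBasis_affineOpens.exists_subset_of_mem_open
    (Set.mem_univ x) isOpen_univ
  exact ⟨U, hU, hxU⟩

theorem genericSpec_eq_of_isAffineOpen {X : Scheme.{u}} [IsIntegral X] {U : X.Opens} [Nonempty U]
    (hU : IsAffineOpen U) :
    X.genericSpec = Spec.map (CommRingCat.ofHom (X.germToFunctionField U).hom) ≫ hU.fromSpec :=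
  (hU.fromSpecStalk_eq_fromSpecStalk _).symm

theorem isDominant_of_comp_ι_eq_genericSpec {X : Scheme.{u}} [IsIntegral X] {V : X.Opens}
    (a : Spec (.of X.functionField) ⟶ V) (ha : a ≫ V.ι = X.genericSpec) : IsDominant a := by
  rw [isDominant_iff, DenseRange, dense_iff_inter_open]
  rintro W hW ⟨w₀, hw₀⟩
  have h1 : V.ι (a (specClosedPoint _)) = genericPoint X := by
    rw [← Scheme.Hom.comp_apply, ha, genericSpec_specClosedPoint]
  have h2 : genericPoint X ∈ V.ι '' W :=
    ((genericPoint_spec X).mem_open_set_iff (V.ι.isOpenEmbedding.isOpenMap W hW)).mpr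
      ⟨V.ι w₀, trivial, w₀, hw₀, rfl⟩
  obtain ⟨w, hw, hwx⟩ := h2
  refine ⟨w, hw, specClosedPoint _, V.ι.isOpenEmbedding.injective ?_⟩
  rw [h1, hwx]

/-- An integral affine open of a scheme locally of finite type over a field is the spectrum of a
quotient of the coordinate ring of a standard chart of projective space. -/
theorem exists_surjective_chartRing_hom {k A : Type u} [Field k] [CommRing A] (c : k →+* A)
    (hc : c.FiniteType) : ∃ (N : ℕ) (_ : 1 ≤ N) (ψ : ProjSpace.ChartRing k N 0 →+* A),
      Function.Surjective ψ ∧ ψ.comp (ProjSpace.chartConst k N 0) = c := by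
  let _ := c.toAlgebra
  have : Algebra.FiniteType k A := hc
  obtain ⟨n, w, hw⟩ := Algebra.FiniteType.iff_quotient_mvPolynomial''.mp this
  obtain ⟨ψ, hψ, hψ'⟩ := ProjSpace.exists_chartRing_hom k (n + 1) c 0
    (Fin.cons 1 (Fin.cons 0 fun i => w (MvPolynomial.X i))) rfl
  refine ⟨n + 1, by simp, ψ, fun x => ?_, hψ⟩
  obtain ⟨p, rfl⟩ := hw x
  refine ⟨MvPolynomial.eval₂Hom (ProjSpace.chartConst k (n + 1) 0)
    (fun i : Fin n => ProjSpace.chartCoord k (n + 1) 0 i.succ.succ) p, ?_⟩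
  have : ψ.comp (MvPolynomial.eval₂Hom (ProjSpace.chartConst k (n + 1) 0)
      (fun i : Fin n => ProjSpace.chartCoord k (n + 1) 0 i.succ.succ)) = w := by
    apply MvPolynomial.ringHom_ext
    · intro x
      simpa using (RingHom.congr_fun hψ x).trans (w.commutes x).symm
    · intro i
      simp [hψ']
  exact RingHom.congr_fun this p

end AlgebraicGeometry.Scheme

open AlgebraicGeometry.Scheme

theorem isRetractRational_of_hasLocalSections {k : Type u} [Field k] {X : Scheme.{u}}
    [IsIntegral X] (sX : X ⟶ Spec (CommRingCat.of k)) [LocallyOfFiniteType sX] [IsSeparated sX]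
    (h : HasLocalSections (functionFieldAlgebraMap sX).hom) : IsRetractRational k X sX := by
  obtain ⟨U, hU, hxU⟩ := exists_isAffineOpen_mem X (genericPoint X)
  have : Nonempty U := ⟨⟨_, hxU⟩⟩
  obtain ⟨c, hc⟩ := exists_specMap_eq (A := k) (B := Γ(X, U)) (hU.fromSpec ≫ sX)
  have hcft : c.FiniteType := by
    have : LocallyOfFiniteType (Spec.map (CommRingCat.ofHom c)) := by
      rw [hc]
      infer_instance
    exact HasRingHomProperty.Spec_iff.mp this
  obtain ⟨N, hN, ψ, hψ, hψc⟩ := exists_surjective_chartRing_hom c hcft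
  let e : (U : Scheme.{u}) ⟶ ProjSpace k N :=
    hU.isoSpec.hom ≫ Spec.map (CommRingCat.ofHom ψ) ≫ ProjSpace.chart k N 0
  have he : e ≫ ProjSpace.structMap k N = U.ι ≫ sX := by
    simp only [e, Category.assoc]
    rw [ProjSpace.chart_structMap, ← Spec.map_comp, ← CommRingCat.ofHom_comp, hψc, hc,
      ← IsAffineOpen.isoSpec_inv_ι_assoc, Iso.hom_inv_id_assoc]
  let γ : Γ(X, U) →+* X.functionField := (X.germToFunctionField U).hom
  let a : Spec (.of X.functionField) ⟶ U := Spec.map (CommRingCat.ofHom γ) ≫ hU.isoSpec.inv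
  have ha : a ≫ U.ι = X.genericSpec := by
    rw [genericSpec_eq_of_isAffineOpen hU, Category.assoc, IsAffineOpen.isoSpec_inv_ι]
  let b := a ≫ e
  have hb : b = Spec.map (CommRingCat.ofHom (γ.comp ψ)) ≫ ProjSpace.chart k N 0 := by
    simp [b, a, e]
  have hbs : b ≫ ProjSpace.structMap k N =
      Spec.map (CommRingCat.ofHom (functionFieldAlgebraMap sX).hom) := by
    rw [Category.assoc, he, reassoc_of% ha, genericSpec_comp_eq_specMap]
  obtain ⟨p, hp⟩ : ∃ p, b (specClosedPoint X.functionField) = p := ⟨_, rfl⟩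
  obtain ⟨ρ, hρ, hρb⟩ := exists_ringHom_stalk b p hp
  obtain ⟨θ', hθ'⟩ := exists_lift_of_isOpenImmersion
    (Q := (ProjSpace k N).presheaf.stalk p) ((ProjSpace k N).stalkSpec p)
    (ProjSpace.chart k N 0) (by
      rw [stalkSpec_specClosedPoint, ← hp, hb]
      exact ⟨_, rfl⟩)
  obtain ⟨θ, rfl⟩ := exists_specMap_eq θ'
  have hρθ : ρ.comp θ = γ.comp ψ := by
    refine specMap_injective ?_
    rw [← cancel_mono (ProjSpace.chart k N 0), ← hb, CommRingCat.ofHom_comp, Spec.map_comp,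
      Category.assoc, hθ', hρb]
  have hρs : Function.Surjective ρ := by
    intro x
    have := functionField_isFractionRing_of_isAffineOpen X U hU
    obtain ⟨y, z, hz, rfl⟩ := IsFractionRing.div_surjective (A := Γ(X, U)) x
    obtain ⟨y, rfl⟩ := hψ y
    obtain ⟨z, rfl⟩ := hψ z
    have h1 (t) : algebraMap Γ(X, U) X.functionField (ψ t) = ρ (θ t) :=
      (RingHom.congr_fun hρθ t).symm
    have hz' : IsUnit (θ z) := by
      refine isUnit_of_map_unit ρ _ (IsUnit.mk0 _ ?_)
      rw [← h1]
      exact IsFractionRing.to_map_ne_zero_of_mem_nonZeroDivisors hz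
    obtain ⟨w, hw⟩ := hz'.exists_right_inv
    refine ⟨θ y * w, ?_⟩
    rw [h1, h1, eq_div_iff (hz'.map ρ).ne_zero, ← map_mul, mul_assoc, mul_comm w, hw, mul_one]
  obtain ⟨κ, hκ⟩ := exists_specMap_eq (A := k) (B := (ProjSpace k N).presheaf.stalk p)
    ((ProjSpace k N).stalkSpec p ≫ ProjSpace.structMap k N)
  have hρκ : ρ.comp κ = (functionFieldAlgebraMap sX).hom := specMap_injective (by
    rw [CommRingCat.ofHom_comp, Spec.map_comp, hκ, reassoc_of% hρb, hbs])
  obtain ⟨s, hs, hsκ⟩ := h _ κ ρ hρs hρκ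
  let φ : Spec (.of ((ProjSpace k N).presheaf.stalk p)) ⟶ X :=
    Spec.map (CommRingCat.ofHom s) ≫ X.genericSpec
  have hφ : φ ≫ sX = (ProjSpace k N).stalkSpec p ≫ ProjSpace.structMap k N := by
    rw [← hκ, ← hsκ, Category.assoc, genericSpec_comp_eq_specMap, CommRingCat.ofHom_comp,
      Spec.map_comp]
  let g := PartialMap.ofFromSpecStalk (ProjSpace.structMap k N) sX φ hφ
  have hpg : p ∈ g.domain := PartialMap.mem_domain_ofFromSpecStalk _ _ _ _
  have hgφ : g.fromSpecStalkOfMem hpg = φ := PartialMap.fromSpecStalkOfMem_ofFromSpecStalk ..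
  have hgs : g.hom ≫ sX = g.domain.ι ≫ ProjSpace.structMap k N :=
    PartialMap.ofFromSpecStalk_comp _ _ _ _
  let V : X.Opens := U.ι ''ᵁ (e ⁻¹ᵁ g.domain)
  have hV : genericPoint X ∈ V := by
    refine ⟨a (specClosedPoint _), ?_, ?_⟩
    · change e (a (specClosedPoint _)) ∈ g.domain
      rw [← Scheme.Hom.comp_apply]
      exact hp ▸ hpg
    · change U.ι (a (specClosedPoint _)) = _
      rw [← Scheme.Hom.comp_apply, ha, genericSpec_specClosedPoint]
  have hVU : V ≤ U := by
    rintro _ ⟨y, -, rfl⟩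
    exact y.2
  have hrange : Set.range (X.homOfLE hVU ≫ e) ⊆ Set.range g.domain.ι := by
    rw [Scheme.Opens.range_ι]
    rintro _ ⟨x, rfl⟩
    obtain ⟨y, hy, hyx⟩ := x.2
    have : X.homOfLE hVU x = y := by
      apply U.ι.isOpenEmbedding.injective
      rw [← Scheme.Hom.comp_apply, Scheme.homOfLE_ι]
      exact hyx.symm
    rw [Scheme.Hom.comp_apply, this]
    exact hy
  let l := IsOpenImmersion.lift g.domain.ι (X.homOfLE hVU ≫ e) hrange
  have hl : l ≫ g.domain.ι = X.homOfLE hVU ≫ e := IsOpenImmersion.lift_fac _ _ _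
  refine ⟨N, hN, ⟨U, U.2.dense ⟨_, hxU⟩, e⟩, g, he, hgs, V, V.2.dense ⟨_, hV⟩, hVU, l, hl, ?_⟩
  obtain ⟨a', ha'⟩ := exists_lift_opens X.genericSpec V
    (by rwa [genericSpec_specClosedPoint])
  have ha'a : a' ≫ X.homOfLE hVU = a := by
    rw [← cancel_mono U.ι, Category.assoc, Scheme.homOfLE_ι, ha', ha]
  have : Nonempty V := ⟨⟨_, hV⟩⟩
  have ha'd : IsDominant a' := isDominant_of_comp_ι_eq_genericSpec a' ha'
  refine ext_of_isDominant_of_isSeparated sX ?_ a' ?_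
  · rw [Category.assoc, hgs, reassoc_of% hl, he, Scheme.homOfLE_ι_assoc]
  · have h1 : a' ≫ l = Spec.map (CommRingCat.ofHom ρ) ≫ g.domain.fromSpecStalkOfMem p hpg := by
      rw [← cancel_mono g.domain.ι, Category.assoc, hl, reassoc_of% ha'a]
      exact hρb.symm.trans (congrArg (Spec.map _ ≫ ·)
        (Opens.fromSpecStalkOfMem_ι g.domain p hpg).symm)
    rw [reassoc_of% h1, ha']
    have h2 : g.domain.fromSpecStalkOfMem p hpg ≫ g.hom = φ := hgφ
    rw [h2, ← Category.assoc, ← Spec.map_comp, ← CommRingCat.ofHom_comp, hs]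
    simp

end LocalSectionsRetractRational

end

section

section NormHypersurfaceFibration

open AlgebraicGeometry.Scheme

namespace AlgebraicGeometry.Scheme

theorem map_genericPoint_of_isDominant {X S : Scheme.{u}} [IsIntegral X] [IsIntegral S]
    (f : X ⟶ S) [IsDominant f] : f (genericPoint X) = genericPoint S := by
  refine (genericPoint_spec S).eq ?_ |>.symm
  have := (genericPoint_spec X).image f.continuous
  rwa [Set.image_univ, f.denseRange.closure_range] at this

theorem exists_genericSpec_comp_eq {X S : Scheme.{u}} [IsIntegral X] [IsIntegral S]
    (f : X ⟶ S) [IsDominant f] : ∃ j : S.functionField →+* X.functionField,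
      X.genericSpec ≫ f = Spec.map (CommRingCat.ofHom j) ≫ S.genericSpec := by
  obtain ⟨ρ, -, hρ⟩ := exists_ringHom_stalk (X.genericSpec ≫ f) (genericPoint S) (by
    rw [Scheme.Hom.comp_apply, genericSpec_specClosedPoint, map_genericPoint_of_isDominant])
  exact ⟨ρ, hρ.symm⟩

end AlgebraicGeometry.Scheme

theorem hasLocalSections_of_areBirationalOver {k L : Type u} [Field k] [IsAlgClosed k] [Field L]
    {S X : Scheme.{u}} [IsIntegral S] [IsIntegral X] (sS : S ⟶ Spec (CommRingCat.of k))
    (f : X ⟶ S) [IsDominant f] [Algebra S.functionField L] [FiniteDimensional S.functionField L]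
    (hℓ : (Module.finrank S.functionField L).Prime) {a : k} (ha : a ≠ 0)
    (hbir : AreBirationalOver (GenericFibre.structMap f)
      (NormHypersurface.structMap S.functionField L (functionFieldAlgebraMap sS a)))
    (hK : HasLocalSections (functionFieldAlgebraMap sS).hom)
    (hL : HasLocalSections
      ((algebraMap S.functionField L).comp (functionFieldAlgebraMap sS).hom)) :
    HasLocalSections (functionFieldAlgebraMap (f ≫ sS)).hom := by
  obtain ⟨F, G, hF, hG, ⟨U, hU, hUF, l, hl, hlG⟩, -⟩ := hbir
  intro R _ κ₀ π _ hπ hκ₀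
  have := RingHom.domain_isLocalRing π
  obtain ⟨j, hj⟩ := exists_genericSpec_comp_eq f
  let p₁ : GenericFibre f ⟶ X := pullback.fst f (S.fromSpecStalk (genericPoint S))
  have hp₁ : p₁ ≫ f = GenericFibre.structMap f ≫ S.genericSpec := pullback.condition
  obtain ⟨e, he₁, he₂⟩ : ∃ e : Spec (.of X.functionField) ⟶ GenericFibre f,
      e ≫ p₁ = X.genericSpec ∧ e ≫ GenericFibre.structMap f = Spec.map (CommRingCat.ofHom j) :=
    ⟨pullback.lift _ _ hj, pullback.lift_fst _ _ _, pullback.lift_snd _ _ _⟩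
  have heU : e (specClosedPoint _) ∈ U := by
    have hemb : Topology.IsEmbedding p₁ := by
      have : IsPreimmersion p₁ := by
        have : IsPreimmersion (S.fromSpecStalk (genericPoint S)) := inferInstance
        exact inferInstanceAs (IsPreimmersion (pullback.fst f (S.fromSpecStalk (genericPoint S))))
      exact p₁.isEmbedding
    obtain ⟨x, -, hx⟩ := hU.inter_open_nonempty Set.univ isOpen_univ ⟨e (specClosedPoint _), trivial⟩
    refine Specializes.mem_open (hemb.isInducing.specializes_iff.mp ?_) U.2 hx
    rw [← Scheme.Hom.comp_apply, he₁, genericSpec_specClosedPoint]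
    exact genericPoint_specializes _
  obtain ⟨e', he'⟩ := exists_lift_opens e U heU
  obtain ⟨g, hg⟩ := exists_specMap_eq
    (A := NormHypersurfaceRing S.functionField L (functionFieldAlgebraMap sS a))
    (e' ≫ (GenericFibre f).homOfLE hUF ≫ F.hom)
  have hgj : g.comp (algebraMap S.functionField _) = j := by
    refine specMap_injective ?_
    rw [CommRingCat.ofHom_comp, Spec.map_comp, hg, ← he₂, ← he']
    simp only [Category.assoc]
    congr 1
    rw [← Scheme.homOfLE_ι _ hUF, Category.assoc]
    exact congrArg (_ ≫ ·) hF
  have hjk : j.comp (functionFieldAlgebraMap sS).hom = (functionFieldAlgebraMap (f ≫ sS)).hom := by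
    refine specMap_injective ?_
    rw [CommRingCat.ofHom_comp, Spec.map_comp, ← genericSpec_comp_eq_specMap, ← reassoc_of% hj,
      genericSpec_comp_eq_specMap]
  obtain ⟨g', hg', hg'κ⟩ := NormHypersurfaceRing.exists_lift (functionFieldAlgebraMap sS).hom hK hL
    hℓ ha π hπ κ₀ g (by rw [hκ₀, hgj, hjk])
  have hπg : Spec.map (CommRingCat.ofHom π) ≫ Spec.map (CommRingCat.ofHom g') =
      (e' ≫ l) ≫ G.domain.ι := by
    rw [← Spec.map_comp, ← CommRingCat.ofHom_comp, hg', Category.assoc, hl]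
    exact hg
  obtain ⟨h', hh'⟩ := exists_lift_opens (X := NormHypersurface _ _ _)
    (Spec.map (CommRingCat.ofHom g')) G.domain (by
    have := congrArg (fun t => t (specClosedPoint X.functionField)) hπg
    dsimp only at this
    rw [specMap_comp_specClosedPoint] at this
    have h2 : ((e' ≫ l) ≫ G.domain.ι) (specClosedPoint X.functionField) ∈ G.domain :=
      ((e' ≫ l) (specClosedPoint _)).2
    exact this.symm ▸ h2)
  have hπh' : Spec.map (CommRingCat.ofHom π) ≫ h' = e' ≫ l :=
    (cancel_mono G.domain.ι).mp ((Category.assoc _ _ _).trans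
      ((congrArg (Spec.map (CommRingCat.ofHom π) ≫ ·) hh').trans hπg))
  obtain ⟨ρ, hρ, hπρ⟩ := exists_ringHom_functionField (h' ≫ G.hom ≫ p₁) π (RingHom.id _) (by
    rw [reassoc_of% hπh', reassoc_of% hlG, reassoc_of% he', he₁]
    simp)
  refine ⟨ρ, hπρ, specMap_injective ?_⟩
  have h1 : h' ≫ G.hom ≫ GenericFibre.structMap f =
      Spec.map (CommRingCat.ofHom (g'.comp (algebraMap S.functionField _))) := by
    rw [CommRingCat.ofHom_comp, Spec.map_comp]
    exact (congrArg (h' ≫ ·) hG).trans ((Category.assoc _ _ _).symm.trans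
      (congrArg (· ≫ NormHypersurface.structMap _ _ _) hh'))
  rw [CommRingCat.ofHom_comp, Spec.map_comp, ← genericSpec_comp_eq_specMap, reassoc_of% hρ,
    reassoc_of% hp₁, genericSpec_comp_eq_specMap, ← hg'κ, CommRingCat.ofHom_comp, Spec.map_comp]
  simpa using congrArg (· ≫ Spec.map (functionFieldAlgebraMap sS)) h1

end NormHypersurfaceFibration

end

section

section TensorProductDomain

open scoped TensorProduct

variable {k : Type*} [Field k]

lemma IsAlgClosed.exists_algHom_ne_zero [IsAlgClosed k] {A : Type*} [CommRing A] [IsReduced A] [Algebra k A]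
    [Algebra.FiniteType k A] {a : A} (ha : a ≠ 0) : ∃ p : A →ₐ[k] k, p a ≠ 0 := by
  have hnt : Nontrivial (Localization.Away a) := by
    rw [← not_subsingleton_iff_nontrivial, IsLocalization.subsingleton_iff (M := .powers a)]
    rintro ⟨n, hn⟩
    exact ha (eq_zero_of_pow_eq_zero hn)
  obtain ⟨𝔪, h𝔪⟩ := Ideal.exists_maximal (Localization.Away a)
  let _ : Field (Localization.Away a ⧸ 𝔪) := Ideal.Quotient.field 𝔪
  have : Algebra.FiniteType A (Localization.Away a) := IsLocalization.finiteType_of_monoid_fg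
    (Submonoid.powers a) _
  have : Algebra.FiniteType k (Localization.Away a) := .trans ‹_› this
  have : Module.Finite k (Localization.Away a ⧸ 𝔪) := finite_of_finite_type_of_isJacobsonRing _ _
  let e : k ≃ₐ[k] (Localization.Away a ⧸ 𝔪) := AlgEquiv.ofBijective (Algebra.ofId _ _)
    (IsAlgClosed.algebraMap_bijective_of_isIntegral)
  refine ⟨e.symm.toAlgHom.comp ((Ideal.Quotient.mkₐ k 𝔪).comp
    (IsScalarTower.toAlgHom k A (Localization.Away a))), ?_⟩
  exact ((IsLocalization.Away.algebraMap_isUnit (S := Localization.Away a) a).map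
    (e.symm.toAlgHom.comp (Ideal.Quotient.mkₐ k 𝔪))).ne_zero

/-- The evaluation of the coefficients of a tensor at a point. -/
noncomputable def Algebra.TensorProduct.evalLeft {A : Type*} [CommRing A] [Algebra k A]
    (B : Type*) [CommRing B] [Algebra k B] (p : A →ₐ[k] k) : A ⊗[k] B →ₐ[k] B :=
  Algebra.TensorProduct.lift ((Algebra.ofId k B).comp p) (AlgHom.id k B) (fun _ _ ↦ .all _ _)

lemma Algebra.TensorProduct.evalLeft_tmul {A B : Type*} [CommRing A] [Algebra k A]
    [CommRing B] [Algebra k B] (p : A →ₐ[k] k) (a : A) (b : B) :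
    evalLeft B p (a ⊗ₜ b) = p a • b := by
  simp [evalLeft, Algebra.smul_def, Algebra.ofId_apply]

/-- The coordinates of `evalLeft B p x` in a basis of `B` are the values at `p` of the
coordinates of `x`. -/
lemma Algebra.TensorProduct.repr_evalLeft {A B ι : Type*} [CommRing A] [Algebra k A]
    [CommRing B] [Algebra k B] (b : Module.Basis ι k B) (p : A →ₐ[k] k) (x : A ⊗[k] B) (i : ι) :
    b.repr (evalLeft B p x) i = p ((Algebra.TensorProduct.basis A b).repr x i) := by
  induction x with
  | zero => simp
  | add x y hx hy => simp [hx, hy]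
  | tmul a c => simp [evalLeft_tmul]

lemma IsAlgClosed.exists_evalLeft_ne_zero [IsAlgClosed k] {A B : Type*} [CommRing A] [IsReduced A] [Algebra k A]
    [Algebra.FiniteType k A] [CommRing B] [Algebra k B] {x : A ⊗[k] B} (hx : x ≠ 0) :
    ∃ p : A →ₐ[k] k, Algebra.TensorProduct.evalLeft B p x ≠ 0 := by
  let b := Module.Basis.ofVectorSpace k B
  obtain ⟨i, hi⟩ : ∃ i, (Algebra.TensorProduct.basis A b).repr x i ≠ 0 := by
    by_contra! h
    exact hx ((Algebra.TensorProduct.basis A b).repr.injective (Finsupp.ext (by simpa using h)))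
  obtain ⟨p, hp⟩ := exists_algHom_ne_zero (k := k) hi
  refine ⟨p, fun h ↦ hp ?_⟩
  rw [← Algebra.TensorProduct.repr_evalLeft, h]
  simp

lemma IsAlgClosed.isDomain_tensorProduct_of_finiteType [IsAlgClosed k] (A B : Type*) [CommRing A] [IsDomain A]
    [Algebra k A] [Algebra.FiniteType k A] [CommRing B] [IsDomain B] [Algebra k B] :
    IsDomain (A ⊗[k] B) := by
  have : NoZeroDivisors (A ⊗[k] B) := by
    refine ⟨fun {x y} hxy ↦ ?_⟩
    by_contra! h
    let b := Module.Basis.ofVectorSpace k B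
    let b' := Algebra.TensorProduct.basis A b
    have aux (x : A ⊗[k] B) (hx : x ≠ 0) : ∃ i, b'.repr x i ≠ 0 := by
      by_contra! h
      exact hx (b'.repr.injective (Finsupp.ext (by simpa using h)))
    obtain ⟨i, hi⟩ := aux x h.1
    obtain ⟨j, hj⟩ := aux y h.2
    obtain ⟨p, hp⟩ := exists_algHom_ne_zero (k := k) (mul_ne_zero hi hj)
    rw [map_mul, ← Algebra.TensorProduct.repr_evalLeft, ← Algebra.TensorProduct.repr_evalLeft]
      at hp
    have h0 := congr(Algebra.TensorProduct.evalLeft B p $hxy)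
    rw [map_mul, map_zero, mul_eq_zero] at h0
    obtain h0 | h0 := h0 <;> simp [h0] at hp
  have : Nontrivial (A ⊗[k] B) := by infer_instance
  exact NoZeroDivisors.to_isDomain _

theorem IsAlgClosed.isDomain_tensorProduct [IsAlgClosed k] (A B : Type*) [CommRing A] [IsDomain A]
    [Algebra k A] [CommRing B] [IsDomain B] [Algebra k B] :
    IsDomain (A ⊗[k] B) := by
  have : NoZeroDivisors (A ⊗[k] B) := by
    refine ⟨fun {x y} hxy ↦ ?_⟩
    obtain ⟨P, hP, x₁, hx₁⟩ := TensorProduct.Algebra.exists_of_fg x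
    obtain ⟨Q, hQ, y₁, hy₁⟩ := TensorProduct.Algebra.exists_of_fg y
    let R := P ⊔ Q
    have : Algebra.FiniteType k R := (Subalgebra.fg_iff_finiteType _).mp (hP.sup hQ)
    have := isDomain_tensorProduct_of_finiteType (k := k) R B
    let φ : R ⊗[k] B →ₐ[k] A ⊗[k] B := Algebra.TensorProduct.map R.val (AlgHom.id k B)
    have hφ : Function.Injective φ :=
      Module.Flat.rTensor_preserves_injective_linearMap (M := B) R.val.toLinearMap
        Subtype.val_injective
    obtain ⟨x₂, rfl⟩ : ∃ x₂, φ x₂ = x := by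
      refine ⟨Algebra.TensorProduct.map (Subalgebra.inclusion (le_sup_left : P ≤ R))
        (AlgHom.id k B) x₁, ?_⟩
      rw [← hx₁, ← AlgHom.comp_apply, ← Algebra.TensorProduct.map_comp]
      rfl
    obtain ⟨y₂, rfl⟩ : ∃ y₂, φ y₂ = y := by
      refine ⟨Algebra.TensorProduct.map (Subalgebra.inclusion (le_sup_right : Q ≤ R))
        (AlgHom.id k B) y₁, ?_⟩
      rw [← hy₁, ← AlgHom.comp_apply, ← Algebra.TensorProduct.map_comp]
      rfl
    rw [← map_mul, map_eq_zero_iff _ hφ, mul_eq_zero] at hxy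
    simpa [map_eq_zero_iff _ hφ] using hxy
  have : Nontrivial (A ⊗[k] B) := by infer_instance
  exact NoZeroDivisors.to_isDomain _

end TensorProductDomain

end

section

namespace AlgebraicGeometry

lemma isIntegral_pullback_Spec {k : Type u} [Field k] [IsAlgClosed k] {A B : CommRingCat.{u}}
    [IsDomain A] [IsDomain B] (f : Spec A ⟶ Spec (.of k)) (g : Spec B ⟶ Spec (.of k)) :
    IsIntegral (pullback f g) := by
  obtain ⟨φ, rfl⟩ := Scheme.exists_specMap_eq f
  obtain ⟨ψ, rfl⟩ := Scheme.exists_specMap_eq g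
  let _ := φ.toAlgebra
  let _ := ψ.toAlgebra
  have := IsAlgClosed.isDomain_tensorProduct (k := k) A B
  exact isIntegral_of_isOpenImmersion (pullbackSpecIso k A B).hom

lemma isIntegral_pullback {k : Type u} [Field k] [IsAlgClosed k] {X W : Scheme.{u}}
    (sX : X ⟶ Spec (.of k)) (sW : W ⟶ Spec (.of k)) [IsIntegral X] [IsIntegral W] :
    IsIntegral (pullback sX sW) := by
  have hred : IsReduced (pullback sX sW) := by
    let 𝒰 := Scheme.Pullback.openCoverOfLeftRight X.affineCover W.affineCover sX sW
    have (i : 𝒰.I₀) : IsReduced (𝒰.X i) := by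
      change IsReduced (pullback (X.affineCover.f i.1 ≫ sX) (W.affineCover.f i.2 ≫ sW))
      by_cases h0 : Nonempty (pullback (X.affineCover.f i.1 ≫ sX)
        (W.affineCover.f i.2 ≫ sW) : Scheme)
      · have : Nonempty (X.affineCover.X i.1) := h0.map fun z ↦ pullback.fst (X.affineCover.f i.1 ≫ sX) (W.affineCover.f i.2 ≫ sW) z
        have : Nonempty (W.affineCover.X i.2) := h0.map fun z ↦ pullback.snd (X.affineCover.f i.1 ≫ sX) (W.affineCover.f i.2 ≫ sW) z
        have h1 : IsIntegral (X.affineCover.X i.1) :=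
          isIntegral_of_isOpenImmersion (X.affineCover.f i.1)
        have h2 : IsIntegral (W.affineCover.X i.2) :=
          isIntegral_of_isOpenImmersion (W.affineCover.f i.2)
        have h1' := (affine_isIntegral_iff _).mp h1
        have h2' := (affine_isIntegral_iff _).mp h2
        have := isIntegral_pullback_Spec (X.affineCover.f i.1 ≫ sX) (W.affineCover.f i.2 ≫ sW)
        exact @isReduced_of_isIntegral _ this
      · have := not_nonempty_iff.mp h0
        refine ⟨fun U ↦ ?_⟩
        obtain rfl : U = ⊥ := by ext z; exact (this.false z).elim
        infer_instance
    exact IsReduced.of_openCover _ 𝒰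
  let ι : pullback (X.genericSpec ≫ sX) (W.genericSpec ≫ sW) ⟶ pullback sX sW :=
    pullback.map _ _ _ _ X.genericSpec W.genericSpec (𝟙 _) (by simp) (by simp)
  have hF : IsIntegral (pullback (X.genericSpec ≫ sX) (W.genericSpec ≫ sW)) :=
    isIntegral_pullback_Spec _ _
  have hι : DenseRange ι := by
    rw [DenseRange, dense_iff_inter_open]
    rintro U hU ⟨z, hz⟩
    obtain ⟨z₁, h₁, h₁'⟩ := Flat.generalizingMap (pullback.fst sX sW)
      (genericPoint_specializes (pullback.fst sX sW z))
    obtain ⟨z₂, h₂, h₂'⟩ := Flat.generalizingMap (pullback.snd sX sW)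
      (genericPoint_specializes (pullback.snd sX sW z₁))
    refine ⟨z₂, (h₂.trans h₁).mem_open hU hz, ?_⟩
    rw [Scheme.Pullback.range_map]
    refine ⟨⟨Scheme.specClosedPoint _, ?_⟩, ⟨Scheme.specClosedPoint _, ?_⟩⟩
    · rw [Scheme.genericSpec_specClosedPoint]
      refine ((genericPoint_specializes _).antisymm ?_).eq
      rw [← h₁']
      exact h₂.map (pullback.fst sX sW).continuous
    · exact (Scheme.genericSpec_specClosedPoint W).trans h₂'.symm
  have : IrreducibleSpace (pullback sX sW : Scheme) := by
    rw [irreducibleSpace_def, Set.top_eq_univ, ← hι.closure_range, ← Set.image_univ]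
    exact ((IrreducibleSpace.isIrreducible_univ _).image _ ι.continuous.continuousOn).closure
  exact isIntegral_of_irreducibleSpace_of_isReduced _

end AlgebraicGeometry

end

section

namespace fibrePower

variable {k : Type u} [Field k] {Y : Scheme.{u}} {sY : Y ⟶ Spec (.of k)} {m : ℕ}

variable (sY m) in
/-- The structure morphism of the fibre power. -/
noncomputable abbrev struct : (fibrePower k sY m).left ⟶ Spec (.of k) := (fibrePower k sY m).hom

variable (sY m) in
/-- The projections of the fibre power. -/
noncomputable def proj (i : Fin m) : (fibrePower k sY m).left ⟶ Y :=
  (Pi.π (fun _ : Fin m ↦ Over.mk sY) i).left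

lemma proj_comp (i : Fin m) : proj sY m i ≫ sY = struct sY m :=
  Over.w (Pi.π (fun _ : Fin m ↦ Over.mk sY) i)

lemma exists_lift {Z : Scheme.{u}} (z : Z ⟶ Spec (.of k)) (g : Fin m → (Z ⟶ Y))
    (hg : ∀ i, g i ≫ sY = z) :
    ∃ h : Z ⟶ (fibrePower k sY m).left, h ≫ struct sY m = z ∧ ∀ i, h ≫ proj sY m i = g i := by
  let h : Over.mk z ⟶ fibrePower k sY m := Pi.lift fun i ↦ Over.homMk (g i) (hg i)
  refine ⟨h.left, Over.w h, fun i ↦ ?_⟩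
  have : h ≫ Pi.π (fun _ : Fin m ↦ Over.mk sY) i = _ := Pi.lift_π _ _
  exact congr(($this).left)

lemma hom_ext {Z : Scheme.{u}} {h h' : Z ⟶ (fibrePower k sY m).left}
    (hs : h ≫ struct sY m = h' ≫ struct sY m)
    (hp : ∀ i, h ≫ proj sY m i = h' ≫ proj sY m i) : h = h' := by
  have : (Over.homMk h : Over.mk (h ≫ struct sY m) ⟶ fibrePower k sY m) =
      Over.homMk h' hs.symm := by
    refine Pi.hom_ext _ _ fun i ↦ ?_
    ext
    exact hp i
  exact congr(($this).left)

lemma permAction_left_struct (σ : Equiv.Perm (Fin m)) :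
    (permAction k sY m σ).left ≫ struct sY m = struct sY m :=
  Over.w _

lemma permAction_left_proj (σ : Equiv.Perm (Fin m)) (i : Fin m) :
    (permAction k sY m σ).left ≫ proj sY m i = proj sY m (σ i) := by
  have : permAction k sY m σ ≫ Pi.π (fun _ : Fin m ↦ Over.mk sY) i = _ := Pi.lift_π _ _
  exact congr(($this).left)

instance : IsIso (struct sY 0) := by
  obtain ⟨h, hs, -⟩ := exists_lift (sY := sY) (𝟙 (Spec (.of k))) Fin.elim0 (fun i ↦ i.elim0)
  exact ⟨h, hom_ext (by rw [Category.assoc, hs]; simp) (fun i ↦ i.elim0), hs⟩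

variable (sY m) in
/-- The `(m + 1)`-st fibre power is the product of the first factor and the others. -/
lemma exists_iso_pullback :
    ∃ e : (fibrePower k sY (m + 1)).left ≅ pullback sY (struct sY m),
      e.hom ≫ pullback.fst _ _ = proj sY (m + 1) 0 ∧
      ∀ i, e.hom ≫ pullback.snd _ _ ≫ proj sY m i = proj sY (m + 1) i.succ := by
  obtain ⟨t, ht, ht'⟩ := exists_lift (sY := sY) (struct sY (m + 1))
    (fun i : Fin m ↦ proj sY (m + 1) i.succ) (fun i ↦ proj_comp _)
  let e := pullback.lift (f := sY) (g := struct sY m) (proj sY (m + 1) 0) t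
    ((proj_comp 0).trans ht.symm)
  obtain ⟨s, hs, hs'⟩ := exists_lift (sY := sY) (m := m + 1)
    (pullback.fst sY (struct sY m) ≫ sY)
    (Fin.cases (pullback.fst _ _) (fun i ↦ pullback.snd _ _ ≫ proj sY m i)) (by
      refine Fin.cases rfl (fun i ↦ ?_)
      simp only [Fin.cases_succ, Category.assoc, proj_comp, pullback.condition])
  have hs0 := hs' 0
  have hs1 (i : Fin m) := hs' i.succ
  simp only [Fin.cases_zero, Fin.cases_succ] at hs0 hs1
  refine ⟨⟨e, s, ?_, ?_⟩, pullback.lift_fst _ _ _, fun i ↦ ?_⟩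
  · refine hom_ext ?_ (Fin.cases ?_ fun i ↦ ?_)
    · rw [Category.assoc, hs, pullback.lift_fst_assoc, proj_comp]; simp
    · rw [Category.assoc, hs0, pullback.lift_fst]; simp
    · rw [Category.assoc, hs1, pullback.lift_snd_assoc, ht']; simp
  · refine pullback.hom_ext ?_ ?_
    · rw [Category.assoc, pullback.lift_fst, hs0]; simp
    · rw [Category.assoc, pullback.lift_snd]
      refine hom_ext ?_ fun i ↦ ?_
      · rw [Category.assoc, ht, hs, pullback.condition]; simp
      · rw [Category.assoc, ht', hs1]; simp
  · rw [pullback.lift_snd_assoc, ht']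

lemma induction (P : ∀ {Z : Scheme.{u}}, (Z ⟶ Spec (.of k)) → Prop)
    (h0 : ∀ {Z : Scheme.{u}} (z : Z ⟶ Spec (.of k)) [IsIso z], P z)
    (h1 : ∀ {Z Z' : Scheme.{u}} (z : Z ⟶ Spec (.of k)) (z' : Z' ⟶ Spec (.of k)) (e : Z ≅ Z'),
      e.hom ≫ z' = z → P z' → P z)
    (h2 : ∀ {Z : Scheme.{u}} (z : Z ⟶ Spec (.of k)), P z → P (pullback.snd sY z ≫ z)) :
    P (struct sY m) := by
  induction m with
  | zero => exact h0 _
  | succ m ih =>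
    obtain ⟨e, h, -⟩ := exists_iso_pullback sY m
    refine h1 _ _ e ?_ (h2 _ ih)
    rw [← pullback.condition, reassoc_of% h, proj_comp]

instance [LocallyOfFiniteType sY] : LocallyOfFiniteType (struct sY m) :=
  induction (sY := sY) (fun z ↦ LocallyOfFiniteType z) (fun _ _ ↦ inferInstance)
    (fun _ _ _ h _ ↦ by rw [← h]; infer_instance) (fun _ _ ↦ inferInstance)

instance [IsSeparated sY] : IsSeparated (struct sY m) :=
  induction (sY := sY) (fun z ↦ IsSeparated z) (fun _ _ ↦ inferInstance)
    (fun _ _ _ h _ ↦ by rw [← h]; infer_instance) (fun _ _ ↦ inferInstance)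

instance [QuasiCompact sY] : QuasiCompact (struct sY m) :=
  induction (sY := sY) (fun z ↦ QuasiCompact z) (fun _ _ ↦ inferInstance)
    (fun _ _ _ h _ ↦ by rw [← h]; infer_instance) (fun _ _ ↦ inferInstance)

instance [IsAlgClosed k] [IsIntegral Y] : IsIntegral (fibrePower k sY m).left :=
  induction (sY := sY) (fun {Z} _ ↦ IsIntegral Z)
    (fun {Z} z _ ↦ by
      have : Nonempty Z := ⟨inv z (Scheme.specClosedPoint k)⟩
      exact isIntegral_of_isOpenImmersion z)
    (fun {Z _} _ _ e _ _ ↦ by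
      have : Nonempty Z := ⟨e.inv (genericPoint _)⟩
      exact isIntegral_of_isOpenImmersion e.hom)
    (fun z _ ↦ isIntegral_pullback sY z)

end fibrePower

end

section

namespace AlgebraicGeometry.Scheme

variable {X S T : Scheme.{u}} [IsIntegral X] [IsIntegral S] [IsIntegral T]

/-- The embedding of function fields induced by a dominant morphism. -/
noncomputable def functionFieldMap (f : X ⟶ S) [IsDominant f] :
    S.functionField →+* X.functionField :=
  (exists_genericSpec_comp_eq f).choose

lemma genericSpec_comp (f : X ⟶ S) [IsDominant f] :
    X.genericSpec ≫ f = Spec.map (CommRingCat.ofHom (functionFieldMap f)) ≫ S.genericSpec :=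
  (exists_genericSpec_comp_eq f).choose_spec

lemma specMap_comp_genericSpec_comp (f : X ⟶ S) [IsDominant f] {R : Type u} [CommRing R]
    (g : X.functionField →+* R) :
    Spec.map (CommRingCat.ofHom g) ≫ X.genericSpec ≫ f =
      Spec.map (CommRingCat.ofHom (g.comp (functionFieldMap f))) ≫ S.genericSpec := by
  rw [genericSpec_comp, CommRingCat.ofHom_comp, Spec.map_comp, Category.assoc]

lemma functionFieldMap_eq (f : X ⟶ S) [IsDominant f] {g : S.functionField →+* X.functionField}
    (h : X.genericSpec ≫ f = Spec.map (CommRingCat.ofHom g) ≫ S.genericSpec) :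
    functionFieldMap f = g :=
  specMap_genericSpec_injective ((genericSpec_comp f).symm.trans h)

lemma functionFieldMap_comp (f : X ⟶ S) (g : S ⟶ T) (h : X ⟶ T) [IsDominant f] [IsDominant g]
    [IsDominant h] (e : f ≫ g = h) :
    functionFieldMap h = (functionFieldMap f).comp (functionFieldMap g) := by
  refine functionFieldMap_eq h ?_
  rw [← specMap_comp_genericSpec_comp, ← reassoc_of% genericSpec_comp f, e]

lemma functionFieldMap_algebraMap {k : Type u} [Field k] {sX : X ⟶ Spec (.of k)}
    {sS : S ⟶ Spec (.of k)} (f : X ⟶ S) [IsDominant f] (e : f ≫ sS = sX) :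
    (functionFieldMap f).comp (functionFieldAlgebraMap sS).hom =
      (functionFieldAlgebraMap sX).hom := by
  refine specMap_injective ?_
  rw [CommRingCat.ofHom_comp, Spec.map_comp, ← genericSpec_comp_eq_specMap, ← reassoc_of% genericSpec_comp f, e,
    genericSpec_comp_eq_specMap]

end AlgebraicGeometry.Scheme

namespace fibrePower

open AlgebraicGeometry.Scheme

variable {k : Type u} [Field k] {Y : Scheme.{u}} (sY : Y ⟶ Spec (.of k)) (m : ℕ)

instance (i : Fin m) : Surjective (proj sY m i) := by
  obtain ⟨h, -, hh⟩ := exists_lift (sY := sY) (m := m) sY (fun _ ↦ 𝟙 Y) (fun _ ↦ by simp)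
  refine ⟨fun y ↦ ⟨h y, ?_⟩⟩
  rw [← Scheme.Hom.comp_apply, hh]
  rfl

lemma permAction_left_comp_left_inv (σ : Equiv.Perm (Fin m)) :
    (permAction k sY m σ⁻¹).left ≫ (permAction k sY m σ).left = 𝟙 _ := by
  refine hom_ext ?_ fun i ↦ ?_
  · simp only [Category.assoc, permAction_left_struct, Category.id_comp]
  · simp [permAction_left_proj]

instance (σ : Equiv.Perm (Fin m)) : IsIso (permAction k sY m σ).left :=
  ⟨(permAction k sY m σ⁻¹).left, by simpa using permAction_left_comp_left_inv sY m σ⁻¹,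
    permAction_left_comp_left_inv sY m σ⟩

variable [IsAlgClosed k] [IsIntegral Y] {m}

/-- The function field of the fibre power. -/
noncomputable def fieldPower (hm : 0 < m) :
    FieldPower (functionFieldAlgebraMap sY).hom m (fibrePower k sY m).left.functionField where
  emb i := functionFieldMap (proj sY m i)
  act σ := functionFieldMap (permAction k sY m σ).left
  act_emb σ i e := by
    rw [functionFieldMap_comp _ _ _ (permAction_left_proj σ i)]
    rfl
  emb_base i j x :=
    congr($((functionFieldMap_algebraMap _ (proj_comp (sY := sY) i)).trans
      (functionFieldMap_algebraMap _ (proj_comp (sY := sY) j)).symm) x)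
  exists_lift Q Ω _ _ π _ j s hs hs' := by
    obtain ⟨h, -, hh⟩ := exists_lift (sY := sY) (m := m)
      (Spec.map (CommRingCat.ofHom (s ⟨0, hm⟩)) ≫ Y.genericSpec ≫ sY)
      (fun i ↦ Spec.map (CommRingCat.ofHom (s i)) ≫ Y.genericSpec) (fun i ↦ by
        rw [Category.assoc, genericSpec_comp_eq_specMap, ← Spec.map_comp, ← Spec.map_comp,
          ← CommRingCat.ofHom_comp, ← CommRingCat.ofHom_comp,
          show (s i).comp _ = (s ⟨0, hm⟩).comp _ from RingHom.ext (hs' i ⟨0, hm⟩)])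
    have hπ (i) : (Spec.map (CommRingCat.ofHom π) ≫ h) ≫ proj sY m i =
        (Spec.map (CommRingCat.ofHom j) ≫ (fibrePower k sY m).left.genericSpec) ≫
          proj sY m i := by
      rw [Category.assoc, hh, Category.assoc, specMap_comp_genericSpec_comp, ← Category.assoc,
        ← Spec.map_comp, ← CommRingCat.ofHom_comp]
      congr 3
      exact RingHom.ext (hs i)
    obtain ⟨ρ, hρ, hρ'⟩ := exists_ringHom_functionField h π j (hom_ext (by
      rw [← proj_comp ⟨0, hm⟩, ← Category.assoc, hπ, Category.assoc]) hπ)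
    refine ⟨ρ, hρ', fun i e ↦ ?_⟩
    have : ρ.comp (functionFieldMap (proj sY m i)) = s i := by
      refine specMap_genericSpec_injective ?_
      rw [← specMap_comp_genericSpec_comp, ← Category.assoc, hρ, hh]
    exact congr($this e)

lemma fieldPower_emb_base (hm : 0 < m) (i : Fin m) (x : k) :
    (fieldPower sY hm).emb i ((functionFieldAlgebraMap sY).hom x) =
      (functionFieldAlgebraMap (struct sY m)).hom x :=
  congr($(functionFieldMap_algebraMap _ (proj_comp (sY := sY) i)) x)

end fibrePower

end

section

namespace AlgebraicGeometry.Scheme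

open AffineZariskiSite

/-- The relative spectrum of a quasi-coherent algebra `F` over `S`, together with the morphism
into it determined by a compatible family of ring homomorphisms. -/
theorem exists_relativeSpec {S W : Scheme.{u}} (q : W ⟶ S)
    {F : S.AffineZariskiSiteᵒᵖ ⥤ CommRingCat.{u}}
    (α : (toOpensFunctor S).op ⋙ S.presheaf ⟶ F) (H : α.Coequifibered)
    (β : ∀ U : S.AffineZariskiSite, F.obj (.op U) ⟶ Γ(W, q ⁻¹ᵁ U.1))
    (hβ : ∀ {U V : S.AffineZariskiSite} (i : U ⟶ V),
      F.map i.op ≫ β U = β V ≫ W.presheaf.map (homOfLE (q.preimage_mono (toOpens_mono i.le))).op)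
    (hα : ∀ U : S.AffineZariskiSite, α.app (.op U) ≫ β U = q.app U.1) :
    ∃ (T : Scheme.{u}) (p : T ⟶ S) (h : W ⟶ T)
      (j : ∀ U : S.AffineZariskiSite, Spec (F.obj (.op U)) ⟶ T),
      h ≫ p = q ∧ (∀ U, IsOpenImmersion (j U)) ∧
      ∀ U, (q ⁻¹ᵁ U.1).ι ≫ h = (q ⁻¹ᵁ U.1).toSpecΓ ≫ Spec.map (β U) ≫ j U := by
  let d := relativeGluingData H
  have : (d.functor ⋙ Scheme.forget).IsLocallyDirected :=
    Cover.RelativeGluingData.instIsLocallyDirectedI₀CompFunctorForgetOfIsThin ..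
  let j : ∀ U : S.AffineZariskiSite, Spec (F.obj (.op U)) ⟶ d.glued := fun U ↦ d.cover.f U
  have hj : ∀ (U V : S.AffineZariskiSite) (i : U ⟶ V), Spec.map (F.map i.op) ≫ j V = j U :=
    fun U V i ↦ colimit.w d.functor (show (U : (directedCover S).I₀) ⟶ V from i)
  have hjp : ∀ U, j U ≫ d.toBase = Spec.map (α.app (.op U)) ≫ U.2.fromSpec :=
    fun U ↦ by
    refine (colimit.ι_desc _ _).trans ?_
    refine (Category.assoc (Spec.map (α.app (.op U))) _ _).trans ?_
    rfl
  let g : ∀ U : S.AffineZariskiSite, pullback q U.1.ι ⟶ d.glued := fun U ↦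
    (pullbackRestrictIsoRestrict q _).hom ≫ (q ⁻¹ᵁ U.1).toSpecΓ ≫ Spec.map (β U) ≫ j U
  have hg : ∀ {U V : S.AffineZariskiSite} (i : U ⟶ V) (t : pullback q U.1.ι ⟶ pullback q V.1.ι),
      t ≫ pullback.fst _ _ = pullback.fst _ _ → t ≫ g V = g U := by
    intro U V i t ht
    have : (pullbackRestrictIsoRestrict q U.1).inv ≫ t ≫
        (pullbackRestrictIsoRestrict q V.1).hom = W.homOfLE
          (q.preimage_mono (toOpens_mono i.le)) := by
      rw [← cancel_mono (Scheme.Opens.ι _)]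
      simp [ht]
    rw [← Iso.inv_comp_eq]
    dsimp only [g]
    rw [reassoc_of% this, ← Scheme.Opens.toSpecΓ_SpecMap_presheaf_map_assoc,
      ← Spec.map_comp_assoc, ← hβ, Spec.map_comp_assoc, hj _ _ i]
  let 𝒱 : W.OpenCover := (directedCover S).pullback₁ q
  let h : W ⟶ d.glued := by
    refine 𝒱.glueMorphismsOfLocallyDirected g fun {U V} i ↦ hg i _ ?_
    exact (pullback.lift_fst _ _ _).trans (Category.comp_id _)
  have hh : ∀ U, (q ⁻¹ᵁ U.1).ι ≫ h = (q ⁻¹ᵁ U.1).toSpecΓ ≫ Spec.map (β U) ≫ j U := by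
    intro U
    have h₁ : pullback.fst q U.1.ι ≫ h = g U :=
      Scheme.OpenCover.map_glueMorphismsOfLocallyDirected (𝒰 := 𝒱) g _ U
    rw [← cancel_epi (pullbackRestrictIsoRestrict q U.1).hom, ← Category.assoc,
      pullbackRestrictIsoRestrict_hom_ι, h₁]
  refine ⟨d.glued, d.toBase, h, j, ?_, d.cover.map_prop, hh⟩
  have hq : ∀ U : S.AffineZariskiSite, (q ⁻¹ᵁ U.1).ι ≫ h ≫ d.toBase = (q ⁻¹ᵁ U.1).ι ≫ q := by
    intro U
    have hαU : Spec.map (β U) ≫ Spec.map (α.app (.op U)) = Spec.map (q.app U.1) :=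
      (Spec.map_comp _ _).symm.trans (congrArg Spec.map (hα U))
    rw [reassoc_of% hh U, hjp]
    refine (congrArg (_ ≫ ·) ((Category.assoc _ _ _).symm.trans
      (congrArg (· ≫ U.2.fromSpec) hαU))).trans ?_
    simp
  exact Scheme.Cover.hom_ext (W.openCoverOfIsOpenCover _
    (.comap (iSup_affineOpens_eq_top S) q.base.1)) _ _ hq

end AlgebraicGeometry.Scheme

end

section

theorem Subring.isLocalizationAway_of_fixed {A B ι : Type*} [CommRing A] [CommRing B] [Finite ι]
    (g : A →+* B) (r : A)
    (hg : let _ := g.toAlgebra; IsLocalization.Away r B)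
    (σ : ι → A →+* A) (σ' : ι → B →+* B) (hσ : ∀ i a, σ' i (g a) = g (σ i a))
    (hr : ∀ i, σ i r = r) (A₀ : Subring A) (B₀ : Subring B) (hA₀ : ∀ a, a ∈ A₀ ↔ ∀ i, σ i a = a)
    (hB₀ : ∀ b, b ∈ B₀ ↔ ∀ i, σ' i b = b) (f : A₀ →+* B₀) (hf : ∀ a, (f a : B) = g a)
    (r₀ : A₀) (hr₀ : (r₀ : A) = r) :
    let _ := f.toAlgebra; IsLocalization.Away r₀ B₀ := by
  let _ := g.toAlgebra
  let _ := f.toAlgebra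
  have : IsLocalization.Away r B := hg
  have halg : ∀ a : A₀, algebraMap A₀ B₀ a = f a := fun _ ↦ rfl
  have halg' : ∀ a : A, algebraMap A B a = g a := fun _ ↦ rfl
  have hu : IsUnit (g r) := IsLocalization.Away.algebraMap_isUnit (S := B) r
  have hfix : ∀ i, σ' i (g r) = g r := fun i ↦ by rw [hσ, hr]
  obtain ⟨v, hv⟩ := hu.exists_left_inv
  show IsLocalization.Away r₀ B₀
  refine IsLocalization.Away.mk r₀ ?_ (fun s ↦ ?_) (fun a b hab ↦ ?_)
  · have hv₀ : v ∈ B₀ := (hB₀ v).2 fun i ↦ by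
      refine hu.mul_left_injective ?_
      change σ' i v * g r = v * g r
      rw [hv, ← hfix i, ← map_mul, hv, map_one]
    refine IsUnit.of_mul_eq_one (⟨v, hv₀⟩ : B₀) (Subtype.ext ?_)
    change (f r₀ : B) * v = 1
    rw [hf, hr₀, mul_comm, hv]
  · obtain ⟨n, a, ha⟩ := IsLocalization.Away.surj r (s : B)
    rw [halg', halg'] at ha
    have key : ∀ i, ∃ m : ℕ, r ^ m * σ i a = r ^ m * a := fun i ↦ by
      refine IsLocalization.Away.exists_of_eq (S := B) r ?_
      rw [halg', halg', ← hσ, ← ha, map_mul, map_pow, hfix, (hB₀ _).1 s.2 i]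
    choose m hm using key
    obtain ⟨M, hM⟩ := Set.finite_range m |>.bddAbove
    have hM' : ∀ i, r ^ M * σ i a = r ^ M * a := fun i ↦ by
      rw [← Nat.sub_add_cancel (hM ⟨i, rfl⟩), pow_add, mul_assoc, hm, mul_assoc]
    refine ⟨M + n, ⟨r ^ M * a, (hA₀ _).2 fun i ↦ by rw [map_mul, map_pow, hr, hM']⟩, ?_⟩
    refine Subtype.ext ?_
    change (s : B) * ((f r₀ ^ (M + n) : B₀) : B) = (f _ : B)
    rw [hf, SubmonoidClass.coe_pow, hf, hr₀, map_mul, ← ha, map_pow]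
    ring
  · obtain ⟨n, hn⟩ := IsLocalization.Away.exists_of_eq (S := B) (a := (a : A)) (b := b) r (by
      rw [halg', halg', ← hf, ← hf, ← halg, ← halg, hab])
    exact ⟨n, Subtype.ext (by simpa [hr₀] using hn)⟩

namespace AlgebraicGeometry.Scheme

open AffineZariskiSite

section Invariants

variable {S W : Scheme.{u}} (q : W ⟶ S) {ι : Type*} (τ : ι → (W ⟶ W)) (hτ : ∀ i, τ i ≫ q = q)

include hτ in
lemma preimage_le_preimage_preimage (i : ι) (U : S.Opens) : q ⁻¹ᵁ U ≤ τ i ⁻¹ᵁ q ⁻¹ᵁ U := by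
  rw [← Scheme.Hom.comp_preimage, hτ]

/-- The action of an endomorphism of `W` over `S` on sections over preimages of opens of `S`. -/
noncomputable def sectionsAction (i : ι) (U : S.Opens) : Γ(W, q ⁻¹ᵁ U) →+* Γ(W, q ⁻¹ᵁ U) :=
  ((τ i).appLE (q ⁻¹ᵁ U) (q ⁻¹ᵁ U) (preimage_le_preimage_preimage q τ hτ i U)).hom

lemma sectionsAction_map (i : ι) {U V : S.Opens} (h : U ≤ V) (b : Γ(W, q ⁻¹ᵁ V)) :
    sectionsAction q τ hτ i U (W.presheaf.map (homOfLE (q.preimage_mono h)).op b) =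
      W.presheaf.map (homOfLE (q.preimage_mono h)).op (sectionsAction q τ hτ i V b) := by
  have : W.presheaf.map (homOfLE (q.preimage_mono h)).op ≫
      (τ i).appLE (q ⁻¹ᵁ U) (q ⁻¹ᵁ U) (preimage_le_preimage_preimage q τ hτ i U) =
      (τ i).appLE (q ⁻¹ᵁ V) (q ⁻¹ᵁ V) (preimage_le_preimage_preimage q τ hτ i V) ≫
        W.presheaf.map (homOfLE (q.preimage_mono h)).op := by
    rw [Scheme.Hom.map_appLE, Scheme.Hom.appLE_map]
  exact congr($(this).hom b)

lemma sectionsAction_app (i : ι) (U : S.Opens) (r : Γ(S, U)) :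
    sectionsAction q τ hτ i U (q.app U r) = q.app U r := by
  have : q.app U ≫ (τ i).appLE (q ⁻¹ᵁ U) (q ⁻¹ᵁ U) (preimage_le_preimage_preimage q τ hτ i U) =
      q.app U := by
    rw [Scheme.Hom.app_eq_appLE, Scheme.Hom.appLE_comp_appLE]
    simp only [hτ]
  exact congr($(this).hom r)

/-- The sections over `q ⁻¹ᵁ U` which are invariant under all `τ i`. -/
noncomputable def invariantSections (U : S.Opens) : Subring Γ(W, q ⁻¹ᵁ U) :=
  ⨅ i, (sectionsAction q τ hτ i U).eqLocus (RingHom.id _)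

lemma mem_invariantSections {U : S.Opens} {b : Γ(W, q ⁻¹ᵁ U)} :
    b ∈ invariantSections q τ hτ U ↔ ∀ i, sectionsAction q τ hτ i U b = b := by
  simp only [invariantSections, Subring.mem_iInf]
  rfl

/-- The presheaf of invariant sections on the affine opens of `S`. -/
noncomputable def invariantsDiagram : S.AffineZariskiSiteᵒᵖ ⥤ CommRingCat.{u} where
  obj U := .of (invariantSections q τ hτ U.unop.1)
  map {V U} f := CommRingCat.ofHom
    ((W.presheaf.map (homOfLE (q.preimage_mono (toOpens_mono f.unop.le))).op).hom.restrict _ _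
      fun b hb ↦ (mem_invariantSections q τ hτ).2 fun i ↦ by
        refine (sectionsAction_map q τ hτ i (toOpens_mono f.unop.le) b).trans ?_
        rw [(mem_invariantSections q τ hτ).1 hb i])
  map_id U := by
    refine CommRingCat.hom_ext (RingHom.ext fun x ↦ ?_)
    refine Subtype.ext ?_
    exact congr($(W.presheaf.map_id (.op (q ⁻¹ᵁ U.unop.1))).hom x.1)
  map_comp {U V T} f g := by
    refine CommRingCat.hom_ext (RingHom.ext fun x ↦ ?_)
    refine Subtype.ext ?_
    exact congr($(W.presheaf.map_comp
      (homOfLE (q.preimage_mono (toOpens_mono f.unop.le))).op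
      (homOfLE (q.preimage_mono (toOpens_mono g.unop.le))).op).hom x.1)

/-- The map from the structure presheaf of `S` to the presheaf of invariant sections. -/
noncomputable def invariantsDiagramMap :
    (toOpensFunctor S).op ⋙ S.presheaf ⟶ invariantsDiagram q τ hτ where
  app U := CommRingCat.ofHom ((q.app U.unop.1).hom.codRestrict _ fun r ↦
    (mem_invariantSections q τ hτ).2 fun i ↦ sectionsAction_app q τ hτ i _ r)
  naturality {V U} f := by
    ext x
    exact Subtype.ext congr($(q.naturality ((toOpensFunctor S).op.map f)).hom x)

lemma coequifibered_invariantsDiagramMap [Finite ι] [QuasiCompact q] [QuasiSeparated q] :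
    (invariantsDiagramMap q τ hτ).Coequifibered := by
  refine coequifibered_iff_forall_isLocalizationAway.mpr fun U r ↦ ?_
  refine Subring.isLocalizationAway_of_fixed
    (W.presheaf.map (homOfLE (q.preimage_mono (S.basicOpen_le r))).op).hom (q.app U.1 r) ?_
    (fun i ↦ sectionsAction q τ hτ i U.1) (fun i ↦ sectionsAction q τ hτ i (S.basicOpen r))
    (fun i a ↦ sectionsAction_map q τ hτ i (S.basicOpen_le r) a)
    (fun i ↦ sectionsAction_app q τ hτ i _ r) _ _ (fun a ↦ mem_invariantSections q τ hτ)
    (fun a ↦ mem_invariantSections q τ hτ) _ (fun a ↦ rfl) _ rfl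
  have key : ∀ (V : W.Opens) (hV : V ≤ q ⁻¹ᵁ U.1) (h : V = W.basicOpen (q.app U.1 r)),
      let _ := (W.presheaf.map (homOfLE hV).op).hom.toAlgebra
      IsLocalization.Away (q.app U.1 r) Γ(W, V) := by
    rintro V hV rfl
    exact isLocalization_basicOpen_of_qcqs (q.isCompact_preimage U.2.isCompact)
        (q.isQuasiSeparated_preimage U.2.isQuasiSeparated) (q.app _ r)
  exact key _ _ (q.preimage_basicOpen r)

end Invariants

end AlgebraicGeometry.Scheme

end

section

namespace AlgebraicGeometry.Scheme

lemma exists_genericSpec_lift (X : Scheme.{u}) [IsIntegral X] (U : X.Opens) [Nonempty U] :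
    ∃ a : Spec (.of X.functionField) ⟶ U, a ≫ U.ι = X.genericSpec ∧
      a ≫ U.toSpecΓ = Spec.map (CommRingCat.ofHom (X.germToFunctionField U).hom) := by
  have hx : genericPoint X ∈ U :=
    (((genericPoint_spec X).mem_open_set_iff U.isOpen).mpr (by simpa using ‹Nonempty U›))
  exact ⟨U.fromSpecStalkOfMem (genericPoint X) hx, U.fromSpecStalkOfMem_ι _ hx,
    U.fromSpecStalkOfMem_toSpecΓ _ hx⟩

lemma functionFieldMap_germToFunctionField {X S : Scheme.{u}} [IsIntegral X] [IsIntegral S]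
    (f : X ⟶ S) [IsDominant f] (U : S.Opens) (V : X.Opens) (e : V ≤ f ⁻¹ᵁ U)
    [Nonempty U] [Nonempty V] (r : Γ(S, U)) :
    functionFieldMap f (S.germToFunctionField U r) = X.germToFunctionField V (f.appLE U V e r) := by
  obtain ⟨a, ha, ha'⟩ := X.exists_genericSpec_lift V
  obtain ⟨b, hb, hb'⟩ := S.exists_genericSpec_lift U
  have h₁ : a ≫ f.resLE U V e = Spec.map (CommRingCat.ofHom (functionFieldMap f)) ≫ b := by
    rw [← cancel_mono U.ι, Category.assoc, Category.assoc, Scheme.Hom.resLE_comp_ι,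
      reassoc_of% ha, hb, genericSpec_comp]
  have h₂ : (X.germToFunctionField V).hom.comp (f.appLE U V e).hom =
      (functionFieldMap f).comp (S.germToFunctionField U).hom := by
    refine specMap_injective ?_
    have h₃ := congrArg (· ≫ U.toSpecΓ) h₁
    simp only [Category.assoc] at h₃
    rw [← Scheme.Opens.toSpecΓ_SpecMap_appLE, hb', reassoc_of% ha', ← Spec.map_comp,
      ← Spec.map_comp] at h₃
    exact h₃
  exact congr($(h₂) r).symm

lemma germToFunctionField_map (X : Scheme.{u}) [IsIntegral X] {U V : X.Opens} (i : V ⟶ U)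
    [Nonempty U] [Nonempty V] (r : Γ(X, U)) :
    X.germToFunctionField V (X.presheaf.map i.op r) = X.germToFunctionField U r :=
  TopCat.Presheaf.germ_res_apply _ _ _ _ _

end AlgebraicGeometry.Scheme

end

section

namespace AlgebraicGeometry.Scheme

open AffineZariskiSite

section Invariants

variable {S W : Scheme.{u}} [IsIntegral S] [IsIntegral W] (q : W ⟶ S) [IsDominant q]
  [QuasiCompact q] [QuasiSeparated q] {ι : Type*} [Finite ι] (τ : ι → (W ⟶ W))
  (hτ : ∀ i, τ i ≫ q = q)
  (hUP : ∀ (T : Scheme.{u}) (p : T ⟶ S) (h : W ⟶ T), h ≫ p = q → (∀ i, τ i ≫ h = h) →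
    ∃ t : S ⟶ T, q ≫ t = h)

include hUP in
lemma germToFunctionField_mem_range_of_invariant (U : S.AffineZariskiSite) [Nonempty (q ⁻¹ᵁ U.1)]
    {b : Γ(W, q ⁻¹ᵁ U.1)} (hb : b ∈ invariantSections q τ hτ U.1) :
    W.germToFunctionField (q ⁻¹ᵁ U.1) b ∈ (functionFieldMap q).range := by
  let β (U : S.AffineZariskiSite) :
      (invariantsDiagram q τ hτ).obj (.op U) ⟶ Γ(W, q ⁻¹ᵁ U.1) :=
    CommRingCat.ofHom (invariantSections q τ hτ U.1).subtype
  obtain ⟨T, p, h, j, hp, hj, hjh⟩ := exists_relativeSpec q (invariantsDiagramMap q τ hτ)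
    (coequifibered_invariantsDiagramMap q τ hτ) β (fun _ ↦ rfl) (fun _ ↦ rfl)
  have := hj U
  have hinv : ∀ i, τ i ≫ h = h := by
    intro i
    refine Scheme.Cover.hom_ext (W.openCoverOfIsOpenCover _
      (.comap (iSup_affineOpens_eq_top S) q.base.1)) _ _ fun U ↦ ?_
    change (q ⁻¹ᵁ U.1).ι ≫ τ i ≫ h = (q ⁻¹ᵁ U.1).ι ≫ h
    have e := preimage_le_preimage_preimage q τ hτ i U.1
    have hβ : β U ≫ (τ i).appLE (q ⁻¹ᵁ U.1) (q ⁻¹ᵁ U.1) e = β U := by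
      ext x
      exact (mem_invariantSections q τ hτ).1 x.2 i
    rw [← Scheme.Hom.resLE_comp_ι_assoc (τ i) e, hjh U, ← Scheme.Opens.toSpecΓ_SpecMap_appLE_assoc,
      ← Spec.map_comp_assoc, hβ]
  obtain ⟨t, ht⟩ := hUP T p h hp hinv
  obtain ⟨a, ha, ha'⟩ := W.exists_genericSpec_lift (q ⁻¹ᵁ U.1)
  have h₁ : Spec.map (CommRingCat.ofHom (functionFieldMap q)) ≫ S.genericSpec ≫ t =
      Spec.map (CommRingCat.ofHom ((W.germToFunctionField (q ⁻¹ᵁ U.1)).hom.comp (β U).hom)) ≫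
        j U := by
    rw [← Category.assoc, ← genericSpec_comp, Category.assoc, ht, ← ha, Category.assoc, hjh U,
      reassoc_of% ha', ← Spec.map_comp_assoc]
    rfl
  have hmem : (S.genericSpec ≫ t) (specClosedPoint S.functionField) ∈ (j U).opensRange := by
    rw [← specMap_comp_specClosedPoint (functionFieldMap q) (S.genericSpec ≫ t), h₁]
    exact ⟨_, rfl⟩
  obtain ⟨c, hc⟩ := exists_lift_of_isOpenImmersion (S.genericSpec ≫ t) (j U) hmem
  obtain ⟨φ, hφ⟩ := exists_specMap_eq c
  have h₂ : (functionFieldMap q).comp φ =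
      (W.germToFunctionField (q ⁻¹ᵁ U.1)).hom.comp (β U).hom := by
    refine specMap_injective ?_
    refine (cancel_mono (j U)).1 (Eq.trans ?_ h₁)
    rw [← hc, ← hφ]
    exact (congrArg (· ≫ j U) (Spec.map_comp (CommRingCat.ofHom φ)
      (CommRingCat.ofHom (functionFieldMap q)))).trans (Category.assoc _ _ _)
  exact ⟨φ ⟨b, hb⟩, congr($(h₂) ⟨b, hb⟩)⟩

end Invariants
end AlgebraicGeometry.Scheme

end

section

theorem IsFractionRing.exists_dvd_of_isAlgebraic {A B K M : Type*} [CommRing A] [IsDomain A]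
    [CommRing B] [Field K] [Field M] [Algebra A K] [IsFractionRing A K] (φ : K →+* M)
    (hφ : let _ := φ.toAlgebra; Algebra.IsAlgebraic K M) (ψ : A →+* B) (g : B →+* M)
    (hg : Function.Injective g) (hψ : ∀ a, g (ψ a) = φ (algebraMap A K a)) {s : B} (hs : s ≠ 0) :
    ∃ r, r ≠ 0 ∧ s ∣ ψ r := by
  let _ := φ.toAlgebra
  let _ := (φ.comp (algebraMap A K)).toAlgebra
  let _ := ψ.toAlgebra
  let _ := g.toAlgebra
  have : IsScalarTower A K M := .of_algebraMap_eq' rfl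
  have : IsScalarTower A B M := .of_algebraMap_eq fun a ↦ (hψ a).symm
  have : IsDomain B := hg.isDomain g
  have h : IsAlgebraic K (g s) := hφ.isAlgebraic _
  have h' : IsAlgebraic A (algebraMap B M s) := (IsFractionRing.isAlgebraic_iff A K M).2 h
  exact ((isAlgebraic_algebraMap_iff hg).1 h').exists_nonzero_dvd
    (mem_nonZeroDivisors_of_ne_zero hs)

namespace AlgebraicGeometry.Scheme

lemma nonempty_inf (X : Scheme.{u}) [IsIntegral X] (U V : X.Opens) [hU : Nonempty U]
    [hV : Nonempty V] : Nonempty (U ⊓ V : X.Opens) := by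
  obtain ⟨x, hx⟩ := nonempty_preirreducible_inter U.isOpen V.isOpen (by simpa using hU)
    (by simpa using hV)
  exact ⟨⟨x, hx⟩⟩

lemma exists_germToFunctionField_eq (X : Scheme.{u}) [IsIntegral X] (U : X.Opens) [Nonempty U]
    (y : X.functionField) (h : ∀ x ∈ U, ∃ V : X.Opens, x ∈ V ∧ V ≤ U ∧ ∃ b : Γ(X, V),
      ∀ _ : Nonempty V, X.germToFunctionField V b = y) :
    ∃ b : Γ(X, U), X.germToFunctionField U b = y := by
  choose V hxV hVU b hb using fun x : U ↦ h x.1 x.2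
  have hne : ∀ x, Nonempty (V x) := fun x ↦ ⟨⟨x.1, hxV x⟩⟩
  obtain ⟨s, hs, -⟩ := X.sheaf.existsUnique_gluing' V U (fun x ↦ homOfLE (hVU x))
    (fun x hx ↦ Opens.mem_iSup.2 ⟨⟨x, hx⟩, hxV ⟨x, hx⟩⟩) b (by
      intro x y
      have := X.nonempty_inf (V x) (V y)
      refine germ_injective_of_isIntegral X (genericPoint X) (U := V x ⊓ V y)
        (((genericPoint_spec X).mem_open_set_iff (V x ⊓ V y).isOpen).mpr (by simpa using this)) ?_
      exact ((X.germToFunctionField_map (Opens.infLELeft (V x) (V y)) (b x)).trans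
        (hb x inferInstance)).trans
        ((X.germToFunctionField_map (Opens.infLERight (V x) (V y)) (b y)).trans
        (hb y inferInstance)).symm)
  obtain ⟨x⟩ := ‹Nonempty U›
  have := hne x
  exact ⟨s, (X.germToFunctionField_map (homOfLE (hVU x)) s).symm.trans
    ((congrArg (X.germToFunctionField (V x)) (hs x)).trans (hb x inferInstance))⟩

section Invariants

variable {S W : Scheme.{u}} [IsIntegral S] [IsIntegral W] (q : W ⟶ S) [IsDominant q]
  (hq : let _ := (functionFieldMap q).toAlgebra; Algebra.IsAlgebraic S.functionField W.functionField)

include hq in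
lemma exists_germToFunctionField_eq_mul {U : S.Opens} (hU : IsAffineOpen U) [Nonempty U]
    (hqU : IsCompact (q ⁻¹ᵁ U : Set W)) [Nonempty (q ⁻¹ᵁ U)] (x : W.functionField) :
    ∃ r : Γ(S, U), r ≠ 0 ∧ ∃ b : Γ(W, q ⁻¹ᵁ U), W.germToFunctionField (q ⁻¹ᵁ U) b =
      functionFieldMap q (S.germToFunctionField U r) * x := by
  let p (s : Set W) : Prop := ∃ r : Γ(S, U), r ≠ 0 ∧ ∀ w ∈ s, ∃ V : W.Opens, w ∈ V ∧
    V ≤ q ⁻¹ᵁ U ∧ ∃ b : Γ(W, V), ∀ _ : Nonempty V, W.germToFunctionField V b =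
      functionFieldMap q (S.germToFunctionField U r) * x
  have hp : p (q ⁻¹ᵁ U : Set W) := by
    refine hqU.induction_on (p := p) ⟨1, one_ne_zero, by simp⟩ ?_ ?_ ?_
    · rintro s t hst ⟨r, hr, h⟩
      exact ⟨r, hr, fun w hw ↦ h w (hst hw)⟩
    · have aux : ∀ (r r' : Γ(S, U)) (w : W), (∃ V : W.Opens, w ∈ V ∧
          V ≤ q ⁻¹ᵁ U ∧ ∃ b : Γ(W, V), ∀ _ : Nonempty V, W.germToFunctionField V b =
          functionFieldMap q (S.germToFunctionField U r) * x) → (∃ V : W.Opens, w ∈ V ∧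
          V ≤ q ⁻¹ᵁ U ∧ ∃ b : Γ(W, V), ∀ _ : Nonempty V, W.germToFunctionField V b =
          functionFieldMap q (S.germToFunctionField U (r' * r)) * x) := by
        rintro r r' w ⟨V, hwV, hV, b, hb⟩
        refine ⟨V, hwV, hV, q.appLE U V hV r' * b, fun _ ↦ ?_⟩
        rw [map_mul, map_mul, map_mul, hb inferInstance, mul_assoc,
          functionFieldMap_germToFunctionField q U V hV r']
      rintro s t ⟨r, hr, h⟩ ⟨r', hr', h'⟩
      refine ⟨r' * r, mul_ne_zero hr' hr, fun w hw ↦ ?_⟩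
      obtain hw | hw := hw
      · exact aux r r' w (h w hw)
      · rw [mul_comm r' r]
        exact aux r' r w (h' w hw)
    · intro w hw
      obtain ⟨V, hV, hwV, hVU⟩ := exists_isAffineOpen_mem_and_subset (U := q ⁻¹ᵁ U) hw
      have : Nonempty V := ⟨⟨w, hwV⟩⟩
      have := functionField_isFractionRing_of_isAffineOpen W V hV
      have := functionField_isFractionRing_of_isAffineOpen S U hU
      obtain ⟨a, s, hs, hx⟩ := IsFractionRing.div_surjective (A := Γ(W, V)) x
      obtain ⟨r, hr, c, hc⟩ := IsFractionRing.exists_dvd_of_isAlgebraic (functionFieldMap q) hq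
        (q.appLE U V hVU).hom (W.germToFunctionField V).hom
        (IsFractionRing.injective Γ(W, V) W.functionField)
        (fun a ↦ (functionFieldMap_germToFunctionField q U V hVU a).symm)
        (nonZeroDivisors.ne_zero hs)
      refine ⟨V, mem_nhdsWithin_of_mem_nhds (V.isOpen.mem_nhds hwV), r, hr, fun v hv ↦
        ⟨V, hv, hVU, c * a, fun _ ↦ ?_⟩⟩
      have hs' : W.germToFunctionField V s ≠ 0 :=
        IsFractionRing.to_map_ne_zero_of_mem_nonZeroDivisors hs
      change W.germToFunctionField V a / W.germToFunctionField V s = x at hx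
      replace hc : q.appLE U V hVU r = s * c := hc
      rw [functionFieldMap_germToFunctionField q U V hVU r, hc, ← hx, map_mul, map_mul]
      field_simp
  obtain ⟨r, hr, h⟩ := hp
  exact ⟨r, hr, W.exists_germToFunctionField_eq _ _ h⟩

end Invariants

end AlgebraicGeometry.Scheme

end

section

namespace AlgebraicGeometry.Scheme

theorem mem_range_functionFieldMap_of_invariant {S W : Scheme.{u}} [IsIntegral S] [IsIntegral W]
    (q : W ⟶ S) [IsDominant q] [QuasiCompact q] [QuasiSeparated q]
    (hq : let _ := (functionFieldMap q).toAlgebra;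
      Algebra.IsAlgebraic S.functionField W.functionField)
    {ι : Type*} [Finite ι] (τ : ι → (W ⟶ W)) [∀ i, IsDominant (τ i)] (hτ : ∀ i, τ i ≫ q = q)
    (hUP : ∀ (T : Scheme.{u}) (p : T ⟶ S) (h : W ⟶ T), h ≫ p = q → (∀ i, τ i ≫ h = h) →
      ∃ t : S ⟶ T, q ≫ t = h)
    {x : W.functionField} (hx : ∀ i, functionFieldMap (τ i) x = x) :
    x ∈ (functionFieldMap q).range := by
  obtain ⟨U, hU, hqU⟩ := exists_isAffineOpen_mem S (q (genericPoint W))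
  have : Nonempty U := ⟨⟨_, hqU⟩⟩
  have : Nonempty (q ⁻¹ᵁ U) := ⟨⟨_, hqU⟩⟩
  obtain ⟨r, hr, b, hb⟩ := exists_germToFunctionField_eq_mul q hq hU
    (q.isCompact_preimage hU.isCompact) x
  have hfix : ∀ i, functionFieldMap (τ i) (functionFieldMap q (S.germToFunctionField U r)) =
      functionFieldMap q (S.germToFunctionField U r) := fun i ↦
    congr($(functionFieldMap_comp (τ i) q q (hτ i)) _).symm
  have hbinv : b ∈ invariantSections q τ hτ U := by
    refine (mem_invariantSections q τ hτ).2 fun i ↦ ?_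
    refine germToFunctionField_injective W (q ⁻¹ᵁ U) ?_
    refine (functionFieldMap_germToFunctionField (τ i) (q ⁻¹ᵁ U) (q ⁻¹ᵁ U)
      (preimage_le_preimage_preimage q τ hτ i U) b).symm.trans ?_
    rw [hb, map_mul, hfix, hx]
  obtain ⟨y, hy⟩ := germToFunctionField_mem_range_of_invariant q τ hτ hUP ⟨U, hU⟩ hbinv
  have hy' : functionFieldMap q y = functionFieldMap q (S.germToFunctionField U r) * x :=
    hy.trans hb
  have hr' : S.germToFunctionField U r ≠ 0 := fun h ↦
    hr (germToFunctionField_injective S U (h.trans (map_zero _).symm))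
  refine ⟨y / S.germToFunctionField U r, ?_⟩
  rw [map_div₀, hy', mul_div_cancel_left₀]
  simpa using hr'

end AlgebraicGeometry.Scheme

end

section

open fibrePower AlgebraicGeometry.Scheme

/-- The properties of the quotient morphism `Y^m ⟶ Sym^m Y` on underlying schemes. -/
structure IsSymmetricQuotient {k : Type u} [Field k] {Y S : Scheme.{u}}
    (sY : Y ⟶ Spec (.of k)) (sS : S ⟶ Spec (.of k)) {m : ℕ}
    (q : (fibrePower k sY m).left ⟶ S) : Prop where
  comp_struct : q ≫ sS = struct sY m
  permAction_comp (σ : Equiv.Perm (Fin m)) : (permAction k sY m σ).left ≫ q = q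
  exists_fac {T : Scheme.{u}} (z : T ⟶ Spec (.of k)) (h : (fibrePower k sY m).left ⟶ T)
    (hz : h ≫ z = struct sY m) (hh : ∀ σ, (permAction k sY m σ).left ≫ h = h) :
    ∃ t : S ⟶ T, t ≫ z = sS ∧ q ≫ t = h
  hom_ext {T : Scheme.{u}} (z : T ⟶ Spec (.of k)) {t t' : S ⟶ T} (ht : t ≫ z = sS)
    (ht' : t' ≫ z = sS) (h : q ≫ t = q ≫ t') : t = t'

variable {k : Type u} [Field k] {Y S : Scheme.{u}} {sY : Y ⟶ Spec (.of k)} {sS : S ⟶ Spec (.of k)}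
  {m : ℕ}

lemma IsSymmetricPower.isSymmetricQuotient {q : fibrePower k sY m ⟶ Over.mk sS}
    (hq : IsSymmetricPower k sY sS m q) : IsSymmetricQuotient sY sS q.left where
  comp_struct := Over.w q
  permAction_comp σ := congr(($(hq.1 σ)).left)
  exists_fac {T} z h hz hh := by
    obtain ⟨t, ht, -⟩ := hq.2 (Over.mk z) (Over.homMk h hz) fun σ ↦ Over.OverMorphism.ext (hh σ)
    exact ⟨t.left, Over.w t, congr(($ht).left)⟩
  hom_ext {T} z {t t'} ht ht' h := by
    obtain ⟨t₀, -, h₀⟩ := hq.2 (Over.mk z) (q ≫ Over.homMk t ht) fun σ ↦ by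
      rw [← Category.assoc, hq.1 σ]
    have h₁ := h₀ (Over.homMk t ht) rfl
    have h₂ := h₀ (Over.homMk t' ht') (Over.OverMorphism.ext h.symm)
    exact congr(($(h₁.trans h₂.symm)).left)

namespace IsSymmetricQuotient

variable {q : (fibrePower k sY m).left ⟶ S} (hq : IsSymmetricQuotient sY sS q)
include hq

lemma quasiCompact [QuasiCompact sY] [IsSeparated sY] [IsSeparated sS] : QuasiCompact q := by
  have : QuasiCompact (q ≫ sS) := by rw [hq.comp_struct]; infer_instance
  exact .of_comp q sS

lemma isSeparated [IsSeparated sY] : IsSeparated q := by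
  have : IsSeparated (q ≫ sS) := by rw [hq.comp_struct]; infer_instance
  exact .of_comp q sS

lemma isDominant [QuasiCompact sY] [IsSeparated sY] [IsSeparated sS] : IsDominant q := by
  have := hq.quasiCompact
  obtain ⟨t, ht, htq⟩ := hq.exists_fac (q.imageι ≫ sS) q.toImage
    (by rw [Scheme.Hom.toImage_imageι_assoc, hq.comp_struct]) fun σ ↦ by
      rw [← cancel_mono q.imageι, Category.assoc, Scheme.Hom.toImage_imageι, hq.permAction_comp]
  have h : t ≫ q.imageι = 𝟙 S := hq.hom_ext sS (by rw [Category.assoc, ht]) (Category.id_comp _) (by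
    rw [reassoc_of% htq, Scheme.Hom.toImage_imageι, Category.comp_id])
  have : Surjective q.imageι := ⟨fun s ↦ ⟨t s, by rw [← Scheme.Hom.comp_apply, h]; rfl⟩⟩
  rw [← q.toImage_imageι]
  infer_instance

end IsSymmetricQuotient

end

section

open fibrePower AlgebraicGeometry.Scheme

namespace IsSymmetricQuotient

variable {k : Type u} [Field k] {Y S : Scheme.{u}} {sY : Y ⟶ Spec (.of k)} {sS : S ⟶ Spec (.of k)}
  {m : ℕ} {q : (fibrePower k sY m).left ⟶ S}

lemma hasLocalSections [IsAlgClosed k] [IsIntegral Y] [IsIntegral S] [QuasiCompact sY]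
    [IsSeparated sY] [IsSeparated sS] [IsDominant q] (hq : IsSymmetricQuotient sY sS q) (hm : 0 < m)
    (halg : let _ := (functionFieldMap q).toAlgebra;
      Algebra.IsAlgebraic S.functionField (fibrePower k sY m).left.functionField)
    (hY : HasLocalSections (functionFieldAlgebraMap sY).hom) :
    HasLocalSections (functionFieldAlgebraMap sS).hom := by
  have := hq.quasiCompact
  have := hq.isSeparated
  have hfix : ∀ (σ : Equiv.Perm (Fin m)) (y : S.functionField),
      functionFieldMap (permAction k sY m σ).left (functionFieldMap q y) = functionFieldMap q y :=
    fun σ y ↦ congr($(functionFieldMap_comp _ q q (hq.permAction_comp σ)) y).symm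
  refine (fieldPower sY hm).hasLocalSections hm hY (functionFieldMap q) _ (fun x ↦ ?_) hfix ?_
  · rw [fieldPower_emb_base]
    exact congr($(functionFieldMap_algebraMap q hq.comp_struct) x)
  · refine fun x hx ↦ mem_range_functionFieldMap_of_invariant q halg
      (fun σ ↦ (permAction k sY m σ).left) hq.permAction_comp (fun T p h hp hh ↦ ?_) hx
    obtain ⟨t, -, ht⟩ := hq.exists_fac (p ≫ sS) h
      (by rw [reassoc_of% hp, hq.comp_struct]) hh
    exact ⟨t, ht⟩

end IsSymmetricQuotient

end

section

open TensorProduct Algebra.TensorProduct in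
theorem IsAlgClosed.exists_map_mul_eq_map_mul {k A F M : Type*} [Field k] [IsAlgClosed k]
    [CommRing A] [IsReduced A] [Algebra k A] [Algebra.FiniteType k A] [Field F] [Field M]
    [Algebra k F] [Algebra k M] [Algebra F M] [IsScalarTower k F M] {g h : A ⊗[k] M} (hh : h ≠ 0)
    (H : ∀ y : A →ₐ[k] k, evalLeft M y h ≠ 0 → ∃ c : F, evalLeft M y g = c • evalLeft M y h) :
    ∃ g₁ h₁ : A ⊗[k] F, h₁ ≠ 0 ∧
      map (.id k A) (IsScalarTower.toAlgHom k F M) h₁ * g =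
        map (.id k A) (IsScalarTower.toAlgHom k F M) g₁ * h := by
  obtain ⟨y₀, hy₀⟩ := IsAlgClosed.exists_evalLeft_ne_zero hh
  obtain ⟨p, hp⟩ : ∃ p : Module.Dual F M, p (evalLeft M y₀ h) ≠ 0 := by
    by_contra! hc
    exact hy₀ ((Module.forall_dual_apply_eq_zero_iff F _).1 hc)
  let P : A ⊗[k] M →ₗ[k] A ⊗[k] F := (p.restrictScalars k).lTensor A
  have hP : ∀ (y : A →ₐ[k] k) x, evalLeft F y (P x) = p (evalLeft M y x) := by
    intro y x
    induction x with
    | zero => simp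
    | add a b ha hb => simp only [map_add, ha, hb]
    | tmul a b => 
      simp only [P, LinearMap.lTensor_tmul, evalLeft_tmul, LinearMap.restrictScalars_apply]
      exact ((p.restrictScalars k).map_smul _ _).symm
  have hmap : ∀ (y : A →ₐ[k] k) x, evalLeft M y
      (map (.id k A) (IsScalarTower.toAlgHom k F M) x) = algebraMap F M (evalLeft F y x) := by
    intro y x
    induction x with
    | zero => simp
    | add a b ha hb => simp only [map_add, ha, hb]
    | tmul a b => simp [evalLeft_tmul, Algebra.smul_def, ← IsScalarTower.algebraMap_apply]
  refine ⟨P g, P h, fun h0 ↦ hp ?_, ?_⟩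
  · rw [← hP, h0, map_zero]
  · by_contra hne
    obtain ⟨y, hy⟩ := IsAlgClosed.exists_evalLeft_ne_zero (sub_ne_zero.2 hne)
    refine hy ?_
    rw [map_sub, map_mul, map_mul, hmap, hmap, hP, hP]
    by_cases h0 : evalLeft M y h = 0
    · simp [h0]
    · obtain ⟨c, hc⟩ := H y h0
      rw [hc, map_smul, smul_eq_mul, map_mul, Algebra.smul_def]
      ring

namespace AlgebraicGeometry.Scheme

lemma exists_forall_isUnit_factor {S : Scheme.{u}} {B : Type u} [CommRing B] [IsDomain B]
    (μ : Spec (.of B) ⟶ S) {U : S.Opens} (hU : IsAffineOpen U) (f : Γ(S, U))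
    (hμ : (μ ⁻¹ᵁ U : Set (Spec (.of B))).Nonempty) :
    ∃ g h : B, h ≠ 0 ∧ ∀ {Ω : Type u} [CommRing Ω] (χ : B →+* Ω), IsUnit (χ h) →
      ∃ ψ : Γ(S, U) →+* Ω, Spec.map (CommRingCat.ofHom χ) ≫ μ =
        Spec.map (CommRingCat.ofHom ψ) ≫ hU.fromSpec ∧ ψ f * χ h = χ g := by
  obtain ⟨x, hx⟩ := hμ
  obtain ⟨h, hxh, hhU⟩ : ∃ h : B, x ∈ PrimeSpectrum.basicOpen h ∧
      (PrimeSpectrum.basicOpen h : Set (PrimeSpectrum B)) ⊆ (μ ⁻¹ᵁ U : Set (Spec (.of B))) := by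
    obtain ⟨_, ⟨_, ⟨h, rfl⟩, rfl⟩, hxh, hhU⟩ :=
      PrimeSpectrum.isBasis_basic_opens.exists_subset_of_mem_open hx (μ ⁻¹ᵁ U).isOpen
    exact ⟨h, hxh, hhU⟩
  have h0 : h ≠ 0 := by
    rintro rfl
    rw [PrimeSpectrum.basicOpen_zero] at hxh
    exact hxh
  let Bh := Localization.Away h
  let i : Spec (.of Bh) ⟶ Spec (.of B) := Spec.map (CommRingCat.ofHom (algebraMap B Bh))
  have hi : Set.range (i ≫ μ) ⊆ U := by
    rintro _ ⟨z, rfl⟩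
    refine hhU ?_
    change i z ∈ _
    have := PrimeSpectrum.localization_away_comap_range Bh h
    exact this.le ⟨z, rfl⟩
  let c : Spec (.of Bh) ⟶ Spec (.of Γ(S, U)) := IsOpenImmersion.lift hU.fromSpec (i ≫ μ) (by
    rw [IsAffineOpen.range_fromSpec]; exact hi)
  have hc : c ≫ hU.fromSpec = i ≫ μ := IsOpenImmersion.lift_fac _ _ _
  obtain ⟨φ, hφ⟩ := exists_specMap_eq c
  obtain ⟨n, a, ha⟩ := IsLocalization.Away.surj h (φ f)
  refine ⟨a * h, h ^ (n + 1), pow_ne_zero _ h0, fun {Ω} _ χ hχ ↦ ?_⟩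
  rw [map_pow, isUnit_pow_iff (by simp)] at hχ
  let χ' : Bh →+* Ω := IsLocalization.Away.lift h hχ
  have hχ' : χ'.comp (algebraMap B Bh) = χ := IsLocalization.Away.lift_comp h hχ
  refine ⟨χ'.comp φ, ?_, ?_⟩
  · rw [CommRingCat.ofHom_comp φ χ', Spec.map_comp, Category.assoc, hφ, hc, ← hχ',
      CommRingCat.ofHom_comp, Spec.map_comp, Category.assoc]
  · rw [← map_pow] at ha
    rw [pow_succ, map_mul, map_mul, ← mul_assoc, RingHom.comp_apply, ← hχ', RingHom.comp_apply,
      RingHom.comp_apply, RingHom.comp_apply, ← map_mul, ha]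

end AlgebraicGeometry.Scheme

end

section

namespace AlgebraicGeometry.Scheme

lemma exists_finiteType_specMap_eq {k : Type u} [Field k] {Y : Scheme.{u}}
    (sY : Y ⟶ Spec (.of k)) [LocallyOfFiniteType sY] {V : Y.Opens} (hV : IsAffineOpen V) :
    ∃ c : k →+* Γ(Y, V), c.FiniteType ∧ Spec.map (CommRingCat.ofHom c) = hV.fromSpec ≫ sY := by
  obtain ⟨c, hc⟩ := exists_specMap_eq (A := k) (B := Γ(Y, V)) (hV.fromSpec ≫ sY)
  refine ⟨c, ?_, hc⟩
  have : LocallyOfFiniteType (Spec.map (CommRingCat.ofHom c)) := by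
    rw [hc]
    infer_instance
  exact HasRingHomProperty.Spec_iff.mp this

open TensorProduct Algebra.TensorProduct in
lemma exists_mono_spec_tensorProduct {k A M : Type u} [Field k] [CommRing A] [CommRing M]
    [Algebra k A] [Algebra k M] {Y Z : Scheme.{u}} {sY : Y ⟶ Spec (.of k)} {sZ : Z ⟶ Spec (.of k)}
    (j : Spec (.of A) ⟶ Y) [Mono j] (hj : j ≫ sY = Spec.map (CommRingCat.ofHom (algebraMap k A)))
    (g : Spec (.of M) ⟶ Z) [Mono g] (hg : g ≫ sZ = Spec.map (CommRingCat.ofHom (algebraMap k M))) :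
    ∃ ι : Spec (.of (A ⊗[k] M)) ⟶ pullback sY sZ, Mono ι ∧
      ι ≫ pullback.fst sY sZ = Spec.map (CommRingCat.ofHom includeLeftRingHom) ≫ j ∧
      ι ≫ pullback.snd sY sZ =
        Spec.map (CommRingCat.ofHom (includeRight : M →ₐ[k] A ⊗[k] M).toRingHom) ≫ g := by
  let m : pullback (Spec.map (CommRingCat.ofHom (algebraMap k A)))
      (Spec.map (CommRingCat.ofHom (algebraMap k M))) ⟶ pullback sY sZ :=
    pullback.map _ _ _ _ j g (𝟙 _) (by simp [hj]) (by simp [hg])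
  have hm₁ : m ≫ pullback.fst _ _ = pullback.fst _ _ ≫ j := pullback.lift_fst _ _ _
  have hm₂ : m ≫ pullback.snd _ _ = pullback.snd _ _ ≫ g := pullback.lift_snd _ _ _
  have : Mono m := ⟨fun u v h ↦ pullback.hom_ext
    ((cancel_mono j).1 (by simp only [Category.assoc, ← hm₁, reassoc_of% h]))
    ((cancel_mono g).1 (by simp only [Category.assoc, ← hm₂, reassoc_of% h]))⟩
  refine ⟨(pullbackSpecIso k A M).inv ≫ m, inferInstance, ?_, ?_⟩
  · rw [Category.assoc, hm₁, ← Category.assoc, pullbackSpecIso_inv_fst]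
  · rw [Category.assoc, hm₂, ← Category.assoc, pullbackSpecIso_inv_snd]
    rfl

lemma injective_of_specMap_comp_eq_genericSpec {X : Scheme.{u}} [IsIntegral X] {B : Type u}
    [CommRing B] [IsDomain B] (ι : Spec (.of B) ⟶ X) [Mono ι] (χ : B →+* X.functionField)
    (h : Spec.map (CommRingCat.ofHom χ) ≫ ι = X.genericSpec) : Function.Injective χ := by
  let p : PrimeSpectrum B := Spec.map (CommRingCat.ofHom χ) (specClosedPoint X.functionField)
  have hp : ι p = genericPoint X := by
    rw [← genericSpec_specClosedPoint, ← h]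
    rfl
  have h1 : ι (⊥ : PrimeSpectrum B) ⤳ ι p :=
    ((PrimeSpectrum.le_iff_specializes _ _).1 bot_le).map ι.continuous
  rw [hp] at h1
  have h2 : (⊥ : PrimeSpectrum B) = p :=
    ι.injective ((h1.antisymm (genericPoint_specializes _)).eq.trans hp.symm)
  have h3 : p.asIdeal = RingHom.ker χ := by
    have : (specClosedPoint X.functionField : PrimeSpectrum X.functionField).asIdeal = ⊥ :=
      IsLocalRing.maximalIdeal_eq_bot
    change Ideal.comap χ (specClosedPoint X.functionField : PrimeSpectrum X.functionField).asIdeal = _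
    rw [this]
    rfl
  rw [RingHom.injective_iff_ker_eq_bot, ← h3, ← h2]
  rfl

instance {k : Type u} [Field k] {Y Z : Scheme.{u}} [Nonempty Y] (sY : Y ⟶ Spec (.of k)) (sZ : Z ⟶ Spec (.of k))
     : Surjective (pullback.snd sY sZ) := by
  have : Surjective sY := ⟨fun x ↦ ⟨Classical.arbitrary Y, Subsingleton.elim (α := PrimeSpectrum k) _ _⟩⟩
  infer_instance

instance {k : Type u} [Field k] {Y Z : Scheme.{u}} [Nonempty Z] (sY : Y ⟶ Spec (.of k)) (sZ : Z ⟶ Spec (.of k))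
     : Surjective (pullback.fst sY sZ) := by
  have : Surjective sZ := ⟨fun x ↦ ⟨Classical.arbitrary Z, Subsingleton.elim (α := PrimeSpectrum k) _ _⟩⟩
  infer_instance

lemma isDominant_pullback_lift {k : Type u} [Field k] {Y Z Z' : Scheme.{u}} (sY : Y ⟶ Spec (.of k))
    [LocallyOfFiniteType sY] (sZ : Z ⟶ Spec (.of k)) (sZ' : Z' ⟶ Spec (.of k)) (q : Z ⟶ Z')
    (hq : q ≫ sZ' = sZ) [IsDominant q] :
    IsDominant (pullback.lift (pullback.fst sY sZ) (pullback.snd sY sZ ≫ q)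
      (by rw [Category.assoc, hq, pullback.condition]) : pullback sY sZ ⟶ pullback sY sZ') := by
  let π : pullback sY sZ ⟶ pullback sY sZ' := pullback.lift (pullback.fst sY sZ)
    (pullback.snd sY sZ ≫ q) (by rw [Category.assoc, hq, pullback.condition])
  have hπ₁ : π ≫ pullback.fst _ _ = pullback.fst _ _ := pullback.lift_fst _ _ _
  have hπ₂ : π ≫ pullback.snd _ _ = pullback.snd _ _ ≫ q := pullback.lift_snd _ _ _
  refine ⟨?_⟩
  have hd : Dense ((pullback.snd sY sZ') ⁻¹' Set.range q) :=
    q.denseRange.preimage (pullback.snd sY sZ').isOpenMap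
  refine hd.mono ?_
  rintro x ⟨z, hz⟩
  obtain ⟨w, hw, -⟩ := Scheme.Pullback.exists_preimage_pullback (f := pullback.snd sY sZ') (g := q)
    x z hz.symm
  let l : pullback (pullback.snd sY sZ') q ⟶ pullback sY sZ :=
    pullback.lift (pullback.fst _ _ ≫ pullback.fst sY sZ') (pullback.snd _ _) (by
      rw [← hq, ← pullback.condition_assoc, Category.assoc, pullback.condition])
  have hl : l ≫ π = pullback.fst (pullback.snd sY sZ') q := by
    refine pullback.hom_ext ?_ ?_
    · rw [Category.assoc, hπ₁, pullback.lift_fst]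
    · rw [Category.assoc, hπ₂, pullback.lift_snd_assoc, pullback.condition]
  refine ⟨l w, ?_⟩
  rw [← hw, ← hl]
  rfl

end AlgebraicGeometry.Scheme

end

section

namespace AlgebraicGeometry.Scheme

lemma germToFunctionField_comp_eq {k : Type u} [Field k] {Y : Scheme.{u}} [IsIntegral Y]
    {sY : Y ⟶ Spec (.of k)} {V : Y.Opens} [Nonempty V] (hV : IsAffineOpen V) {c : k →+* Γ(Y, V)}
    (hc : Spec.map (CommRingCat.ofHom c) = hV.fromSpec ≫ sY) :
    (Y.germToFunctionField V).hom.comp c = (functionFieldAlgebraMap sY).hom := by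
  refine specMap_injective ?_
  rw [CommRingCat.ofHom_comp, Spec.map_comp, hc, ← genericSpec_comp_eq_specMap,
    genericSpec_eq_of_isAffineOpen hV, Category.assoc]

open TensorProduct Algebra.TensorProduct in
lemma exists_tensorProduct_chart {k A M : Type u} [Field k] [IsAlgClosed k] {Y Z : Scheme.{u}}
    [IsIntegral Y] [IsIntegral Z] {sY : Y ⟶ Spec (.of k)} {sZ : Z ⟶ Spec (.of k)}
    [IsIntegral (pullback sY sZ)] [CommRing A] [IsDomain A] [Algebra k A] [Field M] [Algebra k M]
    (j : Spec (.of A) ⟶ Y) [Mono j] (hj : j ≫ sY = Spec.map (CommRingCat.ofHom (algebraMap k A)))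
    (g : Spec (.of M) ⟶ Z) [Mono g] (hg : g ≫ sZ = Spec.map (CommRingCat.ofHom (algebraMap k M)))
    (α : A →+* Y.functionField) (hα : Spec.map (CommRingCat.ofHom α) ≫ j = Y.genericSpec)
    (β : M →+* Z.functionField) (hβ : Spec.map (CommRingCat.ofHom β) ≫ g = Z.genericSpec) :
    ∃ (ι : Spec (.of (A ⊗[k] M)) ⟶ pullback sY sZ)
      (χ : A ⊗[k] M →+* (pullback sY sZ).functionField), Mono ι ∧
      ι ≫ pullback.fst sY sZ = Spec.map (CommRingCat.ofHom includeLeftRingHom) ≫ j ∧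
      ι ≫ pullback.snd sY sZ =
        Spec.map (CommRingCat.ofHom (includeRight : M →ₐ[k] A ⊗[k] M).toRingHom) ≫ g ∧
      Spec.map (CommRingCat.ofHom χ) ≫ ι = (pullback sY sZ).genericSpec ∧
      Function.Injective χ ∧
      ∀ a b, χ (a ⊗ₜ b) = functionFieldMap (pullback.fst sY sZ) (α a) *
        functionFieldMap (pullback.snd sY sZ) (β b) := by
  have : IsDomain (A ⊗[k] M) := IsAlgClosed.isDomain_tensorProduct A M
  obtain ⟨ι, hι, hι₁, hι₂⟩ := exists_mono_spec_tensorProduct j hj g hg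
  let _ : Algebra k (pullback sY sZ).functionField :=
    (functionFieldAlgebraMap (pullback.fst sY sZ ≫ sY)).hom.toAlgebra
  have hα' : α.comp (algebraMap k A) = (functionFieldAlgebraMap sY).hom := by
    refine specMap_injective ?_
    rw [CommRingCat.ofHom_comp, Spec.map_comp, ← hj, reassoc_of% hα, genericSpec_comp_eq_specMap]
  have hβ' : β.comp (algebraMap k M) = (functionFieldAlgebraMap sZ).hom := by
    refine specMap_injective ?_
    rw [CommRingCat.ofHom_comp, Spec.map_comp, ← hg, reassoc_of% hβ, genericSpec_comp_eq_specMap]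
  let α' : A →ₐ[k] (pullback sY sZ).functionField :=
    ⟨(functionFieldMap (pullback.fst sY sZ)).comp α, fun x ↦ by
      have := functionFieldMap_algebraMap (pullback.fst sY sZ) (sS := sY) rfl
      rw [← hα'] at this
      exact RingHom.congr_fun this x⟩
  let β' : M →ₐ[k] (pullback sY sZ).functionField :=
    ⟨(functionFieldMap (pullback.snd sY sZ)).comp β, fun x ↦ by
      have := functionFieldMap_algebraMap (pullback.snd sY sZ) (sS := sZ) pullback.condition.symm
      rw [← hβ'] at this
      exact RingHom.congr_fun this x⟩
  let χ : A ⊗[k] M →ₐ[k] (pullback sY sZ).functionField :=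
    Algebra.TensorProduct.lift α' β' (fun _ _ ↦ .all _ _)
  have hχι : Spec.map (CommRingCat.ofHom χ.toRingHom) ≫ ι = (pullback sY sZ).genericSpec := by
    refine pullback.hom_ext ?_ ?_
    · have : χ.toRingHom.comp includeLeftRingHom = α'.toRingHom :=
        RingHom.ext fun x ↦ by simp [χ]
      rw [Category.assoc, hι₁, genericSpec_comp, ← hα, ← Spec.map_comp_assoc,
        ← Spec.map_comp_assoc]
      exact congrArg (fun t ↦ Spec.map (CommRingCat.ofHom t) ≫ j) this
    · have : χ.toRingHom.comp (includeRight : M →ₐ[k] A ⊗[k] M).toRingHom = β'.toRingHom :=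
        RingHom.ext fun x ↦ by simp [χ]
      rw [Category.assoc, hι₂, genericSpec_comp, ← hβ, ← Spec.map_comp_assoc,
        ← Spec.map_comp_assoc]
      exact congrArg (fun t ↦ Spec.map (CommRingCat.ofHom t) ≫ g) this
  refine ⟨ι, χ.toRingHom, hι, hι₁, hι₂, hχι,
    injective_of_specMap_comp_eq_genericSpec ι χ.toRingHom hχι, fun a b ↦ ?_⟩
  exact lift_tmul _ _ _ _ _

open TensorProduct Algebra.TensorProduct in
lemma range_functionFieldMap_le {k : Type u} [Field k] [IsAlgClosed k] {Y Z Z' S : Scheme.{u}}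
    [IsIntegral Y] [IsIntegral Z] [IsIntegral Z'] [IsIntegral S] (sY : Y ⟶ Spec (.of k))
    [LocallyOfFiniteType sY] (sZ : Z ⟶ Spec (.of k)) (sZ' : Z' ⟶ Spec (.of k))
    [IsIntegral (pullback sY sZ)] [IsIntegral (pullback sY sZ')]
    (q : Z ⟶ Z') [IsDominant q] (hq : q ≫ sZ' = sZ)
    (π : pullback sY sZ ⟶ pullback sY sZ') [IsDominant π]
    (hπ₁ : π ≫ pullback.fst _ _ = pullback.fst _ _)
    (hπ₂ : π ≫ pullback.snd _ _ = pullback.snd _ _ ≫ q)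
    (Q : pullback sY sZ ⟶ S) [IsDominant Q]
    (H : ∀ y : Spec (.of k) ⟶ Y, y ≫ sY = 𝟙 _ → ∀ i : Z ⟶ pullback sY sZ,
      i ≫ pullback.fst _ _ = sZ ≫ y → i ≫ pullback.snd _ _ = 𝟙 Z → ∃ r : Z' ⟶ S, i ≫ Q = q ≫ r) :
    (functionFieldMap Q).range ≤ (functionFieldMap π).range := by
  obtain ⟨V, hV, hxV⟩ := exists_isAffineOpen_mem Y (genericPoint Y)
  have : Nonempty V := ⟨⟨_, hxV⟩⟩
  obtain ⟨c, hcft, hc⟩ := exists_finiteType_specMap_eq sY hV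
  let A : Type u := Γ(Y, V)
  let M : Type u := Z.functionField
  let F : Type u := Z'.functionField
  let N : Type u := (pullback sY sZ).functionField
  let _ : Field M := inferInstanceAs (Field Z.functionField)
  let _ : Field F := inferInstanceAs (Field Z'.functionField)
  let _ : Field N := inferInstanceAs (Field (pullback sY sZ).functionField)
  have : IsDomain A := inferInstanceAs (IsDomain Γ(Y, V))
  let _ : Algebra k A := c.toAlgebra
  let _ : Algebra k M := (functionFieldAlgebraMap sZ).hom.toAlgebra
  let _ : Algebra k F := (functionFieldAlgebraMap sZ').hom.toAlgebra
  let _ : Algebra F M := (functionFieldMap q).toAlgebra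
  have : IsScalarTower k F M := .of_algebraMap_eq' (functionFieldMap_algebraMap q hq).symm
  have : Algebra.FiniteType k A := hcft
  have : IsDomain (A ⊗[k] M) := IsAlgClosed.isDomain_tensorProduct A M
  obtain ⟨ι, χ, hι, hι₁, hι₂, hχι, hχ, hχt⟩ := exists_tensorProduct_chart (A := A) (M := M)
    (sY := sY) (sZ := sZ) hV.fromSpec hc.symm Z.genericSpec (genericSpec_comp_eq_specMap sZ)
    (Y.germToFunctionField V).hom (genericSpec_eq_of_isAffineOpen hV).symm (RingHom.id _)
    (by rw [CommRingCat.ofHom_id, Spec.map_id]; exact Category.id_comp _)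
  obtain ⟨U, hU, hxU⟩ := exists_isAffineOpen_mem S (genericPoint S)
  have : Nonempty U := ⟨⟨_, hxU⟩⟩
  suffices hf : ∀ f : Γ(S, U),
      functionFieldMap Q (S.germToFunctionField U f) ∈ (functionFieldMap π).fieldRange by
    rintro _ ⟨s, rfl⟩
    have := functionField_isFractionRing_of_isAffineOpen S U hU
    obtain ⟨a, b, -, rfl⟩ := IsFractionRing.div_surjective (A := Γ(S, U)) s
    have : functionFieldMap Q (algebraMap Γ(S, U) S.functionField a /
      algebraMap Γ(S, U) S.functionField b) ∈ (functionFieldMap π).fieldRange := by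
      rw [map_div₀]
      exact div_mem (hf a) (hf b)
    exact this
  intro f
  have hrange : ∀ x : A ⊗[k] F, χ (map (.id k A) (IsScalarTower.toAlgHom k F M) x) ∈
      (functionFieldMap π).fieldRange := by
    intro x
    induction x with
    | zero => simp only [map_zero]; exact zero_mem _
    | add a b ha hb => simp only [map_add]; exact add_mem ha hb
    | tmul a b =>
      rw [Algebra.TensorProduct.map_tmul, hχt]
      refine mul_mem ⟨functionFieldMap (pullback.fst sY sZ') (Y.germToFunctionField V a), ?_⟩
        ⟨functionFieldMap (pullback.snd sY sZ') b, ?_⟩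
      · exact RingHom.congr_fun (functionFieldMap_comp π _ _ hπ₁).symm _
      · have : IsDominant (pullback.snd sY sZ ≫ q) := inferInstance
        exact RingHom.congr_fun ((functionFieldMap_comp π _ _ hπ₂).symm.trans
          (functionFieldMap_comp _ _ _ rfl)) b
  have hinj : Function.Injective (map (.id k A) (IsScalarTower.toAlgHom k F M)) :=
    Module.Flat.lTensor_preserves_injective_linearMap (M := A)
      (IsScalarTower.toAlgHom k F M).toLinearMap (algebraMap F M).injective
  obtain ⟨g, h, h0, hgh⟩ := exists_forall_isUnit_factor (ι ≫ Q) hU f (by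
    refine ⟨Spec.map (CommRingCat.ofHom χ) (specClosedPoint _), ?_⟩
    have h1 : (Spec.map (CommRingCat.ofHom χ) ≫ ι ≫ Q) (specClosedPoint _) =
        genericPoint S := by
      rw [reassoc_of% hχι, genericSpec_comp, specMap_comp_specClosedPoint,
        genericSpec_specClosedPoint]
    exact (congrArg (· ∈ U) h1).mpr hxU)
  obtain ⟨ψ, hψ, hψf⟩ := hgh χ (IsUnit.mk0 (G₀ := N) _ ((map_ne_zero_iff χ hχ).2 h0))
  have hψQ : ψ = (functionFieldMap Q).comp (S.germToFunctionField U).hom := by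
    refine specMap_injective ((cancel_mono hU.fromSpec).1 ?_)
    rw [← hψ, reassoc_of% hχι, genericSpec_comp, genericSpec_eq_of_isAffineOpen hU,
      CommRingCat.ofHom_comp, Spec.map_comp, Category.assoc]
  obtain ⟨g₁, h₁, h₁0, he⟩ := IsAlgClosed.exists_map_mul_eq_map_mul (F := F) (g := g) h0 fun y hy ↦ by
    obtain ⟨ψ', hψ', hψf'⟩ := hgh (evalLeft M y).toRingHom (IsUnit.mk0 (G₀ := M) _ hy)
    let y' : Spec (.of k) ⟶ Y := Spec.map (CommRingCat.ofHom y.toRingHom) ≫ hV.fromSpec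
    have hy' : y' ≫ sY = 𝟙 _ := by
      rw [Category.assoc, ← hc, ← Spec.map_comp, ← CommRingCat.ofHom_comp,
        show y.toRingHom.comp c = RingHom.id k from y.comp_algebraMap, CommRingCat.ofHom_id,
        Spec.map_id]
    let i : Z ⟶ pullback sY sZ := pullback.lift (sZ ≫ y') (𝟙 Z) (by simp [hy'])
    have hi₁ : i ≫ pullback.fst _ _ = sZ ≫ y' := pullback.lift_fst _ _ _
    have hi₂ : i ≫ pullback.snd _ _ = 𝟙 Z := pullback.lift_snd _ _ _
    obtain ⟨r, hr⟩ := H y' hy' i hi₁ hi₂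
    have hi : Spec.map (CommRingCat.ofHom (evalLeft M y).toRingHom) ≫ ι = Z.genericSpec ≫ i := by
      refine pullback.hom_ext ?_ ?_
      · have : (evalLeft M y).toRingHom.comp includeLeftRingHom =
            (algebraMap k M).comp y.toRingHom := RingHom.ext fun a ↦ by
          simp [evalLeft_tmul, Algebra.smul_def]
        rw [Category.assoc, Category.assoc, hι₁, hi₁, ← Spec.map_comp_assoc,
          ← CommRingCat.ofHom_comp, this, CommRingCat.ofHom_comp, Spec.map_comp_assoc]
        exact (congrArg (· ≫ y') (genericSpec_comp_eq_specMap sZ)).symm.trans (Category.assoc _ _ _)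
      · have : (evalLeft M y).toRingHom.comp (includeRight : M →ₐ[k] A ⊗[k] M).toRingHom =
            RingHom.id M := RingHom.ext fun a ↦ by
          simp [evalLeft_tmul]
        rw [Category.assoc, Category.assoc, hι₂, hi₂, ← Spec.map_comp_assoc,
          ← CommRingCat.ofHom_comp, this, CommRingCat.ofHom_id, Spec.map_id, Category.id_comp,
          Category.comp_id]
    rw [reassoc_of% hi, hr, reassoc_of% genericSpec_comp] at hψ'
    obtain ⟨ρ', hρ'⟩ := exists_lift_of_isOpenImmersion (Z'.genericSpec ≫ r) hU.fromSpec (by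
      rw [← specMap_comp_specClosedPoint (functionFieldMap q), hψ']
      exact ⟨_, rfl⟩)
    obtain ⟨ρ, rfl⟩ := exists_specMap_eq (A := Γ(S, U)) (B := F) ρ'
    have hρ : ψ' = (functionFieldMap q).comp ρ := by
      refine specMap_injective ((cancel_mono hU.fromSpec).1 ?_)
      rw [← hψ', CommRingCat.ofHom_comp, Spec.map_comp, Category.assoc]
      exact congrArg _ hρ'.symm
    refine ⟨ρ f, ?_⟩
    rw [Algebra.smul_def]
    refine hψf'.symm.trans ?_
    rw [hρ]
    rfl
  have h2 : χ (map (.id k A) (IsScalarTower.toAlgHom k F M) h₁) ≠ 0 :=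
    (map_ne_zero_iff χ hχ).2 ((map_ne_zero_iff _ hinj).2 h₁0)
  have h3 : ψ f = χ (map (.id k A) (IsScalarTower.toAlgHom k F M) g₁) /
      χ (map (.id k A) (IsScalarTower.toAlgHom k F M) h₁) := by
    rw [eq_div_iff h2]
    refine mul_right_cancel₀ ((map_ne_zero_iff χ hχ).2 h0) ?_
    rw [← map_mul, ← he, map_mul, ← (show _ = χ g from hψf)]
    change ψ f * _ * χ h = _ * (ψ f * χ h)
    ring
  have h4 : ψ f ∈ (functionFieldMap π).fieldRange := by
    rw [h3]
    exact div_mem (hrange _) (hrange _)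
  rw [hψQ] at h4
  exact h4

end AlgebraicGeometry.Scheme

end

section

open TensorProduct Algebra.TensorProduct in
lemma IsAlgClosed.isAlgebraic_of_tensorProduct {k A F M : Type*} [Field k] [IsAlgClosed k]
    [CommRing A] [IsReduced A] [Algebra k A] [Algebra.FiniteType k A] [Field F] [Field M]
    [Algebra k F] [Algebra k M] [Algebra F M] [IsScalarTower k F M] {m : M}
    {p : Polynomial (A ⊗[k] F)} (hp : p ≠ 0)
    (h : p.eval₂ (map (.id k A) (IsScalarTower.toAlgHom k F M)).toRingHom (1 ⊗ₜ[k] m) = 0) :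
    IsAlgebraic F m := by
  obtain ⟨n, hn⟩ : ∃ n, p.coeff n ≠ 0 := by
    by_contra! hc
    exact hp (Polynomial.ext hc)
  obtain ⟨y, hy⟩ := IsAlgClosed.exists_evalLeft_ne_zero hn
  have hmap : ((evalLeft M y).toRingHom.comp
      (map (.id k A) (IsScalarTower.toAlgHom k F M)).toRingHom) =
        (algebraMap F M).comp (evalLeft F y).toRingHom := by
    refine RingHom.ext fun x ↦ ?_
    induction x with
    | zero => simp
    | add a b ha hb => simp only [map_add, ha, hb]
    | tmul a b =>
      simp [evalLeft_tmul, Algebra.smul_def, ← IsScalarTower.algebraMap_apply]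
  refine ⟨p.map (evalLeft F y).toRingHom, fun h0 ↦ hy ?_, ?_⟩
  · have := congrArg (Polynomial.coeff · n) h0
    rwa [Polynomial.coeff_map] at this
  · have h1 := congrArg (evalLeft M y).toRingHom h
    rw [Polynomial.hom_eval₂, hmap, map_zero] at h1
    rw [Polynomial.aeval_def, Polynomial.eval₂_map]
    refine Eq.trans ?_ h1
    congr 1
    simp [evalLeft_tmul]

namespace AlgebraicGeometry.Scheme

lemma exists_mul_eq_of_specMap_comp_eq_genericSpec {X : Scheme.{u}} [IsIntegral X] {B : Type u}
    [CommRing B] [IsDomain B] (ι : Spec (.of B) ⟶ X) (χ : B →+* X.functionField)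
    (hχ : Function.Injective χ)
    (h : Spec.map (CommRingCat.ofHom χ) ≫ ι = X.genericSpec) (x : X.functionField) :
    ∃ a b : B, b ≠ 0 ∧ x * χ b = χ a := by
  obtain ⟨U, hU, hxU⟩ := exists_isAffineOpen_mem X (genericPoint X)
  have : Nonempty U := ⟨⟨_, hxU⟩⟩
  have hμ : (ι ⁻¹ᵁ U : Set (Spec (.of B))).Nonempty := by
    refine ⟨Spec.map (CommRingCat.ofHom χ) (specClosedPoint _), ?_⟩
    have h1 : (Spec.map (CommRingCat.ofHom χ) ≫ ι) (specClosedPoint _) = genericPoint X := by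
      rw [h, genericSpec_specClosedPoint]
    exact (congrArg (· ∈ U) h1).mpr hxU
  have key (f : Γ(X, U)) : ∃ a b : B, b ≠ 0 ∧ X.germToFunctionField U f * χ b = χ a := by
    obtain ⟨a, b, hb, hab⟩ := exists_forall_isUnit_factor ι hU f hμ
    obtain ⟨ψ, hψ, hψf⟩ := hab χ (IsUnit.mk0 _ ((map_ne_zero_iff χ hχ).2 hb))
    refine ⟨a, b, hb, ?_⟩
    rw [← hψf]
    congr 1
    refine (RingHom.congr_fun (?_ : ψ = (X.germToFunctionField U).hom) f).symm
    refine specMap_injective ((cancel_mono hU.fromSpec).1 ?_)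
    rw [← hψ, h]
    exact genericSpec_eq_of_isAffineOpen hU
  have := functionField_isFractionRing_of_isAffineOpen X U hU
  obtain ⟨f, g, hg, rfl⟩ := IsFractionRing.div_surjective (A := Γ(X, U)) x
  obtain ⟨a, b, hb, hab⟩ := key f
  obtain ⟨c, d, hd, hcd⟩ := key g
  have hg0 : algebraMap Γ(X, U) X.functionField g ≠ 0 :=
    IsFractionRing.to_map_ne_zero_of_mem_nonZeroDivisors hg
  have hc : c ≠ 0 := by
    rintro rfl
    rw [map_zero, mul_eq_zero] at hcd
    exact hcd.elim hg0 ((map_ne_zero_iff χ hχ).2 hd)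
  refine ⟨a * d, b * c, mul_ne_zero hb hc, ?_⟩
  rw [map_mul, map_mul, ← hab, ← hcd]
  change algebraMap Γ(X, U) X.functionField f / algebraMap Γ(X, U) X.functionField g *
    (χ b * (algebraMap Γ(X, U) X.functionField g * χ d)) =
      algebraMap Γ(X, U) X.functionField f * χ b * χ d
  field_simp

end AlgebraicGeometry.Scheme

end

section

namespace AlgebraicGeometry.Scheme

open TensorProduct Algebra.TensorProduct in
lemma isAlgebraic_of_isAlgebraic_pullback {k : Type u} [Field k] [IsAlgClosed k] {Y Z Z' : Scheme.{u}}
    [IsIntegral Y] [IsIntegral Z] [IsIntegral Z'] (sY : Y ⟶ Spec (.of k))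
    [LocallyOfFiniteType sY] (sZ : Z ⟶ Spec (.of k)) (sZ' : Z' ⟶ Spec (.of k))
    [IsIntegral (pullback sY sZ)] [IsIntegral (pullback sY sZ')]
    (q : Z ⟶ Z') [IsDominant q] (hq : q ≫ sZ' = sZ)
    (π : pullback sY sZ ⟶ pullback sY sZ') [IsDominant π]
    (hπ₁ : π ≫ pullback.fst _ _ = pullback.fst _ _)
    (hπ₂ : π ≫ pullback.snd _ _ = pullback.snd _ _ ≫ q) (m : Z.functionField)
    (hm : let _ := (functionFieldMap π).toAlgebra
      IsAlgebraic (pullback sY sZ').functionField (functionFieldMap (pullback.snd sY sZ) m)) :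
    let _ := (functionFieldMap q).toAlgebra
    IsAlgebraic Z'.functionField m := by
  obtain ⟨V, hV, hxV⟩ := exists_isAffineOpen_mem Y (genericPoint Y)
  have : Nonempty V := ⟨⟨_, hxV⟩⟩
  obtain ⟨c, hcft, hc⟩ := exists_finiteType_specMap_eq sY hV
  let A : Type u := Γ(Y, V)
  let M : Type u := Z.functionField
  let F : Type u := Z'.functionField
  let N : Type u := (pullback sY sZ).functionField
  let N' : Type u := (pullback sY sZ').functionField
  let _ : Field M := inferInstanceAs (Field Z.functionField)
  let _ : Field F := inferInstanceAs (Field Z'.functionField)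
  let _ : Field N := inferInstanceAs (Field (pullback sY sZ).functionField)
  let _ : Field N' := inferInstanceAs (Field (pullback sY sZ').functionField)
  have : IsDomain A := inferInstanceAs (IsDomain Γ(Y, V))
  let _ : Algebra k A := c.toAlgebra
  let _ : Algebra k M := (functionFieldAlgebraMap sZ).hom.toAlgebra
  let _ : Algebra k F := (functionFieldAlgebraMap sZ').hom.toAlgebra
  let _ : Algebra F M := (functionFieldMap q).toAlgebra
  have : IsScalarTower k F M := .of_algebraMap_eq' (functionFieldMap_algebraMap q hq).symm
  have : Algebra.FiniteType k A := hcft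
  have : IsDomain (A ⊗[k] M) := IsAlgClosed.isDomain_tensorProduct A M
  have : IsDomain (A ⊗[k] F) := IsAlgClosed.isDomain_tensorProduct A F
  obtain ⟨ι, χ, hι, hι₁, hι₂, hχι, hχ, hχt⟩ := exists_tensorProduct_chart (A := A) (M := M)
    (sY := sY) (sZ := sZ) hV.fromSpec hc.symm Z.genericSpec (genericSpec_comp_eq_specMap sZ)
    (Y.germToFunctionField V).hom (genericSpec_eq_of_isAffineOpen hV).symm (RingHom.id _)
    (by rw [CommRingCat.ofHom_id, Spec.map_id]; exact Category.id_comp _)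
  obtain ⟨ι', χ', hι', hι₁', hι₂', hχι', hχ', hχt'⟩ := exists_tensorProduct_chart (A := A) (M := F)
    (sY := sY) (sZ := sZ') hV.fromSpec hc.symm Z'.genericSpec (genericSpec_comp_eq_specMap sZ')
    (Y.germToFunctionField V).hom (genericSpec_eq_of_isAffineOpen hV).symm (RingHom.id _)
    (by rw [CommRingCat.ofHom_id, Spec.map_id]; exact Category.id_comp _)
  let ν : A ⊗[k] F →ₐ[k] A ⊗[k] M := map (.id k A) (IsScalarTower.toAlgHom k F M)
  have hν : (functionFieldMap π).comp χ' = χ.comp ν.toRingHom := by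
    refine RingHom.ext fun x ↦ ?_
    induction x with
    | zero => simp
    | add a b ha hb => simp only [map_add, ha, hb]
    | tmul a b =>
      rw [RingHom.comp_apply, hχt', map_mul]
      refine Eq.trans ?_ (hχt a (algebraMap F M b)).symm
      congr 1
      · exact RingHom.congr_fun (functionFieldMap_comp π _ _ hπ₁).symm _
      · have : IsDominant (pullback.snd sY sZ ≫ q) := inferInstance
        exact RingHom.congr_fun ((functionFieldMap_comp π _ _ hπ₂).symm.trans
          (functionFieldMap_comp _ _ _ rfl)) b
  let _ : Algebra (A ⊗[k] F) N' := χ'.toAlgebra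
  let _ : Algebra (A ⊗[k] F) N := (χ.comp ν.toRingHom).toAlgebra
  let _ : Algebra N' N := (functionFieldMap π).toAlgebra
  have : IsScalarTower (A ⊗[k] F) N' N := .of_algebraMap_eq' hν.symm
  have : FaithfulSMul (A ⊗[k] F) N' := (faithfulSMul_iff_algebraMap_injective _ _).2 hχ'
  have : IsFractionRing (A ⊗[k] F) N' := .of_field _ _ fun x ↦ by
    obtain ⟨a, b, hb, hab⟩ := exists_mul_eq_of_specMap_comp_eq_genericSpec ι' χ' hχ' hχι' x
    exact ⟨a, b, (eq_div_iff ((map_ne_zero_iff χ' hχ').2 hb)).2 hab⟩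
  obtain ⟨p, hp, hpm⟩ := (IsFractionRing.isAlgebraic_iff (A ⊗[k] F) N' N).2 hm
  refine IsAlgClosed.isAlgebraic_of_tensorProduct (k := k) (A := A) (F := F) (M := M) hp (hχ ?_)
  rw [map_zero, Polynomial.hom_eval₂]
  refine Eq.trans ?_ hpm
  rw [Polynomial.aeval_def]
  congr 1
  rw [hχt]
  simp

end AlgebraicGeometry.Scheme

end

section

open IntermediateField algebraAdjoinAdjoin in
theorem AlgebraicIndependent.isIntegrallyClosed_adjoin {k E ι : Type*} [Field k] [Field E]
    [Algebra k E] {x : ι → E} (hx : AlgebraicIndependent k x) :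
    IsIntegrallyClosed (Algebra.adjoin k (Set.range x)) :=
  IsIntegrallyClosed.of_equiv hx.aevalEquiv.toRingEquiv

theorem MvPolynomial.pow_succ_ne_X_pow {k ι : Type*} [Field k] (i : ι) (d : ℕ) (hd : 0 < d)
    (u : MvPolynomial ι k) : u ^ (d + 1) ≠ X i ^ d := by
  intro h
  have h' := congrArg (fun p => (aeval (fun _ => (Polynomial.X : Polynomial k)) p).natDegree) h
  simp only [map_pow, aeval_X, Polynomial.natDegree_pow, Polynomial.natDegree_X, mul_one] at h'
  have h₁ : (d + 1) ∣ d := ⟨_, h'.symm⟩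
  exact absurd (Nat.le_of_dvd hd h₁) (by omega)

open IntermediateField algebraAdjoinAdjoin in
/-- In a finitely generated field extension of an algebraically closed field, the elements
having an `n`-th root for every `n` are constants. -/
theorem IsAlgClosed.mem_range_algebraMap_of_forall_exists_pow_eq {k E : Type*} [Field k]
    [IsAlgClosed k] [Field E] [Algebra k E] [Algebra.EssFiniteType k E] {x : E}
    (hx : ∀ n : ℕ, 0 < n → ∃ y, y ^ n = x) : x ∈ (algebraMap k E).range := by
  by_contra hne
  have htr : Transcendental k x := fun h => hne (minpoly.mem_range_of_degree_eq_one k x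
    (IsAlgClosed.degree_eq_one_of_irreducible k (minpoly.irreducible h.isIntegral)))
  obtain ⟨t, hxt, ht⟩ := exists_isTranscendenceBasis_superset (R := k) (s := {x})
    (algebraicIndependent_unique_type_iff.2 htr)
  have hxt : x ∈ t := hxt rfl
  have := ht.isAlgebraic_field
  have hti : AlgebraicIndependent k ((↑) : t → E) := ht.1
  have := hti.isIntegrallyClosed_adjoin
  have := Algebra.EssFiniteType.of_comp k (adjoin k (Set.range ((↑) : t → E))) E
  have := Algebra.finite_of_essFiniteType_of_isAlgebraic
    (F := adjoin k (Set.range ((↑) : t → E))) (E := E)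
  set K := adjoin k (Set.range ((↑) : t → E)) with hK
  set d := Module.finrank K E with hd
  obtain ⟨y, hy⟩ := hx (d + 1) d.succ_pos
  have h₁ := congrArg (Algebra.norm K) hy
  have hxe : x = algebraMap K E (algebraMap (Algebra.adjoin k (Set.range ((↑) : t → E))) K
    (hti.aevalEquiv (MvPolynomial.X ⟨x, hxt⟩))) := by
    rw [← IsScalarTower.algebraMap_apply, hti.algebraMap_aevalEquiv, MvPolynomial.aeval_X]
  rw [hxe, map_pow (Algebra.norm K), Algebra.norm_algebraMap, ← hd,
    ← map_pow (algebraMap (Algebra.adjoin k (Set.range ((↑) : t → E))) K)] at h₁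
  obtain ⟨b, hb⟩ := IsIntegrallyClosed.exists_algebraMap_eq_of_isIntegral_pow
    (R := Algebra.adjoin k (Set.range ((↑) : t → E))) d.succ_pos (h₁ ▸ isIntegral_algebraMap)
  rw [← hb, ← map_pow] at h₁
  have h₂ := FaithfulSMul.algebraMap_injective _ _ h₁
  obtain ⟨u, rfl⟩ := hti.aevalEquiv.surjective b
  rw [← map_pow, ← map_pow] at h₂
  exact MvPolynomial.pow_succ_ne_X_pow _ _ Module.finrank_pos u (hti.aevalEquiv.injective h₂)

theorem IsAlgClosed.range_eq_of_essFiniteType {k E : Type*} [Field k] [IsAlgClosed k] [Field E]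
    {φ ψ : k →+* E} (hφ : φ.EssFiniteType) (hψ : ψ.EssFiniteType) : φ.range = ψ.range := by
  have key : ∀ {φ ψ : k →+* E}, ψ.EssFiniteType → φ.range ≤ ψ.range := by
    rintro φ ψ hψ _ ⟨c, rfl⟩
    let _ := ψ.toAlgebra
    have : Algebra.EssFiniteType k E := hψ
    refine IsAlgClosed.mem_range_algebraMap_of_forall_exists_pow_eq (k := k) fun n hn => ?_
    obtain ⟨z, hz⟩ := IsAlgClosed.exists_pow_nat_eq c hn
    exact ⟨φ z, by rw [← map_pow, hz]⟩
  exact le_antisymm (key hψ) (key hφ)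

end

section

theorem RingHom.trdeg_fieldRange {k E : Type u} [Field k] [Field E] (φ : k →+* E) :
    Algebra.trdeg φ.fieldRange E = (let _ := φ.toAlgebra; Algebra.trdeg k E) := by
  let _ := φ.toAlgebra
  let _ := φ.rangeRestrictField.toAlgebra
  have : IsScalarTower k φ.fieldRange E := IsScalarTower.of_algebraMap_eq' rfl
  have : Algebra.IsAlgebraic k φ.fieldRange := by
    refine ⟨fun x => ?_⟩
    obtain ⟨c, rfl⟩ := φ.rangeRestrictField_bijective.2 x
    exact isAlgebraic_algebraMap c
  rw [← trdeg_add_eq k φ.fieldRange (A := E), trdeg_eq_zero (R := k) (A := φ.fieldRange), zero_add]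

theorem RingHom.isAlgebraic_of_range_comp_eq {k K L N : Type u} [Field k] [Field K] [Field L]
    [Field N] [Algebra K L] [Algebra.IsAlgebraic K L] (κ : k →+* K) (e : L ≃+* N) (j : K →+* N)
    (hj : (j.comp κ).EssFiniteType)
    (h : (j.comp κ).range = ((e : L →+* N).comp ((algebraMap K L).comp κ)).range) :
    let _ := j.toAlgebra
    Algebra.IsAlgebraic K N := by
  have h' : (j.comp κ).fieldRange = ((e : L →+* N).comp ((algebraMap K L).comp κ)).fieldRange :=
    SetLike.ext' (congrArg (fun S : Subring N => (S : Set N)) h)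
  have h₁ := (j.comp κ).trdeg_fieldRange
  rw [h', RingHom.trdeg_fieldRange] at h₁
  let _ := κ.toAlgebra
  let _ := ((algebraMap K L).comp κ).toAlgebra
  have : IsScalarTower k K L := IsScalarTower.of_algebraMap_eq' rfl
  have h₂ : (let _ := ((e : L →+* N).comp ((algebraMap K L).comp κ)).toAlgebra
      Algebra.trdeg k N) = Algebra.trdeg k L := by
    let _ := ((e : L →+* N).comp ((algebraMap K L).comp κ)).toAlgebra
    exact (AlgEquiv.trdeg_eq (AlgEquiv.ofRingEquiv (f := e) fun _ => rfl : L ≃ₐ[k] N)).symm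
  rw [h₂, ← trdeg_add_eq k K (A := L), trdeg_eq_zero (R := K) (A := L), add_zero] at h₁
  let _ := j.toAlgebra
  let _ := (j.comp κ).toAlgebra
  have : IsScalarTower k K N := IsScalarTower.of_algebraMap_eq' rfl
  have : Algebra.EssFiniteType k N := hj
  have h₃ := trdeg_add_eq k K (A := N)
  rw [show Algebra.trdeg k N = Algebra.trdeg k K from h₁.symm] at h₃
  refine trdeg_eq_zero_iff.1 (Cardinal.eq_of_add_eq_add_left (h₃.trans (add_zero _).symm) ?_)
  exact (h₁.trans_lt (trdeg_lt_aleph0 k N))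

end

section

theorem RingHom.EssFiniteType.comp_of_algebra {R S T : Type*} [CommRing R] [CommRing S]
    [CommRing T] [Algebra S T] [Algebra.EssFiniteType S T] {f : R →+* S} (hf : f.EssFiniteType) :
    ((algebraMap S T).comp f).EssFiniteType := by
  let _ := f.toAlgebra
  let _ := ((algebraMap S T).comp f).toAlgebra
  have : IsScalarTower R S T := IsScalarTower.of_algebraMap_eq' rfl
  have : Algebra.EssFiniteType R S := hf
  exact Algebra.EssFiniteType.comp R S T

theorem RingHom.EssFiniteType.comp_ringEquiv {R S T : Type*} [CommRing R] [CommRing S]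
    [CommRing T] {f : R →+* S} (hf : f.EssFiniteType) (e : S ≃+* T) :
    ((e : S →+* T).comp f).EssFiniteType := by
  let _ := (e : S →+* T).toAlgebra
  have : Algebra.FiniteType S T :=
    Algebra.FiniteType.of_surjective (Algebra.ofId S T) e.surjective
  exact hf.comp_of_algebra

theorem AlgebraicGeometry.Scheme.essFiniteType_functionFieldAlgebraMap {k : Type u} [Field k]
    {X : Scheme.{u}} [IsIntegral X] (sX : X ⟶ Spec (.of k)) [LocallyOfFiniteType sX] :
    (functionFieldAlgebraMap sX).hom.EssFiniteType := by
  obtain ⟨U, hU, hx⟩ := exists_isAffineOpen_mem X (genericPoint X)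
  have : Nonempty U := ⟨⟨_, hx⟩⟩
  obtain ⟨c, hc, h⟩ := exists_finiteType_specMap_eq sX hU
  have := functionField_isFractionRing_of_isAffineOpen X U hU
  have := Algebra.EssFiniteType.of_isLocalization (X.functionField) (nonZeroDivisors Γ(X, U))
  rw [← germToFunctionField_comp_eq hU h]
  exact hc.essFiniteType.comp_of_algebra

end

section

namespace IsSymmetricQuotient
open fibrePower Scheme

lemma exists_comp_eq {k : Type u} [Field k] {Y S S' : Scheme.{u}} {sY : Y ⟶ Spec (.of k)}
    {sS : S ⟶ Spec (.of k)} {sS' : S' ⟶ Spec (.of k)} {m : ℕ}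
    {q : (fibrePower k sY (m + 1)).left ⟶ S} {q' : (fibrePower k sY m).left ⟶ S'}
    (hq : IsSymmetricQuotient sY sS q) (hq' : IsSymmetricQuotient sY sS' q')
    (e : (fibrePower k sY (m + 1)).left ≅ pullback sY (struct sY m))
    (he₀ : e.hom ≫ pullback.fst _ _ = proj sY (m + 1) 0)
    (he : ∀ i, e.hom ≫ pullback.snd _ _ ≫ proj sY m i = proj sY (m + 1) i.succ)
    {y : Spec (.of k) ⟶ Y} {i : (fibrePower k sY m).left ⟶ pullback sY (struct sY m)}
    (hi₁ : i ≫ pullback.fst _ _ = struct sY m ≫ y) (hi₂ : i ≫ pullback.snd _ _ = 𝟙 _) :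
    ∃ r : S' ⟶ S, i ≫ e.inv ≫ q = q' ≫ r := by
  have he₀' : e.inv ≫ proj sY (m + 1) 0 = pullback.fst _ _ := by
    rw [← he₀, Iso.inv_hom_id_assoc]
  have he' : ∀ j, e.inv ≫ proj sY (m + 1) j.succ = pullback.snd _ _ ≫ proj sY m j := fun j ↦ by
    rw [← he, Iso.inv_hom_id_assoc]
  have hs : i ≫ e.inv ≫ struct sY (m + 1) = struct sY m := by
    rw [← proj_comp (sY := sY) (0 : Fin (m + 1)), reassoc_of% he₀', pullback.condition,
      reassoc_of% hi₂]
  obtain ⟨r, -, hr⟩ := hq'.exists_fac sS (i ≫ e.inv ≫ q)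
    (by rw [Category.assoc, Category.assoc, hq.comp_struct, hs]) fun σ ↦ by
      conv_rhs => rw [← hq.permAction_comp (Equiv.Perm.decomposeFin.symm (0, σ))]
      simp only [← Category.assoc]
      refine congrArg (· ≫ q) (fibrePower.hom_ext (sY := sY) ?_ fun j ↦ ?_)
      · simp only [Category.assoc]
        rw [hs, permAction_left_struct, permAction_left_struct, hs]
      · simp only [Category.assoc]
        rw [permAction_left_proj]
        cases j using Fin.cases with
        | zero =>
          rw [Equiv.Perm.decomposeFin_symm_apply_zero, he₀', hi₁,
            reassoc_of% permAction_left_struct]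
        | succ j =>
          rw [Equiv.Perm.decomposeFin_symm_apply_succ, Equiv.swap_self, Equiv.refl_apply, he', he',
            reassoc_of% hi₂, reassoc_of% hi₂, permAction_left_proj]
  exact ⟨r, hr.symm⟩

end IsSymmetricQuotient

end

section

theorem RingHom.isAlgebraic_map {K A B : Type*} [Field K] [Field A] [Field B] (f : K →+* A)
    (g : K →+* B) (h : A →+* B) (hfg : h.comp f = g) {x : A}
    (hx : let _ := f.toAlgebra; IsAlgebraic K x) :
    let _ := g.toAlgebra
    IsAlgebraic K (h x) := by
  let _ := f.toAlgebra
  let _ := g.toAlgebra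
  exact IsAlgebraic.algHom { h with commutes' := fun r => congr($hfg r) } hx

namespace IsSymmetricQuotient
open fibrePower Scheme

section

variable {k : Type u} [Field k] [IsAlgClosed k] {Y S S' : Scheme.{u}} {sY : Y ⟶ Spec (.of k)}
    {sS : S ⟶ Spec (.of k)} {sS' : S' ⟶ Spec (.of k)} {m : ℕ}
    [IsIntegral Y] [IsIntegral S] [IsIntegral S']
    {q : (fibrePower k sY (m + 1)).left ⟶ S} {q' : (fibrePower k sY m).left ⟶ S'}
    [IsDominant q] [IsDominant q']
    [IsIntegral (pullback sY (struct sY m))] [IsIntegral (pullback sY sS')]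

lemma exists_functionField_ringHom [LocallyOfFiniteType sY]
    (hq : IsSymmetricQuotient sY sS q) (hq' : IsSymmetricQuotient sY sS' q')
    (e : (fibrePower k sY (m + 1)).left ≅ pullback sY (struct sY m))
    (he₀ : e.hom ≫ pullback.fst _ _ = proj sY (m + 1) 0)
    (he : ∀ i, e.hom ≫ pullback.snd _ _ ≫ proj sY m i = proj sY (m + 1) i.succ)
    (π : pullback sY (struct sY m) ⟶ pullback sY sS') [IsDominant π]
    (hπ₁ : π ≫ pullback.fst _ _ = pullback.fst _ _)
    (hπ₂ : π ≫ pullback.snd _ _ = pullback.snd _ _ ≫ q') :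
    ∃ j : S.functionField →+* (pullback sY sS').functionField,
      (functionFieldMap π).comp j = functionFieldMap (e.inv ≫ q) ∧
      j.comp (functionFieldAlgebraMap sS).hom =
        (functionFieldAlgebraMap (pullback.fst sY sS' ≫ sY)).hom := by
  have h := range_functionFieldMap_le sY (struct sY m) sS' q' hq'.comp_struct π hπ₁ hπ₂
    (e.inv ≫ q) fun y _ i hi₁ hi₂ ↦ hq.exists_comp_eq hq' e he₀ he hi₁ hi₂
  obtain ⟨j, hj⟩ := RingHom.exists_comp_eq_of_range_le (functionFieldMap (e.inv ≫ q))
    (functionFieldMap π) (functionFieldMap π).injective h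
  refine ⟨j, hj, ?_⟩
  have h₁ := functionFieldMap_algebraMap (sS := sS) (e.inv ≫ q) rfl
  have h₂ := functionFieldMap_algebraMap (sS := pullback.fst sY sS' ≫ sY) π rfl
  refine RingHom.cancel_left (functionFieldMap π).injective |>.1 ?_
  rw [← RingHom.comp_assoc, hj, h₁, h₂]
  congr 2
  rw [Category.assoc, hq.comp_struct, ← proj_comp (sY := sY) (0 : Fin (m + 1)), ← he₀,
    Category.assoc, Iso.inv_hom_id_assoc, reassoc_of% hπ₁]

lemma isAlgebraic_functionField_succ
    (hq : IsSymmetricQuotient sY sS q)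
    (e : (fibrePower k sY (m + 1)).left ≅ pullback sY (struct sY m))
    (he₀ : e.hom ≫ pullback.fst _ _ = proj sY (m + 1) 0)
    (π : pullback sY (struct sY m) ⟶ pullback sY sS') [IsDominant π]
    (hπ₁ : π ≫ pullback.fst _ _ = pullback.fst _ _)
    (j : S.functionField →+* (pullback sY sS').functionField)
    (hj : (functionFieldMap π).comp j = functionFieldMap (e.inv ≫ q))
    (halg : let _ := j.toAlgebra
      Algebra.IsAlgebraic S.functionField (pullback sY sS').functionField) :
    let _ := (functionFieldMap q).toAlgebra
    Algebra.IsAlgebraic S.functionField (fibrePower k sY (m + 1)).left.functionField := by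
  have hp₁ : (e.hom ≫ π) ≫ pullback.fst sY sS' = proj sY (m + 1) 0 := by
    rw [Category.assoc, hπ₁, he₀]
  have hp₂ : (functionFieldMap (e.hom ≫ π)).comp j = functionFieldMap q := by
    rw [functionFieldMap_comp e.hom π _ rfl, RingHom.comp_assoc, hj]
    exact (functionFieldMap_comp e.hom (e.inv ≫ q) q (by simp)).symm
  have h₀ : ∀ x : Y.functionField, let _ := (functionFieldMap q).toAlgebra
      IsAlgebraic S.functionField (functionFieldMap (proj sY (m + 1) 0) x) := fun x ↦ by
    rw [functionFieldMap_comp (e.hom ≫ π) (pullback.fst sY sS') _ hp₁]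
    refine RingHom.isAlgebraic_map j _ _ hp₂ ?_
    let _ := j.toAlgebra
    exact halg.isAlgebraic _
  have h₁ : ∀ i (x : Y.functionField), let _ := (functionFieldMap q).toAlgebra
      IsAlgebraic S.functionField ((fieldPower sY m.succ_pos).emb i x) := fun i x ↦ by
    have := (fieldPower sY m.succ_pos).act_emb (Equiv.swap 0 i) 0 x
    rw [Equiv.swap_apply_left] at this
    rw [← this]
    exact RingHom.isAlgebraic_map _ _ (functionFieldMap (permAction k sY (m + 1) _).left)
      (functionFieldMap_comp _ _ _ (hq.permAction_comp _)).symm (h₀ x)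
  let _ := (functionFieldMap q).toAlgebra
  have h₂ := (fieldPower sY m.succ_pos).subfield_eq_top
    (algebraicClosure S.functionField (fibrePower k sY (m + 1)).left.functionField).toSubfield
    fun i x ↦ mem_algebraicClosure_iff.2 (h₁ i x)
  refine ⟨fun x ↦ ?_⟩
  have h₃ : x ∈ (⊤ : Subfield (fibrePower k sY (m + 1)).left.functionField) := trivial
  rw [← h₂] at h₃
  exact mem_algebraicClosure_iff.1 h₃

lemma isAlgebraic_functionField [LocallyOfFiniteType sY]
    (hq : IsSymmetricQuotient sY sS q) (hq' : IsSymmetricQuotient sY sS' q')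
    (e : (fibrePower k sY (m + 1)).left ≅ pullback sY (struct sY m))
    (he₀ : e.hom ≫ pullback.fst _ _ = proj sY (m + 1) 0)
    (π : pullback sY (struct sY m) ⟶ pullback sY sS') [IsDominant π]
    (hπ₁ : π ≫ pullback.fst _ _ = pullback.fst _ _)
    (hπ₂ : π ≫ pullback.snd _ _ = pullback.snd _ _ ≫ q')
    (j : S.functionField →+* (pullback sY sS').functionField)
    (hj : (functionFieldMap π).comp j = functionFieldMap (e.inv ≫ q))
    (halg : let _ := j.toAlgebra
      Algebra.IsAlgebraic S.functionField (pullback sY sS').functionField) :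
    let _ := (functionFieldMap q').toAlgebra
    Algebra.IsAlgebraic S'.functionField (fibrePower k sY m).left.functionField := by
  have h₁ := hq.isAlgebraic_functionField_succ e he₀ π hπ₁ j hj halg
  let _ := (functionFieldMap q').toAlgebra
  refine ⟨fun x ↦ isAlgebraic_of_isAlgebraic_pullback sY (struct sY m) sS' q' hq'.comp_struct π
    hπ₁ hπ₂ x ?_⟩
  have h₂ : ∀ y : (pullback sY (struct sY m)).functionField,
      let _ := (functionFieldMap (e.inv ≫ q)).toAlgebra
      IsAlgebraic S.functionField y := fun y ↦ by
    have h₃ := RingHom.isAlgebraic_map (functionFieldMap q) (functionFieldMap (e.inv ≫ q))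
      (functionFieldMap e.inv) (functionFieldMap_comp e.inv q _ rfl).symm
      (x := functionFieldMap e.hom y) (by
        let _ := (functionFieldMap q).toAlgebra
        exact h₁.isAlgebraic _)
    have h₄ : functionFieldMap e.inv (functionFieldMap e.hom y) = y := by
      have := functionFieldMap_comp e.inv e.hom (𝟙 _) e.inv_hom_id
      have h₅ := functionFieldMap_comp (𝟙 (pullback sY (struct sY m))) (𝟙 _) (𝟙 _) (by simp)
      have h₆ : functionFieldMap (𝟙 (pullback sY (struct sY m))) y = y :=
        (functionFieldMap (𝟙 (pullback sY (struct sY m)))).injective congr($h₅ y).symm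
      exact congr($this y).symm.trans h₆
    rwa [h₄] at h₃
  have h₅ := h₂ (functionFieldMap (pullback.snd sY (struct sY m)) x)
  let _ := j.toAlgebra
  let _ := (functionFieldMap π).toAlgebra
  let _ := (functionFieldMap (e.inv ≫ q)).toAlgebra
  have : IsScalarTower S.functionField (pullback sY sS').functionField
      (pullback sY (struct sY m)).functionField := IsScalarTower.of_algebraMap_eq' hj.symm
  exact IsAlgebraic.tower_top _ h₅

end
end IsSymmetricQuotient

end

section

namespace AlgebraicGeometry.Scheme

lemma hasLocalSections_pullback {k : Type u} [Field k] {Y Z : Scheme.{u}} [IsIntegral Y]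
    [IsIntegral Z] (sY : Y ⟶ Spec (.of k)) (sZ : Z ⟶ Spec (.of k)) [IsIntegral (pullback sY sZ)]
    [IsDominant (pullback.fst sY sZ)] [IsDominant (pullback.snd sY sZ)]
    (hY : HasLocalSections (functionFieldAlgebraMap sY).hom)
    (hZ : HasLocalSections (functionFieldAlgebraMap sZ).hom) :
    HasLocalSections (functionFieldAlgebraMap (pullback.fst sY sZ ≫ sY)).hom := by
  intro R _ κ π _ hπ hκ
  have h₁ := functionFieldMap_algebraMap (sS := sY) (pullback.fst sY sZ) rfl
  have h₂ := functionFieldMap_algebraMap (sS := sZ) (pullback.snd sY sZ) pullback.condition.symm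
  have hr : π.range = ⊤ := RingHom.range_eq_top.2 hπ
  obtain ⟨s, hs, hs'⟩ := hY.lift κ π (functionFieldMap (pullback.fst sY sZ))
    (hκ.trans h₁.symm) (hr ▸ le_top)
  obtain ⟨t, ht, ht'⟩ := hZ.lift κ π (functionFieldMap (pullback.snd sY sZ))
    (hκ.trans h₂.symm) (hr ▸ le_top)
  have hs₀ : (Spec.map (CommRingCat.ofHom s) ≫ Y.genericSpec) ≫ sY =
      Spec.map (CommRingCat.ofHom κ) := by
    rw [Category.assoc, genericSpec_comp_eq_specMap, ← Spec.map_comp, ← CommRingCat.ofHom_comp, hs']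
  have ht₀ : (Spec.map (CommRingCat.ofHom t) ≫ Z.genericSpec) ≫ sZ =
      Spec.map (CommRingCat.ofHom κ) := by
    rw [Category.assoc, genericSpec_comp_eq_specMap, ← Spec.map_comp, ← CommRingCat.ofHom_comp, ht']
  obtain ⟨ρ, hρ, hρ'⟩ := exists_ringHom_functionField (X := pullback sY sZ)
    (pullback.lift _ _ (hs₀.trans ht₀.symm)) π (RingHom.id _) (by
      refine pullback.hom_ext ?_ ?_
      · rw [Category.assoc, pullback.lift_fst, ← Category.assoc, ← Spec.map_comp,
          ← CommRingCat.ofHom_comp, hs, Category.assoc, genericSpec_comp]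
        simp
      · rw [Category.assoc, pullback.lift_snd, ← Category.assoc, ← Spec.map_comp,
          ← CommRingCat.ofHom_comp, ht, Category.assoc, genericSpec_comp]
        simp)
  refine ⟨ρ, hρ', specMap_injective ?_⟩
  rw [CommRingCat.ofHom_comp, Spec.map_comp, ← genericSpec_comp_eq_specMap, ← Category.assoc, hρ,
    pullback.lift_fst_assoc, hs₀]

end AlgebraicGeometry.Scheme

end

section

open fibrePower Scheme

theorem IsSymmetricQuotient.hasLocalSections_pullback {k : Type u} [Field k] [IsAlgClosed k]
    {Y S S' : Scheme.{u}} {sY : Y ⟶ Spec (.of k)} {sS : S ⟶ Spec (.of k)} {sS' : S' ⟶ Spec (.of k)}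
    {m : ℕ} [IsIntegral Y] [LocallyOfFiniteType sY] [QuasiCompact sY] [IsSeparated sY]
    [IsIntegral S] [LocallyOfFiniteType sS] [IsSeparated sS]
    [IsIntegral S'] [IsSeparated sS'] [LocallyOfFiniteType sS']
    {q : (fibrePower k sY (m + 1)).left ⟶ S} {q' : (fibrePower k sY m).left ⟶ S'}
    [IsIntegral (pullback sY sS')] (hm : 0 < m)
    (hq : IsSymmetricQuotient sY sS q) (hq' : IsSymmetricQuotient sY sS' q')
    (hY : HasLocalSections (functionFieldAlgebraMap sY).hom)
    {L : Type u} [Field L] [Algebra S.functionField L] [FiniteDimensional S.functionField L]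
    (e : L ≃+* (pullback sY sS').functionField) :
    HasLocalSections (functionFieldAlgebraMap sS).hom ∧
      HasLocalSections ((algebraMap S.functionField L).comp (functionFieldAlgebraMap sS).hom) := by
  have := hq.isDominant
  have := hq'.isDominant
  have := isIntegral_pullback sY (struct sY m)
  have := isDominant_pullback_lift sY (struct sY m) sS' q' hq'.comp_struct
  obtain ⟨i, hi₀, hi⟩ := exists_iso_pullback (sY := sY) (m := m)
  obtain ⟨j, hj, hjk⟩ := hq.exists_functionField_ringHom hq' i hi₀ hi _
    (pullback.lift_fst _ _ _) (pullback.lift_snd _ _ _)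
  have hα := essFiniteType_functionFieldAlgebraMap (pullback.fst sY sS' ≫ sY)
  have hβ := (essFiniteType_functionFieldAlgebraMap sS).comp_of_algebra (T := L)
  have halg := RingHom.isAlgebraic_of_range_comp_eq (functionFieldAlgebraMap sS).hom e j
    (hjk.symm ▸ hα)
    (IsAlgClosed.range_eq_of_essFiniteType (hjk.symm ▸ hα) (hβ.comp_ringEquiv e))
  have hP := Scheme.hasLocalSections_pullback sY sS' hY
    (hq'.hasLocalSections hm (hq.isAlgebraic_functionField hq' i hi₀ _ (pullback.lift_fst _ _ _)
      (pullback.lift_snd _ _ _) j hj halg) hY)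
  exact ⟨hq.hasLocalSections m.succ_pos (hq.isAlgebraic_functionField_succ i hi₀ _
      (pullback.lift_fst _ _ _) j hj halg) hY,
    (hP.of_ringEquiv e.symm).of_range_eq
      (IsAlgClosed.range_eq_of_essFiniteType hβ (hα.comp_ringEquiv e.symm))⟩

end

/-- **The key step in the proof of the main theorem.**  Let `k` be an algebraically
closed field (of arbitrary characteristic), `ℓ` a prime, `n ≥ 3`, and let `X` be a
`k`-variety admitting a dominant morphism `f : X → Sym^ℓ Y` such that (i) `Y` is a
retract rational `k`-variety, and (ii) the generic fibre of `f` is birational over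
`K := k(Sym^ℓ Y)` to the norm hypersurface `{N = a} ⊆ R_{L/K} 𝔾_{m,L}`, where
`L := k(Y × Sym^{ℓ-1} Y)` is a degree-`ℓ` extension of `K` with norm map `N`, and
`a ∈ k^*`.  Then `X` is retract rational over `k`. -/
theorem isRetractRational_of_normHypersurface_fibration
    (k : Type u) [Field k] [IsAlgClosed k] (ℓ n : ℕ) (hℓ : ℓ.Prime) (hn : 3 ≤ n)
    -- the retract rational variety `Y`
    (Y : Scheme.{u}) (sY : Y ⟶ Spec (CommRingCat.of k))
    [IsIntegral Y] [LocallyOfFiniteType sY] [QuasiCompact sY] [IsSeparated sY]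
    (hYrr : IsRetractRational k Y sY)
    -- the symmetric power `S = Sym^ℓ Y`
    (S : Scheme.{u}) (sS : S ⟶ Spec (CommRingCat.of k))
    [IsIntegral S] [LocallyOfFiniteType sS] [QuasiCompact sS] [IsSeparated sS]
    (q : fibrePower k sY ℓ ⟶ Over.mk sS) (hq : IsSymmetricPower k sY sS ℓ q)
    -- the symmetric power `S' = Sym^{ℓ-1} Y`
    (S' : Scheme.{u}) (sS' : S' ⟶ Spec (CommRingCat.of k))
    [IsIntegral S'] [LocallyOfFiniteType sS'] [QuasiCompact sS'] [IsSeparated sS']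
    (q' : fibrePower k sY (ℓ - 1) ⟶ Over.mk sS')
    (hq' : IsSymmetricPower k sY sS' (ℓ - 1) q')
    [IrreducibleSpace (Limits.pullback sY sS' : Scheme.{u})]
    -- the variety `X` with its dominant morphism `f` to `Sym^ℓ Y`
    (X : Scheme.{u}) (sX : X ⟶ Spec (CommRingCat.of k))
    [IsIntegral X] [LocallyOfFiniteType sX] [QuasiCompact sX] [IsSeparated sX]
    (f : X ⟶ S) (hf : f ≫ sS = sX) [IsDominant f]
    -- the generic fibre of `f` is birational over `K = k(Sym^ℓ Y)` to the norm
    -- hypersurface `{N = a}` of a degree-`ℓ` extension `L ≅ k(Y × Sym^{ℓ-1} Y)` of `K`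
    (a : kˣ)
    (hfib : NormHypFibreData k ℓ (a : k) (P := (Limits.pullback sY sS' : Scheme.{u})) f sS) :
    IsRetractRational k X sX := by
  obtain ⟨m, rfl⟩ : ∃ m, ℓ = m + 1 := ⟨ℓ - 1, (Nat.succ_pred hℓ.pos.ne').symm⟩
  have hm : 0 < m := by have := hℓ.two_le; omega
  subst hf
  have := isIntegral_pullback sY sS'
  obtain ⟨L, iL, iA, hfin, ⟨e⟩, ifd, hbir⟩ := hfib
  have hS := hq.isSymmetricQuotient
  have hS' : IsSymmetricQuotient (m := m) sY sS' q'.left := hq'.isSymmetricQuotient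
  obtain ⟨hK, hL⟩ := hS.hasLocalSections_pullback hm hS' hYrr.hasLocalSections e
  exact isRetractRational_of_hasLocalSections _
    (hasLocalSections_of_areBirationalOver sS f (hfin ▸ hℓ) a.ne_zero hbir hK hL)
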